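/- Let d, k, L ∈ ℕ, let P₁,…,P_k : ℤ^L → ℤ be polynomial maps and v₁,…,v_k ∈ ℤ^d, and suppose that the family of polynomial maps n ↦ P_i(n)v_i (1 ≤ i ≤ k) is essentially distinct. Assume that for all 1 ≤ i,j ≤ k with i ≠ j and deg P_i = deg P_j, either there exists (a,b) ∈ ℤ² ∖ {(0,0)} with a·v_i + b·v_j = 0, or there exists (a,b) ∈ ℤ² ∖ {(0,0)} such that a·P_i + b·P_j is a constant polynomial. Let (X, ℬ, μ, (T_g)_{g∈ℤ^d}) be a ℤ^d-measure-preserving system. Then the following are equivalent: (C1) the tuple (T_{P₁(n)v₁},…,T_{P_k(n)v_k})_{n∈ℤ^L} is jointly ergodic for μ; (C2') for all 1 ≤ i,j ≤ k with i ≠ j and deg P_i = deg P_j the sequence (T_{P_i(n)v_i − P_j(n)v_j})_{n∈ℤ^L} is ergodic for μ, and (T_{P₁(n)v₁}×⋯×T_{P_k(n)v_k})_{n∈ℤ^L} is ergodic for μ^{⊗k}; (C2) for all 1 ≤ i,j ≤ k with i ≠ j the sequence (T_{P_i(n)v_i − P_j(n)v_j})_{n∈ℤ^L} is ergodic for μ,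 and (T_{P₁(n)v₁}×⋯×T_{P_k(n)v_k})_{n∈ℤ^L} is ergodic for μ^{⊗k}. -/

import Mathlib

open MeasureTheory Filter Finset
open scoped ENNReal symmDiff

noncomputable section

/-- A Følner sequence in `ℤ^L`: a sequence of nonempty finite subsets that is
asymptotically invariant under all translations. -/
def IsFolner (L : ℕ) (I : ℕ → Finset (Fin L → ℤ)) : Prop :=
  (∀ N, (I N).Nonempty) ∧
    ∀ g : Fin L → ℤ,
      Tendsto (fun N => ((((I N).image (g + ·)) ∆ I N).card : ℝ) / ((I N).card : ℝ))
        atTop (nhds 0)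

/-- The map `q : ℤ^L → ℤ^d` is represented by the family `Q` of polynomials with
rational coefficients. -/
def RepresentedBy {L d : ℕ} (q : (Fin L → ℤ) → Fin d → ℤ)
    (Q : Fin d → MvPolynomial (Fin L) ℚ) : Prop :=
  ∀ n t, ((q n t : ℤ) : ℚ) = MvPolynomial.eval (fun l => ((n l : ℤ) : ℚ)) (Q t)

/-- `q : ℤ^L → ℤ^d` is a polynomial map. -/
def IsPolyMap {L d : ℕ} (q : (Fin L → ℤ) → Fin d → ℤ) : Prop :=
  ∃ Q, RepresentedBy q Q

/-- The scalar map `q : ℤ^L → ℤ` is represented by the polynomial `Q` with rational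
coefficients. -/
def RepresentedBy₁ {L : ℕ} (q : (Fin L → ℤ) → ℤ) (Q : MvPolynomial (Fin L) ℚ) : Prop :=
  ∀ n, ((q n : ℤ) : ℚ) = MvPolynomial.eval (fun l => ((n l : ℤ) : ℚ)) Q

/-- The sequence `(T_{q(n)})_{n ∈ ℤ^L}` is ergodic for `μ`: Følner averages of
`f ∘ T_{q(n)}` converge in `L²(μ)` to `∫ f dμ`, for every bounded measurable `f`. -/
def ErgodicSeq {X : Type*} [MeasurableSpace X] (μ : Measure X) {d L : ℕ}
    (T : (Fin d → ℤ) → X → X) (q : (Fin L → ℤ) → Fin d → ℤ) : Prop :=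
  ∀ f : X → ℂ, Measurable f → (∃ C, ∀ x, ‖f x‖ ≤ C) →
    ∀ I : ℕ → Finset (Fin L → ℤ), IsFolner L I →
      Tendsto (fun N =>
          eLpNorm (fun x => (((I N).card : ℂ))⁻¹ * (∑ n ∈ I N, f (T (q n) x)) - ∫ y, f y ∂μ)
            2 μ)
        atTop (nhds 0)

/-- The tuple `(T_{q_1(n)}, …, T_{q_k(n)})_{n ∈ ℤ^L}` is jointly ergodic for `μ`. -/
def JointlyErgodic {X : Type*} [MeasurableSpace X] (μ : Measure X) {d L k : ℕ}
    (T : (Fin d → ℤ) → X → X) (q : Fin k → (Fin L → ℤ) → Fin d → ℤ) : Prop :=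
  ∀ f : Fin k → X → ℂ, (∀ i, Measurable (f i)) → (∀ i, ∃ C, ∀ x, ‖f i x‖ ≤ C) →
    ∀ I : ℕ → Finset (Fin L → ℤ), IsFolner L I →
      Tendsto (fun N =>
          eLpNorm (fun x => (((I N).card : ℂ))⁻¹ * (∑ n ∈ I N, ∏ i, f i (T (q i n) x)) -
              ∏ i, ∫ y, f i y ∂μ)
            2 μ)
        atTop (nhds 0)

/-- The sequence `(T_{q_1(n)} × ⋯ × T_{q_k(n)})_{n ∈ ℤ^L}` is ergodic for the product
measure `μ^{⊗k}` on `X^k`. -/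
def ProdErgodic {X : Type*} [MeasurableSpace X] (μ : Measure X) {d L k : ℕ}
    (T : (Fin d → ℤ) → X → X) (q : Fin k → (Fin L → ℤ) → Fin d → ℤ) : Prop :=
  ∀ F : (Fin k → X) → ℂ, Measurable F → (∃ C, ∀ x, ‖F x‖ ≤ C) →
    ∀ I : ℕ → Finset (Fin L → ℤ), IsFolner L I →
      Tendsto (fun N =>
          eLpNorm (fun x : Fin k → X =>
              (((I N).card : ℂ))⁻¹ * (∑ n ∈ I N, F (fun i => T (q i n) (x i))) -
                ∫ y, F y ∂(Measure.pi fun _ : Fin k => μ))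
            2 (Measure.pi fun _ : Fin k => μ))
        atTop (nhds 0)

section Degree

variable {G V W : Type*} [AddCommGroup G] [AddCommGroup V] [AddCommGroup W]

/-- `DegLT e q`: all `e`-fold differences of `q` vanish, i.e. `q` is a polynomial map of degree
less than `e`. -/
def DegLT : ℕ → (G → V) → Prop
  | 0, q => ∀ n, q n = 0
  | e + 1, q => ∀ h : G, DegLT e (fun n => q (n + h) - q n)

/-- `LeadAlong η e ℓ q`: along the direction `η`, the `e`-fold difference of `q` with steps
`t₁, …, t_e` is the constant `(t₁ ⋯ t_e) • ℓ`. -/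
def LeadAlong (η : G) : ℕ → V → (G → V) → Prop
  | 0, ℓ, q => ∀ n, q n = ℓ
  | e + 1, ℓ, q => ∀ t : ℤ, LeadAlong η e (t • ℓ) (fun n => q (n + t • η) - q n)

theorem DegLT.zero (e : ℕ) : DegLT e (fun _ : G => (0 : V)) := by
  induction e with
  | zero => intro n; rfl
  | succ e ih => intro h; simpa using ih

theorem DegLT.add {e : ℕ} {p q : G → V} (hp : DegLT e p) (hq : DegLT e q) :
    DegLT e (fun n => p n + q n) := by
  induction e generalizing p q with
  | zero => intro n; simp [hp n, hq n]
  | succ e ih =>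
    intro h
    have := ih (hp h) (hq h)
    convert this using 2
    exact add_sub_add_comm _ _ _ _

theorem DegLT.map (φ : V →+ W) {e : ℕ} {p : G → V} (hp : DegLT e p) :
    DegLT e (fun n => φ (p n)) := by
  induction e generalizing p with
  | zero => intro n; simp [hp n]
  | succ e ih =>
    intro h
    simpa using ih (hp h)

theorem DegLT.of_map (φ : V →+ W) (hφ : Function.Injective φ) {e : ℕ} {p : G → V}
    (hp : DegLT e (fun n => φ (p n))) : DegLT e p := by
  induction e generalizing p with
  | zero => intro n; exact hφ (by simpa using hp n)
  | succ e ih =>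
    intro h
    apply ih
    simpa using hp h

theorem DegLT.neg {e : ℕ} {p : G → V} (hp : DegLT e p) : DegLT e (fun n => -p n) :=
  hp.map (negAddMonoidHom)

theorem DegLT.sub {e : ℕ} {p q : G → V} (hp : DegLT e p) (hq : DegLT e q) :
    DegLT e (fun n => p n - q n) := by
  simpa [sub_eq_add_neg] using hp.add hq.neg

theorem DegLT.shift {e : ℕ} {p : G → V} (hp : DegLT e p) (a : G) :
    DegLT e (fun n => p (n + a)) := by
  induction e generalizing p with
  | zero => intro n; exact hp _
  | succ e ih =>
    intro h
    have := ih (hp h)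
    convert this using 4
    abel

theorem DegLT.succ {e : ℕ} {p : G → V} (hp : DegLT e p) : DegLT (e + 1) p := by
  induction e generalizing p with
  | zero => intro h n; simp [hp n, hp (n + h)]
  | succ e ih => intro h; exact ih (hp h)

theorem DegLT.mono {e e' : ℕ} (h : e ≤ e') {p : G → V} (hp : DegLT e p) : DegLT e' p := by
  induction h with
  | refl => exact hp
  | step _ ih => exact ih.succ

theorem DegLT.diff {e : ℕ} {p : G → V} (hp : DegLT (e + 1) p) (a b : G) :
    DegLT e (fun n => p (n + a) - p (n + b)) := by
  have := (hp a).sub (hp b)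
  convert this using 2
  abel

theorem DegLT.eq_of_one {p : G → V} (hp : DegLT 1 p) (n m : G) : p n = p m := by
  have := hp (n - m) m
  simpa [sub_eq_zero] using this

theorem degLT_const (v : V) {e : ℕ} (he : 1 ≤ e) : DegLT e (fun _ : G => v) := by
  refine DegLT.mono he ?_
  intro h n
  simp

variable {η : G}

theorem LeadAlong.add {e : ℕ} {p q : G → V} {ℓ m : V} (hp : LeadAlong η e ℓ p)
    (hq : LeadAlong η e m q) : LeadAlong η e (ℓ + m) (fun n => p n + q n) := by
  induction e generalizing p q ℓ m with
  | zero => intro n; simp [hp n, hq n]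
  | succ e ih =>
    intro h
    have := ih (hp h) (hq h)
    rw [smul_add]
    convert this using 2
    exact add_sub_add_comm _ _ _ _

theorem LeadAlong.map (φ : V →+ W) {e : ℕ} {p : G → V} {ℓ : V} (hp : LeadAlong η e ℓ p) :
    LeadAlong η e (φ ℓ) (fun n => φ (p n)) := by
  induction e generalizing p ℓ with
  | zero => intro n; simp [hp n]
  | succ e ih =>
    intro h
    simpa using ih (hp h)

theorem LeadAlong.of_map (φ : V →+ W) (hφ : Function.Injective φ) {e : ℕ} {p : G → V} {ℓ : V}
    (hp : LeadAlong η e (φ ℓ) (fun n => φ (p n))) : LeadAlong η e ℓ p := by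
  induction e generalizing p ℓ with
  | zero => intro n; exact hφ (hp n)
  | succ e ih =>
    intro h
    apply ih
    simpa using hp h

theorem LeadAlong.exists_of_map (φ : V →+ W) (hφ : Function.Injective φ) {e : ℕ} {p : G → V}
    {m : W} (hp : LeadAlong η e m (fun n => φ (p n))) : ∃ ℓ, φ ℓ = m ∧ LeadAlong η e ℓ p := by
  suffices h : ∃ ℓ, φ ℓ = m by
    obtain ⟨ℓ, rfl⟩ := h
    exact ⟨ℓ, rfl, hp.of_map φ hφ⟩
  induction e generalizing p m with
  | zero => exact ⟨p 0, hp 0⟩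
  | succ e ih =>
    have := hp 1
    rw [one_smul] at this
    exact ih (p := fun n => p (n + (1 : ℤ) • η) - p n) (by simpa using this)

theorem LeadAlong.neg {e : ℕ} {p : G → V} {ℓ : V} (hp : LeadAlong η e ℓ p) :
    LeadAlong η e (-ℓ) (fun n => -p n) :=
  hp.map (negAddMonoidHom)

theorem LeadAlong.sub {e : ℕ} {p q : G → V} {ℓ m : V} (hp : LeadAlong η e ℓ p)
    (hq : LeadAlong η e m q) : LeadAlong η e (ℓ - m) (fun n => p n - q n) := by
  simpa [sub_eq_add_neg] using hp.add hq.neg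

theorem LeadAlong.shift {e : ℕ} {p : G → V} {ℓ : V} (hp : LeadAlong η e ℓ p) (a : G) :
    LeadAlong η e ℓ (fun n => p (n + a)) := by
  induction e generalizing p ℓ with
  | zero => intro n; exact hp _
  | succ e ih =>
    intro h
    have := ih (hp h)
    convert this using 4
    abel

theorem DegLT.leadAlong {e : ℕ} {p : G → V} (hp : DegLT e p) : LeadAlong η e 0 p := by
  induction e generalizing p with
  | zero => intro n; exact hp n
  | succ e ih => intro t; rw [smul_zero]; exact ih (hp _)

theorem LeadAlong.diff {e : ℕ} {p : G → V} {ℓ : V} (hp : LeadAlong η (e + 1) ℓ p) (a b : ℤ) :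
    LeadAlong η e ((a - b) • ℓ) (fun n => p (n + a • η) - p (n + b • η)) := by
  have := (hp a).sub (hp b)
  rw [sub_smul]
  convert this using 2
  abel

/-- A polynomial map of degree at most `e` with leading term `ℓ` along `η`. -/
def HasLead (η : G) (e : ℕ) (ℓ : V) (q : G → V) : Prop :=
  DegLT (e + 1) q ∧ LeadAlong η e ℓ q

theorem HasLead.add {e : ℕ} {p q : G → V} {ℓ m : V} (hp : HasLead η e ℓ p)
    (hq : HasLead η e m q) : HasLead η e (ℓ + m) (fun n => p n + q n) :=
  ⟨hp.1.add hq.1, hp.2.add hq.2⟩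

theorem HasLead.sub {e : ℕ} {p q : G → V} {ℓ m : V} (hp : HasLead η e ℓ p)
    (hq : HasLead η e m q) : HasLead η e (ℓ - m) (fun n => p n - q n) :=
  ⟨hp.1.sub hq.1, hp.2.sub hq.2⟩

theorem HasLead.shift {e : ℕ} {p : G → V} {ℓ : V} (hp : HasLead η e ℓ p) (a : G) :
    HasLead η e ℓ (fun n => p (n + a)) := ⟨hp.1.shift a, hp.2.shift a⟩

theorem HasLead.map (φ : V →+ W) {e : ℕ} {p : G → V} {ℓ : V} (hp : HasLead η e ℓ p) :
    HasLead η e (φ ℓ) (fun n => φ (p n)) := ⟨hp.1.map φ, hp.2.map φ⟩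

theorem DegLT.hasLead {e : ℕ} {p : G → V} (hp : DegLT e p) : HasLead η e 0 p :=
  ⟨hp.succ, hp.leadAlong⟩

theorem HasLead.add_degLT {e : ℕ} {p r : G → V} {ℓ : V} (hp : HasLead η e ℓ p)
    (hr : DegLT e r) : HasLead η e ℓ (fun n => p n + r n) := by
  simpa using hp.add hr.hasLead

theorem HasLead.degLT_add {e : ℕ} {p r : G → V} {ℓ : V} (hp : HasLead η e ℓ p)
    (hr : DegLT e r) : HasLead η e ℓ (fun n => r n + p n) := by
  simpa using hr.hasLead.add hp

theorem HasLead.sub_degLT {e : ℕ} {p r : G → V} {ℓ : V} (hp : HasLead η e ℓ p)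
    (hr : DegLT e r) : HasLead η e ℓ (fun n => p n - r n) := by
  simpa using hp.sub hr.hasLead

theorem HasLead.diff {e : ℕ} {p : G → V} {ℓ : V} (hp : HasLead η (e + 1) ℓ p) (a b : ℤ) :
    HasLead η e ((a - b) • ℓ) (fun n => p (n + a • η) - p (n + b • η)) :=
  ⟨hp.1.diff _ _, hp.2.diff a b⟩

theorem HasLead.diff_one {p : G → V} {ℓ : V} (hp : HasLead η 1 ℓ p) (a b : ℤ) (n : G) :
    p (n + a • η) - p (n + b • η) = (a - b) • ℓ := hp.2.diff a b n

end Degree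

section PolynomialDegree

variable {L : ℕ}

/-- The evaluation of a rational polynomial at integer points. -/
def evalInt (Q : MvPolynomial (Fin L) ℚ) (n : Fin L → ℤ) : ℚ :=
  MvPolynomial.eval (fun l => ((n l : ℤ) : ℚ)) Q

theorem degLT_coord_mul {e : ℕ} {q : (Fin L → ℤ) → ℚ} (hq : DegLT e q) (i : Fin L) :
    DegLT (e + 1) (fun n => (n i : ℚ) * q n) := by
  induction e generalizing q with
  | zero =>
    intro h n
    simp [hq n, hq (n + h)]
  | succ e ih =>
    intro h
    have h1 := ih (hq h)
    have h2 := (hq.shift h).map (AddMonoidHom.mulLeft (h i : ℚ))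
    have := h1.add h2
    convert this using 2
    simp
    ring

theorem leadAlong_coord_mul (η : Fin L → ℤ) {e : ℕ} {q : (Fin L → ℤ) → ℚ} {ℓ : ℚ}
    (hq : LeadAlong η e ℓ q) (i : Fin L) :
    LeadAlong η (e + 1) ((e + 1) * η i * ℓ) (fun n => (n i : ℚ) * q n) := by
  induction e generalizing q ℓ with
  | zero =>
    intro t n
    have h1 := hq n
    have h2 := hq (n + t • η)
    simp only [h1, h2]
    simp
    ring
  | succ e ih =>
    intro t
    have h1 := ih (hq t)
    have h2 := (hq.shift (t • η)).map (AddMonoidHom.mulLeft ((t * η i : ℤ) : ℚ))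
    have := h1.add h2
    convert this using 2
    · simp
      ring
    · simp
      ring

theorem hasLead_monomial (η : Fin L → ℤ) (s : Fin L →₀ ℕ) (a : ℚ) :
    HasLead η s.degree (s.degree.factorial * evalInt (MvPolynomial.monomial s a) η)
      (evalInt (MvPolynomial.monomial s a)) := by
  obtain ⟨d, hd⟩ : ∃ d, s.degree = d := ⟨_, rfl⟩
  induction d generalizing s with
  | zero =>
    obtain rfl : s = 0 := (Finsupp.degree_eq_zero_iff s).1 hd
    rw [hd]
    constructor
    · convert degLT_const a le_rfl using 2
      simp [evalInt]
    · intro n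
      simp [evalInt]
  | succ d ih =>
    obtain ⟨i, hi⟩ : ∃ i, s i ≠ 0 := by
      by_contra! h
      have : s = 0 := by ext i; simp [h i]
      simp [this] at hd
    have hs : s - Finsupp.single i 1 + Finsupp.single i 1 = s := by
      ext j
      by_cases hj : i = j
      · subst hj
        simp
        omega
      · simp [hj]
    set s' := s - Finsupp.single i 1
    have hs' : s'.degree = d := by
      rw [← hs] at hd
      simpa using hd
    have key : ∀ n, evalInt (MvPolynomial.monomial s a) n
        = (n i : ℚ) * evalInt (MvPolynomial.monomial s' a) n := by
      intro n
      rw [← hs, ← mul_one a, ← MvPolynomial.monomial_mul]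
      simp only [evalInt, map_mul, MvPolynomial.eval_monomial]
      simp
      ring
    have h := ih s' hs'
    rw [hs'] at h
    rw [hd, funext key]
    refine ⟨degLT_coord_mul h.1 i, ?_⟩
    have := leadAlong_coord_mul η h.2 i
    convert this using 1
    rw [Nat.factorial_succ]
    push_cast
    ring

theorem degLT_evalInt {Q : MvPolynomial (Fin L) ℚ} {e : ℕ}
    (hQ : ∀ s ∈ Q.support, s.degree < e) : DegLT e (evalInt Q) := by
  have : evalInt Q = fun n => ∑ s ∈ Q.support, evalInt (MvPolynomial.monomial s (Q.coeff s)) n := by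
    funext n
    conv_lhs => rw [Q.as_sum]
    simp only [evalInt, map_sum]
  rw [this]
  have h : ∀ S : Finset (Fin L →₀ ℕ), (∀ s ∈ S, s.degree < e) →
      DegLT e (fun n => ∑ s ∈ S, evalInt (MvPolynomial.monomial s (Q.coeff s)) n) := by
    classical
    intro S
    induction S using Finset.induction_on with
    | empty => intro _; simpa using DegLT.zero e
    | insert s S hs ih =>
      intro h
      simp only [Finset.sum_insert hs]
      exact ((hasLead_monomial 0 s _).1.mono (h s (by simp))).add
        (ih fun t ht => h t (by simp [ht]))
  exact h _ hQ

theorem hasLead_evalInt_homogeneous {Q : MvPolynomial (Fin L) ℚ} {e : ℕ} (η : Fin L → ℤ)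
    (hQ : ∀ s ∈ Q.support, s.degree = e) : HasLead η e (e.factorial * evalInt Q η) (evalInt Q) := by
  have : evalInt Q = fun n => ∑ s ∈ Q.support, evalInt (MvPolynomial.monomial s (Q.coeff s)) n := by
    funext n
    conv_lhs => rw [Q.as_sum]
    simp only [evalInt, map_sum]
  rw [this]
  have h : ∀ S : Finset (Fin L →₀ ℕ), (∀ s ∈ S, s.degree = e) →
      HasLead η e (e.factorial * ∑ s ∈ S, evalInt (MvPolynomial.monomial s (Q.coeff s)) η)
      (fun n => ∑ s ∈ S, evalInt (MvPolynomial.monomial s (Q.coeff s)) n) := by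
    classical
    intro S
    induction S using Finset.induction_on with
    | empty => intro _; simpa using (DegLT.zero (V := ℚ) (G := Fin L → ℤ) e).hasLead (η := η)
    | insert s S hs ih =>
      intro h
      simp only [Finset.sum_insert hs, mul_add]
      have := hasLead_monomial η s (Q.coeff s)
      rw [h s (by simp)] at this
      exact this.add (ih fun t ht => h t (by simp [ht]))
  exact h _ hQ

theorem hasLead_evalInt (Q : MvPolynomial (Fin L) ℚ) (η : Fin L → ℤ) :
    HasLead η Q.totalDegree
      (Q.totalDegree.factorial * evalInt (Q.homogeneousComponent Q.totalDegree) η)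
      (evalInt Q) := by
  have h1 : HasLead η Q.totalDegree
      (Q.totalDegree.factorial * evalInt (Q.homogeneousComponent Q.totalDegree) η)
      (evalInt (Q.homogeneousComponent Q.totalDegree)) := by
    apply hasLead_evalInt_homogeneous
    intro s hs
    have := MvPolynomial.coeff_homogeneousComponent Q.totalDegree Q s
    by_contra h
    rw [if_neg h] at this
    exact (MvPolynomial.mem_support_iff.1 hs) this
  have h2 : DegLT Q.totalDegree (evalInt (Q - Q.homogeneousComponent Q.totalDegree)) := by
    apply degLT_evalInt
    intro s hs
    have h3 := MvPolynomial.mem_support_iff.1 hs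
    rw [MvPolynomial.coeff_sub, MvPolynomial.coeff_homogeneousComponent] at h3
    split_ifs at h3 with h4
    · simp at h3
    · simp only [sub_zero] at h3
      have := MvPolynomial.le_totalDegree (MvPolynomial.mem_support_iff.2 h3)
      exact lt_of_le_of_ne this h4
  convert h1.add_degLT h2 using 2
  simp [evalInt]

theorem homogeneousComponent_totalDegree_ne_zero {Q : MvPolynomial (Fin L) ℚ} (hQ : Q ≠ 0) :
    Q.homogeneousComponent Q.totalDegree ≠ 0 := by
  obtain ⟨s, hs, h⟩ := Finset.exists_mem_eq_sup Q.support
    (MvPolynomial.support_nonempty.2 hQ) (fun s => s.sum fun _ e => e)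
  intro h0
  have := MvPolynomial.coeff_homogeneousComponent Q.totalDegree Q s
  rw [h0, if_pos] at this
  · exact (MvPolynomial.mem_support_iff.1 hs) (by simpa using this.symm)
  · rw [MvPolynomial.totalDegree, h]
    rfl

theorem exists_evalInt_ne_zero {Q : MvPolynomial (Fin L) ℚ} (hQ : Q ≠ 0) :
    ∃ η, evalInt Q η ≠ 0 := by
  by_contra! h
  apply hQ
  apply MvPolynomial.funext_set (fun _ => Set.range (Int.cast : ℤ → ℚ))
    (fun _ => Set.infinite_range_of_injective Int.cast_injective)
  intro x hx
  choose n hn using fun i => hx i (Set.mem_univ i)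
  have := h n
  simp only [evalInt, hn] at this
  simpa using this

end PolynomialDegree

section Averages

/-- The average of `a` over the finite set `S`. -/
def avg {ι : Type*} (S : Finset ι) (a : ι → ℂ) : ℂ := (S.card : ℂ)⁻¹ * ∑ n ∈ S, a n

variable {ι : Type*} (S : Finset ι)

theorem norm_avg_le {a : ι → ℂ} {C : ℝ} (hC : 0 ≤ C) (h : ∀ n ∈ S, ‖a n‖ ≤ C) : ‖avg S a‖ ≤ C := by
  rcases S.eq_empty_or_nonempty with rfl | hS
  · simpa [avg]
  rw [avg, norm_mul, norm_inv, Complex.norm_natCast]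
  have hc : (0 : ℝ) < S.card := by exact_mod_cast hS.card_pos
  rw [inv_mul_le_iff₀ hc]
  calc _ ≤ ∑ n ∈ S, ‖a n‖ := norm_sum_le _ _
    _ ≤ ∑ n ∈ S, C := Finset.sum_le_sum h
    _ = _ := by simp

theorem norm_avg_sub_avg_shift_le {G : Type*} [AddCommGroup G] [DecidableEq G] {S : Finset G}
    {a : G → ℂ} (h : ∀ n, ‖a n‖ ≤ 1) (g : G) :
    ‖avg S (fun n => a (n + g)) - avg S a‖
      ≤ (((S.image (g + ·)) ∆ S).card : ℝ) / (S.card : ℝ) := by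
  rw [avg, avg, ← mul_sub, norm_mul, norm_inv, Complex.norm_natCast, div_eq_inv_mul]
  gcongr
  have h1 : ∑ n ∈ S, a (n + g) = ∑ n ∈ S.image (g + ·), a n := by
    rw [Finset.sum_image (fun x _ y _ hxy => by simpa using hxy)]
    exact Finset.sum_congr rfl fun n _ => by rw [add_comm]
  rw [h1, ← Finset.sum_sdiff_sub_sum_sdiff]
  calc _ ≤ ‖∑ x ∈ S.image (g + ·) \ S, a x‖ + ‖∑ x ∈ S \ S.image (g + ·), a x‖ := norm_sub_le _ _
    _ ≤ ∑ x ∈ S.image (g + ·) \ S, 1 + ∑ x ∈ S \ S.image (g + ·), 1 := by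
        gcongr
        · exact norm_sum_le_of_le _ fun n _ => h n
        · exact norm_sum_le_of_le _ fun n _ => h n
    _ = _ := by
        rw [symmDiff_def, Finset.sup_eq_union, Finset.card_union_of_disjoint disjoint_sdiff_sdiff]
        simp

theorem sq_norm_avg_le (a : ι → ℂ) : ‖avg S a‖ ^ 2 ≤ (S.card : ℝ)⁻¹ * ∑ n ∈ S, ‖a n‖ ^ 2 := by
  rcases S.eq_empty_or_nonempty with rfl | hS
  · simp [avg]
  have hc : (0 : ℝ) < S.card := by exact_mod_cast hS.card_pos
  rw [avg, norm_mul, norm_inv, Complex.norm_natCast, mul_pow]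
  have h1 : ‖∑ n ∈ S, a n‖ ^ 2 ≤ S.card * ∑ n ∈ S, ‖a n‖ ^ 2 :=
    calc _ ≤ (∑ n ∈ S, ‖a n‖) ^ 2 := by gcongr; exact norm_sum_le _ _
      _ ≤ _ := sq_sum_le_card_mul_sum_sq
  calc _ ≤ (S.card : ℝ)⁻¹ ^ 2 * (S.card * ∑ n ∈ S, ‖a n‖ ^ 2) := by gcongr
    _ = _ := by field_simp

theorem avg_add (a b : ι → ℂ) : avg S (fun n => a n + b n) = avg S a + avg S b := by
  simp [avg, Finset.sum_add_distrib, mul_add]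

theorem avg_sub (a b : ι → ℂ) : avg S (fun n => a n - b n) = avg S a - avg S b := by
  simp [avg, Finset.sum_sub_distrib, mul_sub]

theorem avg_mul_left (c : ℂ) (a : ι → ℂ) : avg S (fun n => c * a n) = c * avg S a := by
  simp only [avg, ← Finset.mul_sum]; ring

theorem avg_mul_right (c : ℂ) (a : ι → ℂ) : avg S (fun n => a n * c) = avg S a * c := by
  simp only [avg, ← Finset.sum_mul]; ring

theorem avg_conj (a : ι → ℂ) : avg S (fun n => (starRingEnd ℂ) (a n)) = (starRingEnd ℂ) (avg S a) := by
  simp [avg]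

theorem avg_const {S : Finset ι} (hS : S.Nonempty) (c : ℂ) : avg S (fun _ => c) = c := by
  have : (S.card : ℂ) ≠ 0 := by exact_mod_cast hS.card_pos.ne'
  simp [avg, this]

end Averages

section Functions

variable {X : Type*} [MeasurableSpace X]

/-- Measurable functions bounded by `1`. -/
def B1 (f : X → ℂ) : Prop := Measurable f ∧ ∀ x, ‖f x‖ ≤ 1

theorem B1.comp {Y : Type*} [MeasurableSpace Y] {f : X → ℂ} (hf : B1 f) {g : Y → X}
    (hg : Measurable g) : B1 (fun x => f (g x)) :=
  ⟨hf.1.comp hg, fun _ => hf.2 _⟩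

theorem B1.mul {f g : X → ℂ} (hf : B1 f) (hg : B1 g) : B1 (fun x => f x * g x) :=
  ⟨hf.1.mul hg.1, fun x => by
    rw [norm_mul]; exact mul_le_one₀ (hf.2 x) (norm_nonneg _) (hg.2 x)⟩

theorem B1.conj {f : X → ℂ} (hf : B1 f) : B1 (fun x => (starRingEnd ℂ) (f x)) :=
  ⟨Complex.continuous_conj.measurable.comp hf.1, fun x => by simpa using hf.2 x⟩

theorem B1.const {c : ℂ} (hc : ‖c‖ ≤ 1) : B1 (fun _ : X => c) := ⟨measurable_const, fun _ => hc⟩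

theorem B1.one : B1 (fun _ : X => (1 : ℂ)) := B1.const (by simp)

theorem B1.prod {ι : Type*} (s : Finset ι) {f : ι → X → ℂ} (hf : ∀ i ∈ s, B1 (f i)) :
    B1 (fun x => ∏ i ∈ s, f i x) :=
  ⟨Finset.measurable_fun_prod s fun i hi => (hf i hi).1, fun x => by
    rw [norm_prod]
    exact Finset.prod_le_one (fun _ _ => norm_nonneg _) fun i hi => (hf i hi).2 x⟩

theorem B1.avg {ι : Type*} (s : Finset ι) {f : ι → X → ℂ} (hf : ∀ i, B1 (f i)) :
    B1 (fun x => avg s fun i => f i x) :=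
  ⟨(Finset.measurable_fun_sum s fun i _ => (hf i).1).const_mul _,
    fun x => norm_avg_le s zero_le_one fun i _ => (hf i).2 x⟩

theorem B1.integrable {μ : Measure X} [IsFiniteMeasure μ] {f : X → ℂ} (hf : B1 f) :
    Integrable f μ :=
  Integrable.of_bound hf.1.aestronglyMeasurable 1 (ae_of_all _ hf.2)

theorem B1.memLp {μ : Measure X} [IsFiniteMeasure μ] {f : X → ℂ} (hf : B1 f) (p : ℝ≥0∞) :
    MemLp f p μ :=
  MemLp.of_bound hf.1.aestronglyMeasurable 1 (ae_of_all _ hf.2)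

theorem B1.integrable_sq {μ : Measure X} [IsFiniteMeasure μ] {f : X → ℂ} (hf : B1 f) :
    Integrable (fun x => ‖f x‖ ^ 2) μ :=
  Integrable.of_bound (hf.1.norm.pow_const 2).aestronglyMeasurable 1 (ae_of_all _ fun _ => by
    rw [Real.norm_of_nonneg (by positivity)]
    exact pow_le_one₀ (norm_nonneg _) (hf.2 _))

theorem B1.norm_integral_le {μ : Measure X} [IsProbabilityMeasure μ] {f : X → ℂ} (hf : B1 f) :
    ‖∫ x, f x ∂μ‖ ≤ 1 := by
  simpa using norm_integral_le_of_norm_le_const (μ := μ) (ae_of_all _ hf.2)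

/-- The squared `L²` norm. -/
def nsq (μ : Measure X) (f : X → ℂ) : ℝ := ∫ x, ‖f x‖ ^ 2 ∂μ

variable {μ : Measure X}

theorem nsq_nonneg (f : X → ℂ) : 0 ≤ nsq μ f := integral_nonneg fun _ => by positivity

theorem eLpNorm_two_eq {f : X → ℂ} (hf : MemLp f 2 μ) :
    eLpNorm f 2 μ = ENNReal.ofReal (Real.sqrt (nsq μ f)) := by
  rw [hf.eLpNorm_eq_integral_rpow_norm (by simp) (by simp), Real.sqrt_eq_rpow, nsq]
  simp

theorem tendsto_eLpNorm_iff {l : Filter ℕ} {f : ℕ → X → ℂ} (hf : ∀ N, MemLp (f N) 2 μ) :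
    Tendsto (fun N => eLpNorm (f N) 2 μ) l (nhds 0) ↔
      Tendsto (fun N => nsq μ (f N)) l (nhds 0) := by
  simp_rw [fun N => eLpNorm_two_eq (hf N)]
  constructor
  · intro h
    have h := (ENNReal.tendsto_toReal (by simp : (0 : ℝ≥0∞) ≠ ⊤)).comp h
    simp only [Function.comp_def, ENNReal.toReal_ofReal (Real.sqrt_nonneg _)] at h
    have := h.pow 2
    simpa [Real.sq_sqrt (nsq_nonneg _)] using this
  · intro h
    have := ENNReal.tendsto_ofReal ((Real.continuous_sqrt.tendsto 0).comp h)
    simpa using this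

theorem norm_integral_sq_le_nsq [IsProbabilityMeasure μ] {f g : X → ℂ} (hf : B1 f) (hg : B1 g) :
    ‖∫ x, f x * g x ∂μ‖ ^ 2 ≤ nsq μ f := by
  have h1 : ‖∫ x, f x * g x ∂μ‖ ≤ ∫ x, ‖f x‖ ∂μ := by
    refine (norm_integral_le_integral_norm _).trans ?_
    refine integral_mono (hf.mul hg).integrable.norm hf.integrable.norm fun x => ?_
    simp only [norm_mul]
    exact mul_le_of_le_one_right (norm_nonneg _) (hg.2 x)
  have h2 : 0 ≤ ∫ x, (‖f x‖ - ∫ y, ‖f y‖ ∂μ) ^ 2 ∂μ := integral_nonneg fun _ => sq_nonneg _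
  have h3 : ∫ x, (‖f x‖ - ∫ y, ‖f y‖ ∂μ) ^ 2 ∂μ = nsq μ f - (∫ y, ‖f y‖ ∂μ) ^ 2 := by
    set c := ∫ y, ‖f y‖ ∂μ
    have : ∀ x, (‖f x‖ - c) ^ 2 = ‖f x‖ ^ 2 - 2 * c * ‖f x‖ + c ^ 2 := fun x => by ring
    simp_rw [this]
    have i1 := hf.integrable_sq (μ := μ)
    have i2 : Integrable (fun x => 2 * c * ‖f x‖) μ := hf.integrable.norm.const_mul _
    have i3 : Integrable (fun x => ‖f x‖ ^ 2 - 2 * c * ‖f x‖) μ := i1.sub i2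
    rw [integral_add i3 (integrable_const _), integral_sub i1 i2, integral_const_mul]
    simp only [nsq, integral_const, probReal_univ, smul_eq_mul, one_mul]
    ring
  calc _ ≤ (∫ x, ‖f x‖ ∂μ) ^ 2 := by gcongr
    _ ≤ _ := by linarith

end Functions

theorem IsFolner.tendsto_avg_shift {L : ℕ} {I : ℕ → Finset (Fin L → ℤ)} (hI : IsFolner L I)
    (g : Fin L → ℤ) {ε : ℝ} (hε : 0 < ε) : ∀ᶠ N in atTop, ∀ a : (Fin L → ℤ) → ℂ,
      (∀ n, ‖a n‖ ≤ 1) → ‖avg (I N) (fun n => a (n + g)) - avg (I N) a‖ ≤ ε := by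
  filter_upwards [(hI.2 g).eventually_le_const hε] with N hN a ha
  exact (norm_avg_sub_avg_shift_le ha g).trans hN

section VanDerCorput

variable {X : Type*} [MeasurableSpace X] {μ : Measure X} [IsProbabilityMeasure μ]

/-- Van der Corput's inequality along a Følner sequence. -/
theorem vanDerCorput {L : ℕ} {I : ℕ → Finset (Fin L → ℤ)} (hI : IsFolner L I)
    {u : (Fin L → ℤ) → X → ℂ} (hu : ∀ n, B1 (u n)) (η : Fin L → ℤ) {R : ℕ} (hR : 0 < R)
    (b : ℕ → ℕ → ℝ)
    (hb : ∀ h < R, ∀ h' < R, ∀ᶠ N in atTop, ‖avg (I N) fun n =>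
      ∫ x, u (n + (h : ℤ) • η) x * (starRingEnd ℂ) (u (n + (h' : ℤ) • η) x) ∂μ‖ ≤ b h h')
    {ρ : ℝ} (hρ : ((R : ℝ)⁻¹ * (R : ℝ)⁻¹ * ∑ h ∈ range R, ∑ h' ∈ range R, b h h') < ρ) :
    ∀ᶠ N in atTop, nsq μ (fun x => avg (I N) fun n => u n x) ≤ ρ := by
  have hR0 : (0 : ℝ) < R := by exact_mod_cast hR
  set M := (R : ℝ)⁻¹ * (R : ℝ)⁻¹ * ∑ h ∈ range R, ∑ h' ∈ range R, b h h' with hM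
  set ε := (ρ - M) / 2 with hε
  have hε0 : 0 < ε := by simp only [hε]; linarith
  have hb' : ∀ᶠ N in atTop, ∀ h ∈ range R, ∀ h' ∈ range R, ‖avg (I N) fun n =>
      ∫ x, u (n + (h : ℤ) • η) x * (starRingEnd ℂ) (u (n + (h' : ℤ) • η) x) ∂μ‖ ≤ b h h' := by
    rw [Filter.eventually_all_finset]
    intro h hh
    rw [Filter.eventually_all_finset]
    intro h' hh'
    exact hb h (Finset.mem_range.1 hh) h' (Finset.mem_range.1 hh')
  have hs : ∀ᶠ N in atTop, ∀ h ∈ range R, ∀ a : (Fin L → ℤ) → ℂ,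
      (∀ n, ‖a n‖ ≤ 1) → ‖avg (I N) (fun n => a (n + (h : ℤ) • η)) - avg (I N) a‖ ≤ ε := by
    rw [Filter.eventually_all_finset]
    exact fun h _ => hI.tendsto_avg_shift _ hε0
  filter_upwards [hb', hs] with N hN hsN
  set F : X → ℂ := fun x => avg (I N) fun n => u n x
  have hF : B1 F := B1.avg _ hu
  have hpt : ∀ x, ‖F x‖ ^ 2 ≤ (((R : ℂ)⁻¹ * (R : ℂ)⁻¹) * ∑ h ∈ range R, ∑ h' ∈ range R,
      avg (I N) fun n => u (n + (h : ℤ) • η) x * (starRingEnd ℂ) (u (n + (h' : ℤ) • η) x)).re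
      + 2 * ε := by
    intro x
    set B : ℂ := avg (range R) fun h => avg (I N) fun n => u (n + (h : ℤ) • η) x
    have hB1 : ‖B‖ ≤ 1 := norm_avg_le _ zero_le_one fun h _ =>
      norm_avg_le _ zero_le_one fun n _ => (hu _).2 x
    have hBF : ‖F x - B‖ ≤ ε := by
      have : F x - B = avg (range R) fun h => F x - avg (I N) fun n => u (n + (h : ℤ) • η) x := by
        rw [avg_sub, avg_const (by simpa using hR.ne')]
      rw [this]
      refine norm_avg_le _ hε0.le fun h hh => ?_
      rw [norm_sub_rev]
      exact hsN h hh (fun n => u n x) fun n => (hu n).2 x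
    have h1 : ‖F x‖ ≤ ‖B‖ + ε := by
      have := norm_sub_norm_le (F x) B
      linarith
    have h2 : ‖F x‖ ^ 2 ≤ ‖B‖ ^ 2 + 2 * ε := by
      have := hF.2 x
      nlinarith [norm_nonneg (F x), norm_nonneg B]
    have h3 : B = avg (I N) fun n => avg (range R) fun h => u (n + (h : ℤ) • η) x := by
      simp only [B, avg, Finset.mul_sum]
      rw [Finset.sum_comm]
      exact Finset.sum_congr rfl fun _ _ => Finset.sum_congr rfl fun _ _ => by ring
    have h4 : ((‖B‖ ^ 2 : ℝ)) ≤ ((I N).card : ℝ)⁻¹ * ∑ n ∈ I N,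
        ‖avg (range R) fun h => u (n + (h : ℤ) • η) x‖ ^ 2 := by
      rw [h3]; exact sq_norm_avg_le _ _
    have h5 : ((((I N).card : ℝ)⁻¹ * ∑ n ∈ I N,
        ‖avg (range R) fun h => u (n + (h : ℤ) • η) x‖ ^ 2 : ℝ) : ℂ) =
        ((R : ℂ)⁻¹ * (R : ℂ)⁻¹) * ∑ h ∈ range R, ∑ h' ∈ range R,
      avg (I N) fun n => u (n + (h : ℤ) • η) x * (starRingEnd ℂ) (u (n + (h' : ℤ) • η) x) := by
      push_cast
      simp_rw [← Complex.conj_mul', avg, map_mul, map_sum, map_inv₀, map_natCast, card_range,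
        Finset.mul_sum, Finset.sum_mul, Finset.mul_sum]
      rw [Finset.sum_comm]
      refine Finset.sum_congr rfl fun h _ => ?_
      rw [Finset.sum_comm]
      exact Finset.sum_congr rfl fun _ _ => Finset.sum_congr rfl fun _ _ => by ring
    rw [← h5, Complex.ofReal_re]
    linarith
  have h_int : ∀ h h' n, Integrable (fun x => u (n + (h : ℤ) • η) x *
      (starRingEnd ℂ) (u (n + (h' : ℤ) • η) x)) μ := fun h h' n =>
    ((hu _).mul (hu _).conj).integrable
  have hint2 : ∀ h h' : ℕ, Integrable (fun x => avg (I N) fun n => u (n + (h : ℤ) • η) x *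
      (starRingEnd ℂ) (u (n + (h' : ℤ) • η) x)) μ := fun h h' =>
    (B1.avg _ fun n => (hu _).mul (hu _).conj).integrable
  have hint3 : Integrable (fun x => (((R : ℂ)⁻¹ * (R : ℂ)⁻¹) * ∑ h ∈ range R, ∑ h' ∈ range R,
      avg (I N) fun n => u (n + (h : ℤ) • η) x * (starRingEnd ℂ) (u (n + (h' : ℤ) • η) x))) μ :=
    (integrable_finsetSum _ fun h _ => integrable_finsetSum _ fun h' _ => hint2 h h').const_mul _
  have hre : Integrable (fun x => (((R : ℂ)⁻¹ * (R : ℂ)⁻¹) * ∑ h ∈ range R, ∑ h' ∈ range R,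
      avg (I N) fun n => u (n + (h : ℤ) • η) x *
        (starRingEnd ℂ) (u (n + (h' : ℤ) • η) x)).re) μ := hint3.re
  calc nsq μ F ≤ ∫ x, ((((R : ℂ)⁻¹ * (R : ℂ)⁻¹) * ∑ h ∈ range R, ∑ h' ∈ range R,
      avg (I N) fun n => u (n + (h : ℤ) • η) x * (starRingEnd ℂ) (u (n + (h' : ℤ) • η) x)).re
      + 2 * ε) ∂μ := integral_mono hF.integrable_sq (hre.add (integrable_const _)) hpt
    _ = (∫ x, (((R : ℂ)⁻¹ * (R : ℂ)⁻¹) * ∑ h ∈ range R, ∑ h' ∈ range R,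
      avg (I N) fun n => u (n + (h : ℤ) • η) x *
        (starRingEnd ℂ) (u (n + (h' : ℤ) • η) x)) ∂μ).re + 2 * ε := by
      rw [integral_add hre (integrable_const _)]
      congr 1
      · exact integral_re hint3
      · simp
    _ ≤ ‖∫ x, (((R : ℂ)⁻¹ * (R : ℂ)⁻¹) * ∑ h ∈ range R, ∑ h' ∈ range R,
      avg (I N) fun n => u (n + (h : ℤ) • η) x *
        (starRingEnd ℂ) (u (n + (h' : ℤ) • η) x)) ∂μ‖ + 2 * ε := by
      gcongr
      exact Complex.re_le_norm _
    _ ≤ M + 2 * ε := by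
      gcongr
      rw [integral_const_mul, integral_finsetSum _ fun h _ => integrable_finsetSum _ fun h' _ =>
        hint2 h h', norm_mul, hM]
      simp only [norm_mul, norm_inv, Complex.norm_natCast]
      gcongr
      refine norm_sum_le_of_le _ fun h hh => ?_
      rw [integral_finsetSum _ fun h' _ => hint2 h h']
      refine norm_sum_le_of_le _ fun h' hh' => ?_
      have : ∫ x, (avg (I N) fun n => u (n + (h : ℤ) • η) x *
        (starRingEnd ℂ) (u (n + (h' : ℤ) • η) x)) ∂μ = avg (I N) fun n =>
          ∫ x, u (n + (h : ℤ) • η) x * (starRingEnd ℂ) (u (n + (h' : ℤ) • η) x) ∂μ := by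
        simp only [avg]
        rw [integral_const_mul, integral_finsetSum _ fun n _ => h_int h h' n]
      rw [this]
      exact hN h hh h' hh'
    _ = ρ := by rw [hε]; ring

end VanDerCorput

section Uniformity

/-- A measure-preserving action of the additive group `V`. -/
structure IsMPAction {X V : Type*} [MeasurableSpace X] [AddCommGroup V] (μ : Measure X)
    (T : V → X → X) : Prop where
  zero : T 0 = id
  add : ∀ g h, T (g + h) = T g ∘ T h
  mp : ∀ g, MeasurePreserving (T g) μ μ

variable {X V : Type*} [MeasurableSpace X] [AddCommGroup V] {μ : Measure X}
  {T : V → X → X}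

theorem IsMPAction.apply_add (hT : IsMPAction μ T) (g h : V) (x : X) :
    T g (T h x) = T (g + h) x := by rw [hT.add]; rfl

theorem IsMPAction.apply_zero (hT : IsMPAction μ T) (x : X) : T 0 x = x := by rw [hT.zero]; rfl

/-- `T g` as a measurable equivalence. -/
def IsMPAction.equiv (hT : IsMPAction μ T) (g : V) : X ≃ᵐ X where
  toFun := T g
  invFun := T (-g)
  left_inv x := by rw [hT.apply_add, neg_add_cancel, hT.apply_zero]
  right_inv x := by rw [hT.apply_add, add_neg_cancel, hT.apply_zero]
  measurable_toFun := (hT.mp g).measurable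
  measurable_invFun := (hT.mp (-g)).measurable

theorem IsMPAction.integral_comp (hT : IsMPAction μ T) {E : Type*} [NormedAddCommGroup E]
    [NormedSpace ℝ E] (g : V) (f : X → E) : ∫ x, f (T g x) ∂μ = ∫ x, f x ∂μ :=
  (hT.mp g).integral_comp (hT.equiv g).measurableEmbedding f

theorem IsMPAction.measurable (hT : IsMPAction μ T) (g : V) : Measurable (T g) :=
  (hT.mp g).measurable

theorem B1.act {f : X → ℂ} (hf : B1 f) (hT : IsMPAction μ T) (g : V) : B1 (fun x => f (T g x)) :=
  hf.comp (hT.measurable g)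

theorem IsMPAction.nsq_comp (hT : IsMPAction μ T) (g : V) (f : X → ℂ) :
    nsq μ (fun x => f (T g x)) = nsq μ f :=
  hT.integral_comp g (fun x => ‖f x‖ ^ 2)

/-- The multiplicative derivative of `f` with shifts `a`, `b`. -/
def mderiv (T : V → X → X) (a b : V) (f : X → ℂ) : X → ℂ :=
  fun x => f (T a x) * (starRingEnd ℂ) (f (T b x))

theorem B1.mderiv {f : X → ℂ} (hf : B1 f) (hT : IsMPAction μ T) (a b : V) :
    B1 (mderiv T a b f) := (hf.act hT a).mul (hf.act hT b).conj

theorem mderiv_comp (hT : IsMPAction μ T) (a b g : V) (f : X → ℂ) :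
    mderiv T a b (fun x => f (T g x)) = fun x => mderiv T a b f (T g x) := by
  funext x
  simp only [mderiv, hT.apply_add]
  rw [add_comm g, add_comm g]

/-- Finitary box-type averages along the directions `us`, with ranges `Rs`. -/
def boxAvg (μ : Measure X) (T : V → X → X) : List V → List ℕ → (X → ℂ) → ℝ
  | [], _, f => ‖∫ x, f x ∂μ‖ ^ 2
  | _ :: _, [], _ => 0
  | u :: us, R :: Rs, f => (R : ℝ)⁻¹ * (R : ℝ)⁻¹ * ∑ h ∈ range R, ∑ h' ∈ range R,
      boxAvg μ T us Rs (mderiv T ((h : ℤ) • u) ((h' : ℤ) • u) f)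

theorem boxAvg_nonneg (us : List V) (Rs : List ℕ) (f : X → ℂ) : 0 ≤ boxAvg μ T us Rs f := by
  induction us generalizing Rs f with
  | nil => rw [boxAvg]; positivity
  | cons u us ih =>
    cases Rs with
    | nil => rw [boxAvg]
    | cons R Rs =>
      rw [boxAvg]
      exact mul_nonneg (by positivity) (Finset.sum_nonneg fun _ _ => Finset.sum_nonneg fun _ _ => ih _ _)

theorem boxAvg_comp (hT : IsMPAction μ T) (us : List V) (Rs : List ℕ) (f : X → ℂ) (g : V) :
    boxAvg μ T us Rs (fun x => f (T g x)) = boxAvg μ T us Rs f := by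
  induction us generalizing Rs f with
  | nil => rw [boxAvg, boxAvg, hT.integral_comp g f]
  | cons u us ih =>
    cases Rs with
    | nil => rw [boxAvg, boxAvg]
    | cons R Rs =>
      rw [boxAvg, boxAvg]
      congr 1
      refine Finset.sum_congr rfl fun h _ => Finset.sum_congr rfl fun h' _ => ?_
      rw [mderiv_comp hT, ih]

theorem boxAvg_le_one [IsProbabilityMeasure μ] (hT : IsMPAction μ T) (us : List V) (Rs : List ℕ)
    {f : X → ℂ} (hf : B1 f) : boxAvg μ T us Rs f ≤ 1 := by
  induction us generalizing Rs f with
  | nil => rw [boxAvg]; exact pow_le_one₀ (norm_nonneg _) hf.norm_integral_le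
  | cons u us ih =>
    cases Rs with
    | nil => rw [boxAvg]; exact zero_le_one
    | cons R Rs =>
      rw [boxAvg]
      calc _ ≤ (R : ℝ)⁻¹ * (R : ℝ)⁻¹ * ∑ h ∈ range R, ∑ h' ∈ range R, (1 : ℝ) := by
            gcongr with h _ h' _
            exact ih _ (hf.mderiv hT _ _)
        _ ≤ 1 := by
            rcases Nat.eq_zero_or_pos R with rfl | hR
            · simp
            · have : (R : ℝ) ≠ 0 := by positivity
              simp
              field_simp
              exact le_rfl

/-- A fixed nonprincipal ultrafilter on `ℕ`. -/
def UF : Ultrafilter ℕ := Ultrafilter.of atTop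

theorem UF_le : (UF : Filter ℕ) ≤ atTop := Ultrafilter.of_le atTop

/-- The iterated ultrafilter on lists of length `n`. -/
def GU : ℕ → Ultrafilter (List ℕ)
  | 0 => pure []
  | n + 1 => Ultrafilter.bind UF fun R => (GU n).map (R :: ·)

theorem eventually_GU_zero {P : List ℕ → Prop} : (∀ᶠ Rs in GU 0, P Rs) ↔ P [] := by
  rw [GU, Ultrafilter.coe_pure]
  exact Filter.eventually_pure

theorem eventually_GU_succ {n : ℕ} {P : List ℕ → Prop} :
    (∀ᶠ Rs in GU (n + 1), P Rs) ↔ ∀ᶠ R in UF, ∀ᶠ Rs in GU n, P (R :: Rs) := by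
  rw [GU]
  rfl

/-- `f` is `δ`-small with respect to the directions `us`. -/
def IsSmall (μ : Measure X) (T : V → X → X) (us : List V) (f : X → ℂ) (δ : ℝ) : Prop :=
  ∀ᶠ Rs in GU us.length, boxAvg μ T us Rs f ≤ δ

theorem IsSmall.mono {us : List V} {f : X → ℂ} {δ δ' : ℝ} (h : IsSmall μ T us f δ)
    (hδ : δ ≤ δ') : IsSmall μ T us f δ' :=
  Filter.Eventually.mono h fun _ hR => hR.trans hδ

theorem isSmall_comp (hT : IsMPAction μ T) {us : List V} {f : X → ℂ} {δ : ℝ} (g : V) :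
    IsSmall μ T us (fun x => f (T g x)) δ ↔ IsSmall μ T us f δ := by
  simp only [IsSmall, boxAvg_comp hT]

open Classical in
theorem IsSmall.card_le {u : V} {us : List V} {f : X → ℂ} {δ δ' : ℝ} (hδ : 0 < δ)
    (h : IsSmall μ T (u :: us) f (δ * δ')) : ∀ᶠ R : ℕ in UF,
      (((range R ×ˢ range R).filter fun p =>
        ¬IsSmall μ T us (mderiv T ((p.1 : ℤ) • u) ((p.2 : ℤ) • u) f) δ).card : ℝ) ≤ δ' * R ^ 2 := by
  have h1 := eventually_GU_succ.1 h
  filter_upwards [h1, UF_le (eventually_gt_atTop 0)] with R hR hR0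
  set S := (range R ×ˢ range R).filter fun p =>
        ¬IsSmall μ T us (mderiv T ((p.1 : ℤ) • u) ((p.2 : ℤ) • u) f) δ
  have hS : ∀ᶠ Rs in GU us.length, ∀ p ∈ S,
      δ < boxAvg μ T us Rs (mderiv T ((p.1 : ℤ) • u) ((p.2 : ℤ) • u) f) := by
    rw [Filter.eventually_all_finset]
    intro p hp
    have := (Finset.mem_filter.1 hp).2
    rw [IsSmall, ← Ultrafilter.eventually_not] at this
    simpa using this
  obtain ⟨Rs, h2, h3⟩ := (hR.and hS).exists
  rw [boxAvg, ← Finset.sum_product'] at h2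
  have h4 : S.card * δ ≤ ∑ p ∈ range R ×ˢ range R,
      boxAvg μ T us Rs (mderiv T ((p.1 : ℤ) • u) ((p.2 : ℤ) • u) f) :=
    calc S.card * δ = ∑ p ∈ S, δ := by simp
      _ ≤ ∑ p ∈ S, boxAvg μ T us Rs (mderiv T ((p.1 : ℤ) • u) ((p.2 : ℤ) • u) f) :=
        Finset.sum_le_sum fun p hp => (h3 p hp).le
      _ ≤ _ := Finset.sum_le_sum_of_subset_of_nonneg (Finset.filter_subset _ _)
        fun _ _ _ => boxAvg_nonneg _ _ _
  have hR' : (0 : ℝ) < R := by exact_mod_cast hR0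
  have h5 : (R : ℝ)⁻¹ * (R : ℝ)⁻¹ * (S.card * δ) ≤ δ * δ' :=
    (mul_le_mul_of_nonneg_left h4 (by positivity)).trans h2
  have h6 : (S.card : ℝ) * δ ≤ δ * δ' * R ^ 2 := by
    calc _ = (R : ℝ)⁻¹ * (R : ℝ)⁻¹ * (S.card * δ) * R ^ 2 := by field_simp
      _ ≤ _ := by gcongr
  nlinarith

open Classical in
theorem IsSmall.exists_card_le (hT : IsMPAction μ T) {u : V} {us : List V} {f : X → ℂ}
    {δ δ' : ℝ} (hδ : 0 < δ) (hδ' : 0 ≤ δ') {c : ℤ} (hc : c ≠ 0)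
    (h : IsSmall μ T (u :: us) f (δ * (δ' / (4 * (c : ℝ) ^ 2)))) (R₀ : ℕ) : ∃ R ≥ R₀, 0 < R ∧
      (((range R ×ˢ range R).filter fun p =>
        ¬IsSmall μ T us (mderiv T ((p.1 : ℤ) • c • u) ((p.2 : ℤ) • c • u) f) δ).card : ℝ)
          ≤ δ' * R ^ 2 := by
  obtain ⟨R', h1, h2⟩ := ((h.card_le hδ).and
    (UF_le (eventually_ge_atTop (c.natAbs * (R₀ + 1))))).exists
  set m := c.natAbs with hm
  have hm0 : 0 < m := Int.natAbs_pos.2 hc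
  set R := R' / m with hR
  have hRR : R₀ + 1 ≤ R := (Nat.le_div_iff_mul_le hm0).2 (by rw [mul_comm]; exact h2)
  have hR1 : m * R ≤ R' := Nat.mul_div_le R' m
  have hR2 : R' < m * (R + 1) := Nat.lt_mul_div_succ R' hm0
  refine ⟨R, by omega, by omega, ?_⟩
  have hcard : ((range R ×ˢ range R).filter fun p =>
        ¬IsSmall μ T us (mderiv T ((p.1 : ℤ) • c • u) ((p.2 : ℤ) • c • u) f) δ).card ≤
      ((range R' ×ˢ range R').filter fun p =>
        ¬IsSmall μ T us (mderiv T ((p.1 : ℤ) • u) ((p.2 : ℤ) • u) f) δ).card := by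
    have hlt : ∀ a, a < R → m * a < R' := fun a ha =>
      lt_of_lt_of_le ((Nat.mul_lt_mul_left hm0).2 ha) hR1
    rcases Int.natAbs_eq c with hc' | hc'
    · refine Finset.card_le_card_of_injOn (fun p => (m * p.1, m * p.2)) ?_ ?_
      · intro p hp
        simp only [Finset.coe_filter, Finset.mem_product, Finset.mem_range, Set.mem_ofPred_eq] at hp ⊢
        refine ⟨⟨hlt _ hp.1.1, hlt _ hp.1.2⟩, ?_⟩
        have := hp.2
        rw [hc', ← hm, smul_smul, smul_smul] at this
        push_cast
        rwa [mul_comm, mul_comm (m : ℤ)]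
      · intro p _ q _ hpq
        simp only [Prod.mk.injEq, mul_eq_mul_left_iff, hm0.ne', or_false] at hpq
        exact Prod.ext hpq.1 hpq.2
    · refine Finset.card_le_card_of_injOn (fun p => (m * p.2, m * p.1)) ?_ ?_
      · intro p hp
        simp only [Finset.coe_filter, Finset.mem_product, Finset.mem_range, Set.mem_ofPred_eq] at hp ⊢
        refine ⟨⟨hlt _ hp.1.2, hlt _ hp.1.1⟩, ?_⟩
        have := hp.2
        rw [← isSmall_comp hT (((m * (p.1 + p.2) : ℕ) : ℤ) • u)] at this
        convert this using 2
        funext x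
        simp only [mderiv, hT.apply_add]
        congr 4
        · rw [hc', ← hm]
          push_cast
          module
        · rw [hc', ← hm]
          push_cast
          module
      · intro p _ q _ hpq
        simp only [Prod.mk.injEq, mul_eq_mul_left_iff, hm0.ne', or_false] at hpq
        exact Prod.ext hpq.2 hpq.1
  have hmc : (c : ℝ) ^ 2 = (m : ℝ) ^ 2 := by
    rw [hm, Nat.cast_natAbs, Int.cast_abs, sq_abs]
  calc _ ≤ (((range R' ×ˢ range R').filter fun p =>
        ¬IsSmall μ T us (mderiv T ((p.1 : ℤ) • u) ((p.2 : ℤ) • u) f) δ).card : ℝ) := by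
          exact_mod_cast hcard
    _ ≤ δ' / (4 * (c : ℝ) ^ 2) * R' ^ 2 := h1
    _ ≤ δ' / (4 * (c : ℝ) ^ 2) * (2 * m * R) ^ 2 := by
        gcongr
        have : R' ≤ 2 * m * R := by nlinarith
        exact_mod_cast this
    _ = δ' * R ^ 2 := by
        rw [hmc]
        have : (m : ℝ) ≠ 0 := by exact_mod_cast hm0.ne'
        field_simp
        ring

end Uniformity

section PET

variable {X V : Type*} [MeasurableSpace X] [AddCommGroup V] {μ : Measure X}
  {T : V → X → X} {L : ℕ}

/-- The possible behaviours of a factor `g_j ∘ T_{D₀ - D_j}` relative to the distinguished factor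
`f ∘ T_{D₀}`. -/
inductive PointKind (V : Type*)
  | none
  | par (e : ℕ)
  | low (e : ℕ)
  | top (u : V)

/-- The weight of a class of points in the induction on complexity. -/
def PointKind.weight (D : ℕ) : PointKind V → ℕ
  | .none => 0
  | .par _ => 0
  | .low e => e
  | .top _ => D + 1

/-- Degree data of a polynomial family with a distinguished member. -/
structure PolyShape (V : Type*) where
  ι : Type
  κ : Type
  fι : Fintype ι
  fκ : Fintype κ
  D : ℕ
  e : ℕ
  u : V
  cl : ι → κ
  kind : κ → PointKind V

attribute [instance] PolyShape.fι PolyShape.fκ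

/-- The condition on a single point prescribed by its kind. -/
def PointOK (η : Fin L → ℤ) (D e₀ : ℕ) (u₀ : V) (D₀ : (Fin L → ℤ) → V) :
    PointKind V → ℤ → ((Fin L → ℤ) → V) → Prop
  | .none, _, _ => True
  | .par e, c, q => 1 ≤ e ∧ e < e₀ ∧ HasLead η e (c • u₀) q
  | .low e, c, q => 1 ≤ e ∧ HasLead η e₀ (c • u₀) q ∧ DegLT (e + 1) (fun n => D₀ n - q n)
  | .top u, c, q => e₀ ≤ D ∧ HasLead η D (c • u) q

/-- The condition on two points in the same class. -/
def PairOK (D : ℕ) : PointKind V → ((Fin L → ℤ) → V) → ((Fin L → ℤ) → V) → Prop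
  | .none, _, _ => True
  | .par _, _, _ => True
  | .low e, q, r => DegLT e (fun n => q n - r n)
  | .top _, q, r => DegLT D (fun n => q n - r n)

theorem PairOK.self (D : ℕ) (k : PointKind V) (q : (Fin L → ℤ) → V) : PairOK D k q q := by
  cases k <;> simp [PairOK, DegLT.zero]

/-- A polynomial family of a given shape. -/
structure PolyShape.Real (s : PolyShape V) (η : Fin L → ℤ) (c₀ : ℤ) (cD : s.ι → ℤ)
    (D₀ : (Fin L → ℤ) → V) (Dj : s.ι → (Fin L → ℤ) → V) (g : s.ι → X → ℂ) : Prop where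
  pos : 1 ≤ s.e
  lead : HasLead η s.e (c₀ • s.u) D₀
  b1 : ∀ j, B1 (g j)
  one : ∀ j, s.kind (s.cl j) = .none → g j = fun _ => 1
  pt : ∀ j, PointOK η s.D s.e s.u D₀ (s.kind (s.cl j)) (cD j) (Dj j)
  pair : ∀ i j, s.cl i = s.cl j → PairOK s.D (s.kind (s.cl i)) (Dj i) (Dj j)

/-- The terms of a multiple ergodic average. -/
def petTerm {ι : Type*} [Fintype ι] (T : V → X → X) (c : (Fin L → ℤ) → ℂ) (f : X → ℂ)
    (D₀ : (Fin L → ℤ) → V) (Dj : ι → (Fin L → ℤ) → V) (g : ι → X → ℂ) (n : Fin L → ℤ) (x : X) : ℂ :=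
  c n * f (T (D₀ n) x) * ∏ j, g j (T (D₀ n - Dj j n) x)

/-- The averages of shape `s` are controlled by the box averages along `us`. -/
def PolyShape.Ctrl (μ : Measure X) (T : V → X → X) (L : ℕ) (s : PolyShape V) (us : List V) : Prop :=
  ∀ (η : Fin L → ℤ) (c₀ : ℤ) (cD : s.ι → ℤ), c₀ ≠ 0 → (∀ j, cD j ≠ 0) → ∀ ε : ℝ, 0 < ε →
    ∃ δ : ℝ, 0 < δ ∧ ∀ D₀ Dj, ∀ g : s.ι → X → ℂ, s.Real η c₀ cD D₀ Dj g →
      ∀ c : (Fin L → ℤ) → ℂ, (∀ n, ‖c n‖ ≤ 1) → ∀ f : X → ℂ, B1 f → IsSmall μ T us f δ →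
        ∀ I, IsFolner L I →
          ∀ᶠ N in atTop, nsq μ (fun x => avg (I N) fun n => petTerm T c f D₀ Dj g n x) ≤ ε

theorem b1_petTerm {ι : Type*} [Fintype ι] (hT : IsMPAction μ T) {c : (Fin L → ℤ) → ℂ}
    (hc : ∀ n, ‖c n‖ ≤ 1) {f : X → ℂ} (hf : B1 f) (D₀ : (Fin L → ℤ) → V)
    (Dj : ι → (Fin L → ℤ) → V) {g : ι → X → ℂ} (hg : ∀ j, B1 (g j)) (n : Fin L → ℤ) :
    B1 (petTerm T c f D₀ Dj g n) :=
  ((B1.const (hc n)).mul (hf.act hT _)).mul (B1.prod _ fun j _ => (hg j).act hT _)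

section VdC

variable {ι : Type*}

/-- The polynomial family obtained by differencing with shifts `a`, `b`. -/
def diffPts (D₀ : (Fin L → ℤ) → V) (Dj : ι → (Fin L → ℤ) → V) (a b : Fin L → ℤ) :
    Option (ι × Bool) → (Fin L → ℤ) → V
  | none => fun n => D₀ (n + a) - D₀ (n + b)
  | some (j, false) => fun n => Dj j (n + a)
  | some (j, true) => fun n => Dj j (n + b) + (D₀ (n + a) - D₀ (n + b))

/-- The functions obtained by differencing. -/
def diffFun (f : X → ℂ) (g : ι → X → ℂ) : Option (ι × Bool) → X → ℂ
  | none => fun x => (starRingEnd ℂ) (f x)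
  | some (j, false) => g j
  | some (j, true) => fun x => (starRingEnd ℂ) (g j x)

theorem b1_diffFun {f : X → ℂ} {g : ι → X → ℂ} (hf : B1 f) (hg : ∀ j, B1 (g j))
    (y : Option (ι × Bool)) : B1 (diffFun f g y) := by
  rcases y with _ | ⟨j, _ | _⟩
  · exact hf.conj
  · exact hg j
  · exact (hg j).conj

theorem petTerm_mul_conj [Fintype ι] (hT : IsMPAction μ T) (c : (Fin L → ℤ) → ℂ) (f : X → ℂ)
    (D₀ : (Fin L → ℤ) → V) (Dj : ι → (Fin L → ℤ) → V) (g : ι → X → ℂ) (a b : Fin L → ℤ)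
    (y₀ : Option (ι × Bool)) (n : Fin L → ℤ) (x : X) :
    petTerm T c f D₀ Dj g (n + a) x * (starRingEnd ℂ) (petTerm T c f D₀ Dj g (n + b) x) =
      petTerm T (fun n => c (n + a) * (starRingEnd ℂ) (c (n + b))) f (diffPts D₀ Dj a b y₀)
        (diffPts D₀ Dj a b) (diffFun f g) n (T (D₀ (n + a) - diffPts D₀ Dj a b y₀ n) x) := by
  simp only [petTerm, hT.apply_add]
  generalize diffPts D₀ Dj a b y₀ n = z
  have e0 : z + (D₀ (n + a) - z) = D₀ (n + a) := by abel
  have e1 : ∀ w, z - w + (D₀ (n + a) - z) = D₀ (n + a) - w := fun w => by abel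
  simp only [e0, e1]
  simp only [Fintype.prod_option, Fintype.prod_prod_type, Fintype.prod_bool,
    diffFun, diffPts, Finset.prod_mul_distrib, map_mul, map_prod]
  have e2 : D₀ (n + a) - (D₀ (n + a) - D₀ (n + b)) = D₀ (n + b) := by abel
  have e3 : ∀ z, D₀ (n + a) - (z + (D₀ (n + a) - D₀ (n + b))) = D₀ (n + b) - z := fun z => by abel
  simp only [e2, e3]
  ring

variable [IsProbabilityMeasure μ]

/-- Replacing constant factors relative to the base point by `1`. -/
theorem norm_avg_integral_sq_le [Fintype ι] (hT : IsMPAction μ T) {c : (Fin L → ℤ) → ℂ}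
    (hc : ∀ n, ‖c n‖ ≤ 1) {f f' : X → ℂ} (hf : B1 f) (hf' : B1 f') (D₀ : (Fin L → ℤ) → V)
    (Dj : ι → (Fin L → ℤ) → V) {g : ι → X → ℂ} (hg : ∀ j, B1 (g j)) (a b : Fin L → ℤ)
    (y₀ : Option (ι × Bool)) {g' : Option (ι × Bool) → X → ℂ} (hg' : ∀ y, B1 (g' y))
    (hnone : ∃ k, B1 k ∧ ∀ n x,
      f (T (diffPts D₀ Dj a b y₀ n) x) *
        (starRingEnd ℂ) (f (T (diffPts D₀ Dj a b y₀ n - diffPts D₀ Dj a b none n) x)) =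
      k x * (f' (T (diffPts D₀ Dj a b y₀ n) x) *
        g' none (T (diffPts D₀ Dj a b y₀ n - diffPts D₀ Dj a b none n) x)))
    (hsome : ∀ y, g' (some y) = diffFun f g (some y) ∨ (g' (some y) = fun _ => 1) ∧
      ∃ s, ∀ n, diffPts D₀ Dj a b y₀ n - diffPts D₀ Dj a b (some y) n = s) (S : Finset (Fin L → ℤ)) :
    ‖avg S fun n => ∫ x, petTerm T c f D₀ Dj g (n + a) x *
        (starRingEnd ℂ) (petTerm T c f D₀ Dj g (n + b) x) ∂μ‖ ^ 2 ≤
      nsq μ (fun x => avg S fun n => petTerm T (fun n => c (n + a) * (starRingEnd ℂ) (c (n + b))) f'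
        (diffPts D₀ Dj a b y₀) (diffPts D₀ Dj a b) g' n x) := by
  set D' := diffPts D₀ Dj a b with hD'
  set c' : (Fin L → ℤ) → ℂ := fun n => c (n + a) * (starRingEnd ℂ) (c (n + b)) with hc'
  have hc1 : ∀ n, ‖c' n‖ ≤ 1 := fun n => by
    simp only [hc', norm_mul, RCLike.norm_conj]
    exact mul_le_one₀ (hc _) (norm_nonneg _) (hc _)
  obtain ⟨k0, hk0, hk0'⟩ := hnone
  have hk : ∀ y : ι × Bool, ∃ k, B1 k ∧ ∀ n x, diffFun f g (some y) (T (D' y₀ n - D' (some y) n) x) =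
      k x * g' (some y) (T (D' y₀ n - D' (some y) n) x) := by
    intro y
    rcases hsome y with h | ⟨h, s, hs⟩
    · exact ⟨fun _ => 1, B1.one, fun n x => by rw [h, one_mul]⟩
    · refine ⟨fun x => diffFun f g (some y) (T s x), (b1_diffFun hf hg _).act hT _, fun n x => ?_⟩
      rw [h, mul_one, hs]
  choose k hk1 hk2 using hk
  have key : ∀ n x, petTerm T c' f (D' y₀) D' (diffFun f g) n x =
      (k0 x * ∏ y, k y x) * petTerm T c' f' (D' y₀) D' g' n x := by
    intro n x
    simp only [petTerm, Fintype.prod_option, hk2, Finset.prod_mul_distrib]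
    have := hk0' n x
    simp only [diffFun] at this ⊢
    linear_combination (c' n * (∏ y, k y x) * ∏ y, g' (some y) (T (D' y₀ n - D' (some y) n) x)) * this
  have h1 : ∀ n, ∫ x, petTerm T c f D₀ Dj g (n + a) x *
        (starRingEnd ℂ) (petTerm T c f D₀ Dj g (n + b) x) ∂μ =
      ∫ x, (k0 x * ∏ y, k y x) * petTerm T c' f' (D' y₀) D' g' n x ∂μ := by
    intro n
    simp only [petTerm_mul_conj hT c f D₀ Dj g a b y₀]
    rw [hT.integral_comp (D₀ (n + a) - diffPts D₀ Dj a b y₀ n)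
      (fun x => petTerm T c' f (D' y₀) D' (diffFun f g) n x)]
    simp only [key]
  have hK : B1 (fun x => k0 x * ∏ y, k y x) := hk0.mul (B1.prod _ fun y _ => hk1 y)
  have hw := fun n => b1_petTerm hT hc1 hf' (D' y₀) D' hg' n
  have h2 : (avg S fun n => ∫ x, petTerm T c f D₀ Dj g (n + a) x *
        (starRingEnd ℂ) (petTerm T c f D₀ Dj g (n + b) x) ∂μ) =
      ∫ x, (avg S fun n => petTerm T c' f' (D' y₀) D' g' n x) * (k0 x * ∏ y, k y x) ∂μ := by
    simp only [h1, avg]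
    rw [← integral_finsetSum _ fun n _ => (hK.mul (hw n)).integrable, ← integral_const_mul]
    congr 1
    funext x
    rw [mul_assoc, Finset.sum_mul]
    congr 1
    exact Finset.sum_congr rfl fun n _ => mul_comm _ _
  rw [h2]
  exact norm_integral_sq_le_nsq (B1.avg S hw) hK

/-- Van der Corput's inequality with an exceptional set of pairs of shifts. -/
theorem nsq_avg_le_of_card {I : ℕ → Finset (Fin L → ℤ)} (hI : IsFolner L I)
    {u : (Fin L → ℤ) → X → ℂ} (hu : ∀ n, B1 (u n)) (η : Fin L → ℤ) {R : ℕ} (hR : 0 < R)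
    {ε : ℝ} (hε : 0 < ε) (B : Finset (ℕ × ℕ)) (hB : (B.card : ℝ) ≤ ε / 4 * R ^ 2)
    (hb : ∀ h < R, ∀ h' < R, (h, h') ∉ B → ∀ᶠ N in atTop, ‖avg (I N) fun n =>
      ∫ x, u (n + (h : ℤ) • η) x * (starRingEnd ℂ) (u (n + (h' : ℤ) • η) x) ∂μ‖ ^ 2 ≤ ε ^ 2 / 4) :
    ∀ᶠ N in atTop, nsq μ (fun x => avg (I N) fun n => u n x) ≤ ε := by
  classical
  refine vanDerCorput hI hu η hR (fun h h' => ε / 2 + if (h, h') ∈ B then 1 else 0) ?_ ?_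
  · intro h hh h' hh'
    by_cases hm : (h, h') ∈ B
    · refine Eventually.of_forall fun N => (norm_avg_le _ zero_le_one fun n _ =>
        ((hu _).mul (hu _).conj).norm_integral_le).trans ?_
      simp only [hm, if_true]
      linarith
    · filter_upwards [hb h hh h' hh' hm] with N hN
      simp only [hm, if_false, add_zero]
      refine le_of_sq_le_sq ?_ (by positivity)
      linarith
  · have h1 : ∑ h ∈ range R, ∑ h' ∈ range R, (ε / 2 + if (h, h') ∈ B then (1 : ℝ) else 0) ≤
        R ^ 2 * (ε / 2) + B.card := by
      rw [← Finset.sum_product' (range R) (range R) (fun h h' => ε / 2 + if (h, h') ∈ B then (1 : ℝ) else 0),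
        Finset.sum_add_distrib]
      simp only [sum_const, card_product, card_range, nsmul_eq_mul, Finset.sum_ite_mem]
      push_cast
      rw [sq]
      simp only [mul_one]
      gcongr
      exact Finset.inter_subset_right
    have hR' : (0 : ℝ) < R := by exact_mod_cast hR
    calc _ ≤ (R : ℝ)⁻¹ * (R : ℝ)⁻¹ * (R ^ 2 * (ε / 2) + ε / 4 * R ^ 2) := by
          gcongr
          linarith
      _ = 3 * ε / 4 := by field_simp; ring
      _ < ε := by linarith

end VdC

end PET

set_option linter.unusedSectionVars false

section PETStep

variable {X V : Type*} [MeasurableSpace X] [AddCommGroup V] {μ : Measure X}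
  {T : V → X → X} {L : ℕ}

open Classical in
/-- The shape of a differenced family: the classes satisfying `keep` persist, all other points
form singleton classes with kinds `nk`. -/
def PolyShape.next (s : PolyShape V) (keep : s.κ → Prop) (nk : Option (s.ι × Bool) → PointKind V)
    (e : ℕ) (u : V) : PolyShape V where
  ι := Option (s.ι × Bool)
  κ := s.κ ⊕ Option (s.ι × Bool)
  fι := inferInstance
  fκ := inferInstance
  D := s.D
  e := e
  u := u
  cl y := y.elim (Sum.inr none) fun p => if keep (s.cl p.1) then Sum.inl (s.cl p.1) else Sum.inr y
  kind := Sum.elim (fun x => if keep x then s.kind x else .none) nk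

section NextLemmas

variable (s : PolyShape V) (keep : s.κ → Prop) (nk : Option (s.ι × Bool) → PointKind V) (e : ℕ) (u : V)

theorem PolyShape.next_kind_none : (s.next keep nk e u).kind ((s.next keep nk e u).cl none) = nk none :=
  rfl

theorem PolyShape.next_kind_keep {j : s.ι} (β : Bool) (h : keep (s.cl j)) :
    (s.next keep nk e u).kind ((s.next keep nk e u).cl (some (j, β))) = s.kind (s.cl j) := by
  simp [PolyShape.next, h]

theorem PolyShape.next_kind_not {j : s.ι} (β : Bool) (h : ¬keep (s.cl j)) :
    (s.next keep nk e u).kind ((s.next keep nk e u).cl (some (j, β))) = nk (some (j, β)) := by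
  simp [PolyShape.next, h]

theorem PolyShape.next_cl_eq {y z : Option (s.ι × Bool)}
    (h : (s.next keep nk e u).cl y = (s.next keep nk e u).cl z) : y = z ∨
      ∃ i β j γ, y = some (i, β) ∧ z = some (j, γ) ∧ keep (s.cl i) ∧ s.cl i = s.cl j := by
  rcases y with _ | ⟨i, β⟩ <;> rcases z with _ | ⟨j, γ⟩
  · exact Or.inl rfl
  · by_cases hj : keep (s.cl j) <;> simp [PolyShape.next, hj] at h
  · by_cases hj : keep (s.cl i) <;> simp [PolyShape.next, hj] at h
  · by_cases hi : keep (s.cl i) <;> by_cases hj : keep (s.cl j) <;>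
      simp only [PolyShape.next, Option.elim, hi, hj, if_true, if_false, Sum.inl.injEq, Sum.inr.injEq,
        reduceCtorEq] at h
    · exact Or.inr ⟨i, β, j, γ, rfl, rfl, hi, h⟩
    · exact Or.inl h

end NextLemmas

theorem PairOK.symm {D : ℕ} {k : PointKind V} {q r : (Fin L → ℤ) → V} (h : PairOK D k q r) :
    PairOK D k r q := by
  cases k with
  | none => trivial
  | par e => trivial
  | low e =>
    have := DegLT.neg h
    simpa [PairOK] using this
  | top u =>
    have := DegLT.neg h
    simpa [PairOK] using this

section RealLemmas

variable {s : PolyShape V} {η : Fin L → ℤ} {c₀ : ℤ} {cD : s.ι → ℤ} {D₀ : (Fin L → ℤ) → V}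
  {Dj : s.ι → (Fin L → ℤ) → V} {g : s.ι → X → ℂ}

theorem PolyShape.Real.degLT_diff (hs : s.Real η c₀ cD D₀ Dj g) (a b : Fin L → ℤ) :
    DegLT s.e (fun n => D₀ (n + a) - D₀ (n + b)) :=
  hs.lead.1.diff a b

theorem PolyShape.Real.hasLead_diff (hs : s.Real η c₀ cD D₀ Dj g) {e : ℕ} (he : e + 1 = s.e)
    (h h' : ℤ) : HasLead η e (((h - h') * c₀) • s.u) (fun n => D₀ (n + h • η) - D₀ (n + h' • η)) := by
  have := hs.lead
  rw [← he] at this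
  rw [mul_smul]
  exact this.diff h h'

theorem PolyShape.Real.hasLead_diffPts (hs : s.Real η c₀ cD D₀ Dj g) {E : ℕ} (hE : s.e ≤ E) {ℓ : V}
    {j : s.ι} (hj : HasLead η E ℓ (Dj j)) (a b : Fin L → ℤ) (β : Bool) :
    HasLead η E ℓ (diffPts D₀ Dj a b (some (j, β))) := by
  cases β with
  | false => exact hj.shift a
  | true => exact (hj.shift b).add_degLT ((hs.degLT_diff a b).mono hE)

theorem PolyShape.Real.pairOK_diffPts (hs : s.Real η c₀ cD D₀ Dj g) (a b : Fin L → ℤ) {i j : s.ι}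
    (hij : s.cl i = s.cl j) (β γ : Bool) : PairOK s.D (s.kind (s.cl i))
      (diffPts D₀ Dj a b (some (i, β))) (diffPts D₀ Dj a b (some (j, γ))) := by
  have key : ∀ i j, s.cl i = s.cl j → PairOK s.D (s.kind (s.cl i))
      (diffPts D₀ Dj a b (some (i, false))) (diffPts D₀ Dj a b (some (j, true))) := by
    intro i j hij
    have h1 := hs.pair i j hij
    have h2 := hs.pt j
    rw [← hij] at h2
    rcases hk : s.kind (s.cl i) with _ | e | e | u <;> rw [hk] at h1 h2
    · trivial
    · trivial
    · have := (h1.shift a).sub (h2.2.2.diff a b)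
      simp only [PairOK, diffPts]
      convert this using 2
      abel
    · have := ((h1.shift a).add (h2.2.1.diff a b)).sub ((hs.degLT_diff a b).mono h2.1)
      simp only [PairOK, diffPts]
      convert this using 2
      abel
  rcases β with _ | _ <;> rcases γ with _ | _
  · have h1 := hs.pair i j hij
    rcases hk : s.kind (s.cl i) with _ | e | e | u <;> rw [hk] at h1
    · trivial
    · trivial
    · exact h1.shift a
    · exact h1.shift a
  · exact key i j hij
  · have := (key j i hij.symm).symm
    rwa [hij]
  · have h1 := hs.pair i j hij
    rcases hk : s.kind (s.cl i) with _ | e | e | u <;> rw [hk] at h1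
    · trivial
    · trivial
    · simp only [PairOK, diffPts]
      convert h1.shift b using 2
      abel
    · simp only [PairOK, diffPts]
      convert h1.shift b using 2
      abel

/-- Leading coefficients of the differenced family, where `t` is the difference of the shifts. -/
def PolyShape.nextCoef (s : PolyShape V) (c₀ : ℤ) (cD : s.ι → ℤ) (t : ℤ) : Option (s.ι × Bool) → ℤ
  | none => if s.e = 1 then 1 else t * c₀
  | some (j, false) => cD j
  | some (j, true) => if s.e = 1 then cD j else
      match s.kind (s.cl j) with
      | .par e => if e + 1 = s.e then cD j + t * c₀ else t * c₀
      | _ => cD j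

theorem PolyShape.nextCoef_ne_zero (hc : c₀ ≠ 0) (hcD : ∀ j, cD j ≠ 0) {t : ℤ}
    (ht : s.e ≠ 1 → t ≠ 0 ∧ ∀ j, cD j + t * c₀ ≠ 0) (y : Option (s.ι × Bool)) :
    s.nextCoef c₀ cD t y ≠ 0 := by
  rcases y with _ | ⟨j, _ | _⟩
  · simp only [nextCoef]
    split_ifs with h
    · exact one_ne_zero
    · exact mul_ne_zero (ht h).1 hc
  · exact hcD j
  · simp only [nextCoef]
    split_ifs with h
    · exact hcD j
    · split
      · split_ifs
        · exact (ht h).2 j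
        · exact mul_ne_zero (ht h).1 hc
      · exact hcD j

open Classical in
/-- The functions of the differenced family, with factors of kind `none` removed. -/
def PolyShape.nextFun (s : PolyShape V) (keep : s.κ → Prop) (nk : Option (s.ι × Bool) → PointKind V)
    (f : X → ℂ) (g : s.ι → X → ℂ) (y : Option (s.ι × Bool)) : X → ℂ :=
  if (s.next keep nk 0 0).kind ((s.next keep nk 0 0).cl y) = .none then fun _ => 1 else diffFun f g y

theorem PolyShape.Real.b1_nextFun (hs : s.Real η c₀ cD D₀ Dj g) {f : X → ℂ} (hf : B1 f)
    (keep : s.κ → Prop) (nk : Option (s.ι × Bool) → PointKind V) (y : Option (s.ι × Bool)) :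
    B1 (s.nextFun keep nk f g y) := by
  rw [nextFun]
  split_ifs
  · exact B1.one
  · exact b1_diffFun hf hs.b1 y

end RealLemmas

/-- Validity of a differencing step. -/
structure PolyShape.StepOK (s : PolyShape V) (X : Type*) [MeasurableSpace X] (L : ℕ) (keep : s.κ → Prop)
    (nk : Option (s.ι × Bool) → PointKind V) (e : ℕ) (u : V) (y₀ : Option (s.ι × Bool)) : Prop where
  merged : s.e = 1 → nk none = .none
  lead : ∀ (η : Fin L → ℤ) c₀ cD D₀ Dj (g : s.ι → X → ℂ), s.Real η c₀ cD D₀ Dj g →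
    ∀ h h' : ℤ, 1 ≤ e ∧ HasLead η e (s.nextCoef c₀ cD (h - h') y₀ • u) (diffPts D₀ Dj (h • η) (h' • η) y₀)
  pt : ∀ (η : Fin L → ℤ) c₀ cD D₀ Dj (g : s.ι → X → ℂ), s.Real η c₀ cD D₀ Dj g →
    ∀ h h' : ℤ, ∀ y, PointOK η s.D e u (diffPts D₀ Dj (h • η) (h' • η) y₀)
      ((s.next keep nk e u).kind ((s.next keep nk e u).cl y)) (s.nextCoef c₀ cD (h - h') y)
      (diffPts D₀ Dj (h • η) (h' • η) y)
  const_of : ∀ (η : Fin L → ℤ) c₀ cD D₀ Dj (g : s.ι → X → ℂ), s.Real η c₀ cD D₀ Dj g →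
    ∀ h h' : ℤ, ∀ y, (s.next keep nk e u).kind ((s.next keep nk e u).cl y) = .none →
      (y = .none ∧ s.e = 1) ∨ (∃ j β, y = some (j, β) ∧ s.kind (s.cl j) = .none) ∨
      ∃ v, ∀ n, diffPts D₀ Dj (h • η) (h' • η) y₀ n - diffPts D₀ Dj (h • η) (h' • η) y n = v

variable {s : PolyShape V} {keep : s.κ → Prop} {nk : Option (s.ι × Bool) → PointKind V} {e : ℕ} {u : V}
  {y₀ : Option (s.ι × Bool)}

theorem PolyShape.StepOK.real (hst : s.StepOK X L keep nk e u y₀) {η : Fin L → ℤ} {c₀ : ℤ}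
    {cD : s.ι → ℤ} {D₀ : (Fin L → ℤ) → V} {Dj : s.ι → (Fin L → ℤ) → V} {g : s.ι → X → ℂ}
    (hs : s.Real η c₀ cD D₀ Dj g) {f : X → ℂ} (hf : B1 f) (h h' : ℤ) :
    (s.next keep nk e u).Real η (s.nextCoef c₀ cD (h - h') y₀) (s.nextCoef c₀ cD (h - h'))
      (diffPts D₀ Dj (h • η) (h' • η) y₀) (diffPts D₀ Dj (h • η) (h' • η)) (s.nextFun keep nk f g) where
  pos := (hst.lead η c₀ cD D₀ Dj g hs h h').1
  lead := (hst.lead η c₀ cD D₀ Dj g hs h h').2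
  b1 := hs.b1_nextFun hf keep nk
  one y hy := if_pos hy
  pt := hst.pt η c₀ cD D₀ Dj g hs h h'
  pair y z hyz := by
    rcases s.next_cl_eq keep nk e u hyz with rfl | ⟨i, β, j, γ, rfl, rfl, hk, hij⟩
    · exact PairOK.self _ _ _
    · rw [next_kind_keep _ _ _ _ _ _ hk]
      exact hs.pairOK_diffPts _ _ hij β γ

theorem PolyShape.StepOK.nextFun_eq (hst : s.StepOK X L keep nk e u y₀) {η : Fin L → ℤ} {c₀ : ℤ}
    {cD : s.ι → ℤ} {D₀ : (Fin L → ℤ) → V} {Dj : s.ι → (Fin L → ℤ) → V} {g : s.ι → X → ℂ}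
    (hs : s.Real η c₀ cD D₀ Dj g) {f : X → ℂ} (h h' : ℤ) (y : Option (s.ι × Bool))
    (hy : y = none → s.e ≠ 1) :
    s.nextFun keep nk f g y = diffFun f g y ∨ (s.nextFun keep nk f g y = fun _ => 1) ∧
      ∃ v, ∀ n, diffPts D₀ Dj (h • η) (h' • η) y₀ n - diffPts D₀ Dj (h • η) (h' • η) y n = v := by
  by_cases hk : (s.next keep nk e u).kind ((s.next keep nk e u).cl y) = .none
  · have h1 : s.nextFun keep nk f g y = fun _ => 1 := by
      rw [nextFun, if_pos]
      exact hk
    rcases hst.const_of η c₀ cD D₀ Dj g hs h h' y hk with ⟨h2, h3⟩ | ⟨j, β, rfl, h2⟩ | h2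
    · exact absurd h3 (hy h2)
    · left
      rw [h1]
      have := hs.one j h2
      cases β <;> simp [diffFun, this]
    · exact Or.inr ⟨h1, h2⟩
  · left
    rw [nextFun, if_neg]
    exact hk

variable [IsProbabilityMeasure μ]

theorem PolyShape.StepOK.bound (hst : s.StepOK X L keep nk e u y₀) (hT : IsMPAction μ T)
    (he : s.e ≠ 1) {η : Fin L → ℤ} {c₀ : ℤ}
    {cD : s.ι → ℤ} {D₀ : (Fin L → ℤ) → V} {Dj : s.ι → (Fin L → ℤ) → V} {g : s.ι → X → ℂ}
    (hs : s.Real η c₀ cD D₀ Dj g) {f : X → ℂ} (hf : B1 f) {c : (Fin L → ℤ) → ℂ} (hc : ∀ n, ‖c n‖ ≤ 1)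
    (h h' : ℤ) (S : Finset (Fin L → ℤ)) :
    ‖avg S fun n => ∫ x, petTerm T c f D₀ Dj g (n + h • η) x *
        (starRingEnd ℂ) (petTerm T c f D₀ Dj g (n + h' • η) x) ∂μ‖ ^ 2 ≤
      nsq μ (fun x => avg S fun n =>
        petTerm T (fun n => c (n + h • η) * (starRingEnd ℂ) (c (n + h' • η))) f
        (diffPts D₀ Dj (h • η) (h' • η) y₀) (diffPts D₀ Dj (h • η) (h' • η)) (s.nextFun keep nk f g) n x) := by
  refine norm_avg_integral_sq_le hT hc hf hf D₀ Dj hs.b1 _ _ y₀ (hs.b1_nextFun hf keep nk) ?_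
    (fun y => hst.nextFun_eq hs h h' _ (by simp)) S
  rcases hst.nextFun_eq hs (f := f) h h' none (fun _ => he) with h1 | ⟨h1, v, hv⟩
  · exact ⟨fun _ => 1, B1.one, fun n x => by rw [h1, one_mul]; rfl⟩
  · refine ⟨fun x => (starRingEnd ℂ) (f (T v x)), (hf.act hT v).conj, fun n x => ?_⟩
    rw [h1, hv]
    ring

theorem PolyShape.StepOK.bound_one (hst : s.StepOK X L keep nk e u y₀) (hT : IsMPAction μ T)
    (he : s.e = 1) {η : Fin L → ℤ} {c₀ : ℤ}
    {cD : s.ι → ℤ} {D₀ : (Fin L → ℤ) → V} {Dj : s.ι → (Fin L → ℤ) → V} {g : s.ι → X → ℂ}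
    (hs : s.Real η c₀ cD D₀ Dj g) {f : X → ℂ} (hf : B1 f) {c : (Fin L → ℤ) → ℂ} (hc : ∀ n, ‖c n‖ ≤ 1)
    (h h' : ℤ) (S : Finset (Fin L → ℤ)) :
    ‖avg S fun n => ∫ x, petTerm T c f D₀ Dj g (n + h • η) x *
        (starRingEnd ℂ) (petTerm T c f D₀ Dj g (n + h' • η) x) ∂μ‖ ^ 2 ≤
      nsq μ (fun x => avg S fun n =>
        petTerm T (fun n => c (n + h • η) * (starRingEnd ℂ) (c (n + h' • η)))
        (fun x => mderiv T (h • c₀ • s.u) (h' • c₀ • s.u) f (T (-(h • c₀ • s.u)) x))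
        (diffPts D₀ Dj (h • η) (h' • η) y₀) (diffPts D₀ Dj (h • η) (h' • η)) (s.nextFun keep nk f g) n x) := by
  refine norm_avg_integral_sq_le hT hc hf ((hf.mderiv hT _ _).act hT _) D₀ Dj hs.b1 _ _ y₀
    (hs.b1_nextFun hf keep nk) ?_ (fun y => hst.nextFun_eq hs h h' _ (by simp)) S
  refine ⟨fun _ => 1, B1.one, fun n x => ?_⟩
  have h1 : s.nextFun keep nk f g none = fun _ => 1 := by
    rw [nextFun, if_pos]
    exact hst.merged he
  have h2 : diffPts D₀ Dj (h • η) (h' • η) none n = (h - h') • c₀ • s.u := by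
    have := hs.lead
    rw [he] at this
    exact this.diff_one h h' n
  generalize diffPts D₀ Dj (h • η) (h' • η) y₀ n = z at *
  simp only [h1, h2, one_mul, mul_one, mderiv, hT.apply_add]
  rw [show h • c₀ • s.u + (-(h • c₀ • s.u) + z) = z by abel,
    show h' • c₀ • s.u + (-(h • c₀ • s.u) + z) = z - (h - h') • c₀ • s.u by rw [sub_smul]; abel]

theorem card_degenerate_le {ι : Type*} [Fintype ι] (c : ι → ℤ) {c₀ : ℤ} (hc : c₀ ≠ 0) (R : ℕ) :
    (((range R ×ˢ range R).filter fun p : ℕ × ℕ => ∃ i, c i + ((p.1 : ℤ) - p.2) * c₀ = 0).card : ℝ) ≤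
      Fintype.card ι * R := by
  classical
  have : ((range R ×ˢ range R).filter fun p : ℕ × ℕ => ∃ i, c i + ((p.1 : ℤ) - p.2) * c₀ = 0) ⊆
      Finset.univ.biUnion fun i => (range R ×ˢ range R).filter fun p : ℕ × ℕ =>
        c i + ((p.1 : ℤ) - p.2) * c₀ = 0 := by
    intro p hp
    obtain ⟨h1, i, h2⟩ := Finset.mem_filter.1 hp
    exact Finset.mem_biUnion.2 ⟨i, Finset.mem_univ _, Finset.mem_filter.2 ⟨h1, h2⟩⟩
  have h2 := (Finset.card_le_card this).trans Finset.card_biUnion_le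
  have h3 : ∀ i, ((range R ×ˢ range R).filter fun p : ℕ × ℕ =>
        c i + ((p.1 : ℤ) - p.2) * c₀ = 0).card ≤ R := by
    intro i
    calc _ ≤ (range R).card := by
          refine Finset.card_le_card_of_injOn Prod.fst ?_ ?_
          · intro p hp
            exact (Finset.mem_product.1 (Finset.mem_filter.1 hp).1).1
          · intro p hp q hq hpq
            have h1 := (Finset.mem_filter.1 hp).2
            have h2 := (Finset.mem_filter.1 hq).2
            have : ((p.1 : ℤ) - p.2) = (q.1 : ℤ) - q.2 :=
              mul_right_cancel₀ hc (add_left_cancel (h1.trans h2.symm))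
            have hpq' : p.1 = q.1 := hpq
            refine Prod.ext hpq ?_
            omega
      _ = R := card_range R
  have h4 := h2.trans (Finset.sum_le_sum fun i _ => h3 i)
  simp only [sum_const, card_univ, smul_eq_mul] at h4
  exact_mod_cast h4

theorem PolyShape.StepOK.ctrl (hst : s.StepOK X L keep nk e u y₀) (hT : IsMPAction μ T)
    (he : s.e ≠ 1) {us : List V} (hctrl : (s.next keep nk e u).Ctrl μ T L us) : s.Ctrl μ T L us := by
  classical
  intro η c₀ cD hc₀ hcD ε hε
  obtain ⟨R, hR⟩ := exists_nat_ge (4 * (Fintype.card (Option s.ι) : ℝ) / ε + 1)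
  have hR1 : (1 : ℝ) ≤ R := by
    have : 0 ≤ 4 * (Fintype.card (Option s.ι) : ℝ) / ε := by positivity
    linarith
  have hR0 : 0 < R := by exact_mod_cast (zero_lt_one.trans_le hR1)
  set c' : Option s.ι → ℤ := fun o => o.elim 0 cD with hc'
  set B := (range R ×ˢ range R).filter fun p : ℕ × ℕ => ∃ i, c' i + ((p.1 : ℤ) - p.2) * c₀ = 0 with hB
  have hBc : (B.card : ℝ) ≤ ε / 4 * R ^ 2 := by
    refine (card_degenerate_le c' hc₀ R).trans ?_
    have : 4 * (Fintype.card (Option s.ι) : ℝ) / ε ≤ R := by linarith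
    rw [div_le_iff₀ hε] at this
    nlinarith
  have hgood : ∀ p : ℕ × ℕ, p ∈ (range R ×ˢ range R) \ B → ∃ δ : ℝ, 0 < δ ∧ ∀ D₀ Dj,
      ∀ g : Option (s.ι × Bool) → X → ℂ, (s.next keep nk e u).Real η
        (s.nextCoef c₀ cD ((p.1 : ℤ) - p.2) y₀) (s.nextCoef c₀ cD ((p.1 : ℤ) - p.2)) D₀ Dj g →
      ∀ c : (Fin L → ℤ) → ℂ, (∀ n, ‖c n‖ ≤ 1) → ∀ f : X → ℂ, B1 f → IsSmall μ T us f δ →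
        ∀ I, IsFolner L I →
          ∀ᶠ N in atTop, nsq μ (fun x => avg (I N) fun n => petTerm T c f D₀ Dj g n x) ≤ ε ^ 2 / 4 := by
    intro p hp
    obtain ⟨hp1, hp2⟩ := Finset.mem_sdiff.1 hp
    have h0 : ∀ i, c' i + ((p.1 : ℤ) - p.2) * c₀ ≠ 0 := fun i hi =>
      hp2 (Finset.mem_filter.2 ⟨hp1, i, hi⟩)
    have hne := s.nextCoef_ne_zero hc₀ hcD (t := (p.1 : ℤ) - p.2) fun _ =>
      ⟨fun h => h0 none (by simp [hc', h]), fun j => h0 (some j)⟩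
    exact hctrl η _ _ (hne y₀) hne (ε ^ 2 / 4) (by positivity)
  choose! δ hδ hδ' using hgood
  obtain ⟨δm, hδm, hδm'⟩ : ∃ δm : ℝ, 0 < δm ∧ ∀ p ∈ (range R ×ˢ range R) \ B, δm ≤ δ p := by
    rcases ((range R ×ˢ range R) \ B).eq_empty_or_nonempty with hE | hE
    · exact ⟨1, one_pos, by simp [hE]⟩
    · obtain ⟨p, hp, hp'⟩ := Finset.exists_min_image _ δ hE
      exact ⟨δ p, hδ p hp, hp'⟩
  refine ⟨δm, hδm, fun D₀ Dj g hs c hc f hf hsm I hI => ?_⟩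
  refine nsq_avg_le_of_card hI (fun n => b1_petTerm hT hc hf D₀ Dj hs.b1 n) η hR0 hε B hBc ?_
  intro h hh h' hh' hhB
  have hp : (h, h') ∈ (range R ×ˢ range R) \ B := by simp [hh, hh', hhB]
  have := hδ' (h, h') hp _ _ _ (hst.real hs hf h h')
    (fun n => c (n + (h : ℤ) • η) * (starRingEnd ℂ) (c (n + (h' : ℤ) • η)))
    (fun n => by
      simp only [norm_mul, RCLike.norm_conj]
      exact mul_le_one₀ (hc _) (norm_nonneg _) (hc _)) f hf (hsm.mono (hδm' _ hp)) I hI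
  filter_upwards [this] with N hN
  exact (hst.bound hT he hs hf hc h h' (I N)).trans hN

theorem PolyShape.StepOK.ctrl_one (hst : s.StepOK X L keep nk e u y₀) (hT : IsMPAction μ T)
    (he : s.e = 1) {us : List V} (hctrl : (s.next keep nk e u).Ctrl μ T L us) :
    s.Ctrl μ T L (s.u :: us) := by
  classical
  intro η c₀ cD hc₀ hcD ε hε
  have hcoef : ∀ t, s.nextCoef c₀ cD t = s.nextCoef c₀ cD 0 := by
    intro t
    funext y
    rcases y with _ | ⟨j, _ | _⟩ <;> simp [nextCoef, he]
  have hne := s.nextCoef_ne_zero hc₀ hcD (t := 0) fun h => absurd he h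
  obtain ⟨δ, hδ, hδ'⟩ := hctrl η _ _ (hne y₀) hne (ε ^ 2 / 4) (by positivity)
  have hcR : (0 : ℝ) < (c₀ : ℝ) ^ 2 := by positivity
  refine ⟨δ * ((ε / 4) / (4 * (c₀ : ℝ) ^ 2)), by positivity, fun D₀ Dj g hs c hc f hf hsm I hI => ?_⟩
  obtain ⟨R, -, hR0, hRc⟩ := hsm.exists_card_le hT hδ (by positivity) hc₀ 0
  refine nsq_avg_le_of_card hI (fun n => b1_petTerm hT hc hf D₀ Dj hs.b1 n) η hR0 hε _ hRc ?_
  intro h hh h' hh' hhB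
  have hsm' : IsSmall μ T us (mderiv T ((h : ℤ) • c₀ • s.u) ((h' : ℤ) • c₀ • s.u) f) δ := by
    by_contra hcon
    exact hhB (Finset.mem_filter.2 ⟨by simp [hh, hh'], hcon⟩)
  have hr := hst.real hs hf h h'
  rw [hcoef] at hr
  have := hδ' _ _ _ hr
    (fun n => c (n + (h : ℤ) • η) * (starRingEnd ℂ) (c (n + (h' : ℤ) • η)))
    (fun n => by
      simp only [norm_mul, RCLike.norm_conj]
      exact mul_le_one₀ (hc _) (norm_nonneg _) (hc _)) _ ((hf.mderiv hT _ _).act hT _)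
    ((isSmall_comp hT (-((h : ℤ) • c₀ • s.u))).2 hsm') I hI
  filter_upwards [this] with N hN
  exact (hst.bound_one hT he hs hf hc h h' (I N)).trans hN

/-- The base case of the induction: only the distinguished point is left, of degree one. -/
theorem PolyShape.ctrl_terminal (hT : IsMPAction μ T) (he : s.e = 1)
    (hk : ∀ j, s.kind (s.cl j) = .none) : s.Ctrl μ T L [s.u] := by
  classical
  intro η c₀ cD hc₀ hcD ε hε
  have hcR : (0 : ℝ) < (c₀ : ℝ) ^ 2 := by positivity
  refine ⟨(ε ^ 2 / 4) * ((ε / 4) / (4 * (c₀ : ℝ) ^ 2)), by positivity,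
    fun D₀ Dj g hs c hc f hf hsm I hI => ?_⟩
  obtain ⟨R, -, hR0, hRc⟩ := hsm.exists_card_le hT (by positivity) (by positivity) hc₀ 0
  refine nsq_avg_le_of_card hI (fun n => b1_petTerm hT hc hf D₀ Dj hs.b1 n) η hR0 hε _ hRc ?_
  intro h hh h' hh' hhB
  have hsm' : IsSmall μ T [] (mderiv T ((h : ℤ) • c₀ • s.u) ((h' : ℤ) • c₀ • s.u) f) (ε ^ 2 / 4) := by
    by_contra hcon
    exact hhB (Finset.mem_filter.2 ⟨by simp [hh, hh'], hcon⟩)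
  have hsm2 := eventually_GU_zero.1 hsm'
  rw [boxAvg] at hsm2
  refine Eventually.of_forall fun N => le_trans ?_ hsm2
  have hl := hs.lead
  rw [he] at hl
  have h1 : ∀ n, ∫ x, petTerm T c f D₀ Dj g (n + (h : ℤ) • η) x *
      (starRingEnd ℂ) (petTerm T c f D₀ Dj g (n + (h' : ℤ) • η) x) ∂μ =
      (c (n + (h : ℤ) • η) * (starRingEnd ℂ) (c (n + (h' : ℤ) • η))) *
        ∫ x, mderiv T ((h : ℤ) • c₀ • s.u) ((h' : ℤ) • c₀ • s.u) f x ∂μ := by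
    intro n
    rw [← hT.integral_comp (D₀ n) (mderiv T ((h : ℤ) • c₀ • s.u) ((h' : ℤ) • c₀ • s.u) f),
      ← integral_const_mul]
    congr 1
    funext x
    have h2 : ∀ t : ℤ, D₀ (n + t • η) = t • c₀ • s.u + D₀ n := fun t => by
      have := hl.diff_one t 0 n
      simp only [zero_smul, add_zero, sub_zero] at this
      rw [← this]
      abel
    simp only [petTerm, fun j => hs.one j (hk j), prod_const_one, mul_one, map_mul, mderiv,
      hT.apply_add, h2]
    ring
  simp only [h1, avg_mul_right, norm_mul]
  rw [mul_pow]
  refine mul_le_of_le_one_left (by positivity) (pow_le_one₀ (norm_nonneg _)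
    (norm_avg_le _ zero_le_one fun n _ => ?_))
  simp only [norm_mul, RCLike.norm_conj]
  exact mul_le_one₀ (hc _) (norm_nonneg _) (hc _)

end PETStep

set_option linter.unusedSectionVars false

section PETInduction

variable {X V : Type*} [MeasurableSpace X] [AddCommGroup V] {μ : Measure X}
  {T : V → X → X} {L : ℕ} (s : PolyShape V)

/-- The complexity of a shape. -/
def PolyShape.complexity : Multiset ℕ :=
  {s.e} + (univ : Finset s.κ).val.map fun x => (s.kind x).weight s.D

open Classical in
theorem PolyShape.complexity_next (keep : s.κ → Prop) (nk : Option (s.ι × Bool) → PointKind V) (e : ℕ)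
    (u : V) : (s.next keep nk e u).complexity =
      (univ.filter keep).val.map (fun x => (s.kind x).weight s.D) +
        ({e} + ((univ.filter fun x => ¬keep x).val.map (fun _ => 0) +
          (univ : Finset (Option (s.ι × Bool))).val.map fun y => (nk y).weight s.D)) := by
  have h2 : (univ : Finset s.κ).val = (univ.filter keep).val + (univ.filter fun x => ¬keep x).val := by
    simp only [Finset.filter_val]
    exact (Multiset.filter_add_not _ _).symm
  have h3 : ((univ.filter keep).val.map (fun x => ((if keep x then s.kind x else .none).weight s.D))) =
      (univ.filter keep).val.map (fun x => (s.kind x).weight s.D) := by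
    refine Multiset.map_congr rfl fun x hx => ?_
    have : keep x := (Finset.mem_filter.1 hx).2
    simp [this]
  have h4 : ((univ.filter fun x => ¬keep x).val.map
      (fun x => ((if keep x then s.kind x else .none).weight s.D))) =
      (univ.filter fun x => ¬keep x).val.map (fun _ => 0) := by
    refine Multiset.map_congr rfl fun x hx => ?_
    have : ¬keep x := (Finset.mem_filter.1 hx).2
    simp [this, PointKind.weight]
  have h5 : (s.next keep nk e u).complexity = {e} +
      ((univ : Finset s.κ).val.map (fun x => (if keep x then s.kind x else .none).weight s.D) +
        (univ : Finset (Option (s.ι × Bool))).val.map fun y => (nk y).weight s.D) := by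
    have h6 : (s.next keep nk e u).complexity = {e} + ((univ : Finset s.κ).val.map Sum.inl +
      (univ : Finset (Option (s.ι × Bool))).val.map Sum.inr).map
        fun x => (Sum.elim (fun x => if keep x then s.kind x else .none) nk x).weight s.D := rfl
    rw [h6, Multiset.map_add, Multiset.map_map, Multiset.map_map]
    rfl
  rw [h5, h2, Multiset.map_add, h3, h4]
  abel

open Classical in
theorem PolyShape.complexity_eq (keep : s.κ → Prop) : s.complexity =
      (univ.filter keep).val.map (fun x => (s.kind x).weight s.D) +
        ({s.e} + (univ.filter fun x => ¬keep x).val.map (fun x => (s.kind x).weight s.D)) := by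
  have h2 : (univ : Finset s.κ).val = (univ.filter keep).val + (univ.filter fun x => ¬keep x).val := by
    simp only [Finset.filter_val]
    exact (Multiset.filter_add_not _ _).symm
  rw [complexity, h2, Multiset.map_add]
  abel

theorem PolyShape.complexity_next_lt (keep : s.κ → Prop) (nk : Option (s.ι × Bool) → PointKind V) (e : ℕ)
    (u : V) (z : ℕ) (hz : z = s.e ∨ ∃ x, ¬keep x ∧ z = (s.kind x).weight s.D) (he : e < z)
    (hnk : ∀ y, (nk y).weight s.D < z) :
    Multiset.IsDershowitzMannaLT (s.next keep nk e u).complexity s.complexity := by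
  classical
  refine ⟨_, _, _, ?_, s.complexity_next keep nk e u, s.complexity_eq keep, ?_⟩
  · intro h
    have := congrArg Multiset.card h
    simp at this
  · have hz' : z ∈ ({s.e} + (univ.filter fun x => ¬keep x).val.map (fun x => (s.kind x).weight s.D) :
        Multiset ℕ) := by
      rcases hz with rfl | ⟨x, hx, rfl⟩
      · simp
      · refine Multiset.mem_add.2 (Or.inr (Multiset.mem_map.2 ⟨x, ?_, rfl⟩))
        exact Finset.mem_filter.2 ⟨Finset.mem_univ _, hx⟩
    intro w hw
    refine ⟨z, hz', ?_⟩
    rcases Multiset.mem_add.1 hw with h | h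
    · rw [Multiset.mem_singleton.1 h]; exact he
    · rcases Multiset.mem_add.1 h with h | h
      · obtain ⟨_, _, rfl⟩ := Multiset.mem_map.1 h
        omega
      · obtain ⟨y, _, rfl⟩ := Multiset.mem_map.1 h
        exact hnk y

theorem PolyShape.complexity_next_lt' (keep : s.κ → Prop) (nk : Option (s.ι × Bool) → PointKind V)
    (u : V) (x : s.κ) (hx : ¬keep x) (hx0 : 0 < (s.kind x).weight s.D)
    (hnk : ∀ y, (nk y).weight s.D < (s.kind x).weight s.D) :
    Multiset.IsDershowitzMannaLT (s.next keep nk s.e u).complexity s.complexity := by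
  classical
  refine ⟨(univ.filter keep).val.map (fun x => (s.kind x).weight s.D) + {s.e},
    (univ.filter fun x => ¬keep x).val.map (fun _ => 0) +
          (univ : Finset (Option (s.ι × Bool))).val.map fun y => (nk y).weight s.D,
    (univ.filter fun x => ¬keep x).val.map (fun x => (s.kind x).weight s.D), ?_, ?_, ?_, ?_⟩
  · intro h
    have hm : x ∈ (univ.filter fun x => ¬keep x).val := Finset.mem_filter.2 ⟨Finset.mem_univ _, hx⟩
    have := Multiset.mem_map_of_mem (fun x => (s.kind x).weight s.D) hm
    rw [h] at this
    simp at this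
  · rw [s.complexity_next keep nk s.e u, add_assoc]
  · rw [s.complexity_eq keep, add_assoc]
  · intro w hw
    refine ⟨_, Multiset.mem_map.2 ⟨x, Finset.mem_filter.2 ⟨Finset.mem_univ _, hx⟩, rfl⟩, ?_⟩
    rcases Multiset.mem_add.1 hw with h | h
    · obtain ⟨_, _, rfl⟩ := Multiset.mem_map.1 h
      exact hx0
    · obtain ⟨y, _, rfl⟩ := Multiset.mem_map.1 h
      exact hnk y

variable {s}

section RealLemmas

variable {η : Fin L → ℤ} {c₀ : ℤ} {cD : s.ι → ℤ} {D₀ : (Fin L → ℤ) → V}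
  {Dj : s.ι → (Fin L → ℤ) → V} {g : s.ι → X → ℂ}

theorem PolyShape.nextCoef_of_ne_par {j : s.ι} (h : ∀ e, s.kind (s.cl j) ≠ .par e) (t : ℤ) (β : Bool) :
    s.nextCoef c₀ cD t (some (j, β)) = cD j := by
  cases β
  · rfl
  · rcases hk : s.kind (s.cl j) with _ | e | e | u
    · simp [nextCoef, hk]
    · exact absurd hk (h e)
    · simp [nextCoef, hk]
    · simp [nextCoef, hk]

/-- The second copy of a point of kind `par` has degree one less than the distinguished point. -/
theorem PolyShape.Real.hasLead_par (hs : s.Real η c₀ cD D₀ Dj g) {j : s.ι} {e : ℕ}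
    (hj : s.kind (s.cl j) = .par e) (h h' : ℤ) :
    HasLead η (s.e - 1) (s.nextCoef c₀ cD (h - h') (some (j, true)) • s.u)
      (diffPts D₀ Dj (h • η) (h' • η) (some (j, true))) := by
  have h1 := hs.pt j
  rw [hj] at h1
  obtain ⟨h2, h3, h4⟩ := h1
  have he : s.e ≠ 1 := by omega
  have h5 := hs.hasLead_diff (e := s.e - 1) (by omega) h h'
  simp only [nextCoef, he, if_false, hj, diffPts]
  split_ifs with h6
  · have h7 : s.e - 1 = e := by omega
    rw [h7] at h5 ⊢
    rw [add_smul]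
    exact (h4.shift _).add h5
  · exact h5.degLT_add ((h4.1.shift _).mono (by omega))

end RealLemmas

open Classical in
/-- The kinds of the points after a step of the first type. -/
def PolyShape.nkLow (s : PolyShape V) (x₀ : s.κ) : Option (s.ι × Bool) → PointKind V
  | none => if s.e = 1 then .none else .par (s.e - 1)
  | some (j, β) => match s.kind (s.cl j) with
    | .par e => if β then .par (s.e - 1) else .par e
    | .low e => if s.cl j = x₀ ∧ e ≠ 1 then .low (e - 1) else .none
    | _ => .none

theorem PolyShape.stepOK_low {j₀ : s.ι} {e₁ : ℕ} (hj₀ : s.kind (s.cl j₀) = .low e₁)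
    (hmin : ∀ j e, s.kind (s.cl j) = .low e → e₁ ≤ e) :
    s.StepOK X L (fun x => (x ≠ s.cl j₀ ∧ ∃ e, s.kind x = .low e) ∨ ∃ u, s.kind x = .top u)
      (s.nkLow (s.cl j₀)) s.e s.u (some (j₀, true)) where
  merged h := by simp [nkLow, h]
  lead η c₀ cD D₀ Dj g hs h h' := by
    refine ⟨hs.pos, ?_⟩
    rw [nextCoef_of_ne_par (by simp [hj₀])]
    have := hs.pt j₀
    rw [hj₀] at this
    exact hs.hasLead_diffPts le_rfl this.2.1 _ _ true
  pt η c₀ cD D₀ Dj g hs h h' y := by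
    rcases y with _ | ⟨j, β⟩
    · rw [next_kind_none]
      simp only [nkLow]
      split_ifs with he
      · trivial
      · have := hs.pos
        refine ⟨by omega, by omega, ?_⟩
        simp only [nextCoef, he, if_false]
        exact hs.hasLead_diff (by omega) h h'
    · have hp := hs.pt j
      rcases hk : s.kind (s.cl j) with _ | e | e | u
      · rw [next_kind_not _ _ _ _ _ _ (by simp [hk])]
        simp only [nkLow, hk]
        trivial
      · rw [next_kind_not _ _ _ _ _ _ (by simp [hk])]
        rw [hk] at hp
        simp only [nkLow, hk]
        cases β
        · exact ⟨hp.1, hp.2.1, hp.2.2.shift _⟩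
        · exact ⟨by have := hp.1; have := hp.2.1; omega, by have := hp.1; have := hp.2.1; omega,
            hs.hasLead_par hk h h'⟩
      · rw [nextCoef_of_ne_par (by simp [hk])]
        rw [hk] at hp
        by_cases hx : s.cl j = s.cl j₀
        · rw [next_kind_not _ _ _ _ _ _ (by simp [hx, hj₀])]
          simp only [nkLow, hk]
          simp only [hx, true_and]
          split_ifs with he
          · have h1 := hp.1
            refine ⟨by omega, hs.hasLead_diffPts le_rfl hp.2.1 _ _ β, ?_⟩
            have h2 := hs.pairOK_diffPts (h • η) (h' • η) hx.symm true β
            rw [← hx, hk] at h2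
            rwa [Nat.sub_add_cancel h1]
          · trivial
        · rw [next_kind_keep _ _ _ _ _ _ (by simp [hk, hx]), hk]
          refine ⟨hp.1, hs.hasLead_diffPts le_rfl hp.2.1 _ _ β, ?_⟩
          have h0 := hs.pt j₀
          rw [hj₀] at h0
          have h3 := h0.2.2.mono (e' := e + 1) (by have := hmin j e hk; omega)
          cases β
          · convert (hp.2.2.shift (h • η)).sub (h3.shift (h' • η)) using 2
            simp only [diffPts]
            abel
          · convert (hp.2.2.shift (h' • η)).sub (h3.shift (h' • η)) using 2
            simp only [diffPts]
            abel
      · rw [nextCoef_of_ne_par (by simp [hk])]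
        rw [next_kind_keep _ _ _ _ _ _ (by simp [hk]), hk]
        rw [hk] at hp
        exact ⟨hp.1, hs.hasLead_diffPts hp.1 hp.2 _ _ β⟩
  const_of η c₀ cD D₀ Dj g hs h h' y hy := by
    rcases y with _ | ⟨j, β⟩
    · rw [next_kind_none] at hy
      simp only [nkLow] at hy
      split_ifs at hy with he
      exact Or.inl ⟨rfl, he⟩
    · rcases hk : s.kind (s.cl j) with _ | e | e | u
      · exact Or.inr (Or.inl ⟨j, β, rfl, hk⟩)
      · rw [next_kind_not _ _ _ _ _ _ (by simp [hk])] at hy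
        simp only [nkLow, hk] at hy
        split_ifs at hy
      · by_cases hx : s.cl j = s.cl j₀
        · rw [next_kind_not _ _ _ _ _ _ (by simp [hx, hj₀])] at hy
          simp only [nkLow, hk] at hy
          simp only [hx, true_and] at hy
          split_ifs at hy with he
          rw [not_not] at he
          have h2 := hs.pairOK_diffPts (h • η) (h' • η) hx.symm true β
          rw [← hx, hk] at h2
          simp only [PairOK, he] at h2
          exact Or.inr (Or.inr ⟨_, fun n => DegLT.eq_of_one h2 n 0⟩)
        · rw [next_kind_keep _ _ _ _ _ _ (by simp [hk, hx]), hk] at hy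
          cases hy
      · rw [next_kind_keep _ _ _ _ _ _ (by simp [hk]), hk] at hy
        cases hy

/-- The kinds of the points after a step of the second type. -/
def PolyShape.nkPar (s : PolyShape V) : Option (s.ι × Bool) → PointKind V
  | none => .none
  | some (j, β) => match s.kind (s.cl j) with
    | .par e => if β = true ∨ e + 1 = s.e then .low (s.e - 1) else .par e
    | _ => .none

theorem PolyShape.stepOK_par (he : s.e ≠ 1) (hlow : ∀ j e, s.kind (s.cl j) ≠ .low e) :
    s.StepOK X L (fun x => ∃ u, s.kind x = .top u) s.nkPar (s.e - 1) s.u none where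
  merged h := absurd h he
  lead η c₀ cD D₀ Dj g hs h h' := by
    have := hs.pos
    refine ⟨by omega, ?_⟩
    simp only [nextCoef, he, if_false]
    exact hs.hasLead_diff (by omega) h h'
  pt η c₀ cD D₀ Dj g hs h h' y := by
    have hpos := hs.pos
    rcases y with _ | ⟨j, β⟩
    · rw [next_kind_none]
      trivial
    · have hp := hs.pt j
      rcases hk : s.kind (s.cl j) with _ | e | e | u
      · rw [next_kind_not _ _ _ _ _ _ (by simp [hk])]
        simp only [nkPar, hk]
        trivial
      · rw [next_kind_not _ _ _ _ _ _ (by simp [hk])]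
        rw [hk] at hp
        have h1 := hp.2.1
        simp only [nkPar, hk]
        have key : ∀ (c : ℤ) q, HasLead η (s.e - 1) (c • s.u) q → PointOK η s.D (s.e - 1) s.u
            (diffPts D₀ Dj (h • η) (h' • η) none) (.low (s.e - 1)) c q := by
          intro c q hq
          have h2 := (hs.degLT_diff (h • η) (h' • η))
          refine ⟨by omega, hq, ?_⟩
          have h3 : s.e = s.e - 1 + 1 := by omega
          rw [h3] at h2
          exact h2.sub hq.1
        cases β
        · by_cases h2 : e + 1 = s.e
          · rw [if_pos (Or.inr h2)]
            have h3 : s.e - 1 = e := by omega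
            refine key _ _ ?_
            rw [h3]
            exact hp.2.2.shift _
          · rw [if_neg (by simpa using h2)]
            exact ⟨hp.1, by omega, hp.2.2.shift _⟩
        · simp only [true_or, if_true]
          exact key _ _ (hs.hasLead_par hk h h')
      · exact absurd hk (hlow j e)
      · rw [nextCoef_of_ne_par (by simp [hk])]
        rw [next_kind_keep _ _ _ _ _ _ (by simp [hk]), hk]
        rw [hk] at hp
        exact ⟨by have := hp.1; omega, hs.hasLead_diffPts hp.1 hp.2 _ _ β⟩
  const_of η c₀ cD D₀ Dj g hs h h' y hy := by
    rcases y with _ | ⟨j, β⟩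
    · exact Or.inr (Or.inr ⟨0, fun n => sub_self _⟩)
    · rcases hk : s.kind (s.cl j) with _ | e | e | u
      · exact Or.inr (Or.inl ⟨j, β, rfl, hk⟩)
      · rw [next_kind_not _ _ _ _ _ _ (by simp [hk])] at hy
        simp only [nkPar, hk] at hy
        split_ifs at hy
      · exact absurd hk (hlow j e)
      · rw [next_kind_keep _ _ _ _ _ _ (by simp [hk]), hk] at hy
        cases hy

/-- The kinds of the points after a step of the third type. -/
def PolyShape.nkTop (s : PolyShape V) : Option (s.ι × Bool) → PointKind V
  | none => .none
  | some (j, _) => match s.kind (s.cl j) with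
    | .top _ => if s.D = 1 then .none else .low (s.D - 1)
    | _ => .none

theorem PolyShape.stepOK_top (he : s.e = 1) (hlow : ∀ j e, s.kind (s.cl j) ≠ .low e) {j₀ : s.ι} {u : V}
    (hj₀ : s.kind (s.cl j₀) = .top u) :
    s.StepOK X L (fun x => x ≠ s.cl j₀ ∧ ∃ u, s.kind x = .top u) s.nkTop s.D u (some (j₀, true)) where
  merged _ := rfl
  lead η c₀ cD D₀ Dj g hs h h' := by
    have := hs.pt j₀
    rw [hj₀] at this
    refine ⟨hs.pos.trans this.1, ?_⟩
    rw [nextCoef_of_ne_par (by simp [hj₀])]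
    exact hs.hasLead_diffPts this.1 this.2 _ _ true
  pt η c₀ cD D₀ Dj g hs h h' y := by
    rcases y with _ | ⟨j, β⟩
    · rw [next_kind_none]
      trivial
    · have hp := hs.pt j
      rcases hk : s.kind (s.cl j) with _ | e | e | u'
      · rw [next_kind_not _ _ _ _ _ _ (by simp [hk])]
        simp only [nkTop, hk]
        trivial
      · rw [hk] at hp
        have h1 := hp.1
        have h2 := hp.2.1
        omega
      · exact absurd hk (hlow j e)
      · rw [nextCoef_of_ne_par (by simp [hk])]
        rw [hk] at hp
        by_cases hx : s.cl j = s.cl j₀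
        · rw [next_kind_not _ _ _ _ _ _ (by simp [hx])]
          obtain rfl : u' = u := by
            rw [hx, hj₀] at hk
            simpa using hk.symm
          simp only [nkTop, hk]
          split_ifs with hD
          · trivial
          · have h1 := hp.1
            refine ⟨by omega, hs.hasLead_diffPts hp.1 hp.2 _ _ β, ?_⟩
            have h2 := hs.pairOK_diffPts (h • η) (h' • η) hx.symm true β
            rw [← hx, hk] at h2
            rwa [Nat.sub_add_cancel (by omega)]
        · rw [next_kind_keep _ _ _ _ _ _ (by simp [hk, hx]), hk]
          exact ⟨le_rfl, hs.hasLead_diffPts hp.1 hp.2 _ _ β⟩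
  const_of η c₀ cD D₀ Dj g hs h h' y hy := by
    rcases y with _ | ⟨j, β⟩
    · exact Or.inl ⟨rfl, he⟩
    · have hp := hs.pt j
      rcases hk : s.kind (s.cl j) with _ | e | e | u'
      · exact Or.inr (Or.inl ⟨j, β, rfl, hk⟩)
      · rw [hk] at hp
        have h1 := hp.1
        have h2 := hp.2.1
        omega
      · exact absurd hk (hlow j e)
      · by_cases hx : s.cl j = s.cl j₀
        · rw [next_kind_not _ _ _ _ _ _ (by simp [hx])] at hy
          simp only [nkTop, hk] at hy
          split_ifs at hy with hD
          have h2 := hs.pairOK_diffPts (h • η) (h' • η) hx.symm true β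
          rw [← hx, hk] at h2
          simp only [PairOK, hD] at h2
          exact Or.inr (Or.inr ⟨_, fun n => DegLT.eq_of_one h2 n 0⟩)
        · rw [next_kind_keep _ _ _ _ _ _ (by simp [hk, hx]), hk] at hy
          cases hy

theorem PolyShape.next_top {keep : s.κ → Prop} {nk : Option (s.ι × Bool) → PointKind V} {e : ℕ} {u : V}
    (hnk : ∀ y v, nk y ≠ .top v) {P : V → Prop} (hP : ∀ x v, s.kind x = .top v → P v) :
    ∀ x v, (s.next keep nk e u).kind x = .top v → P v := by
  classical
  rintro (x | y) v hx
  · simp only [next, Sum.elim_inl] at hx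
    split_ifs at hx
    exact hP x v hx
  · exact absurd hx (hnk y v)

variable [IsProbabilityMeasure μ]

/-- Multiple averages of a given shape are controlled by box averages along directions that
already occur in the shape. -/
theorem PolyShape.exists_ctrl (hT : IsMPAction μ T) (P : V → Prop) (s : PolyShape V) (hu : P s.u)
    (hP : ∀ x v, s.kind x = .top v → P v) : ∃ us : List V, (∀ u ∈ us, P u) ∧ s.Ctrl μ T L us := by
  classical
  induction hm : s.complexity using
    (Multiset.wellFounded_isDershowitzMannaLT (α := ℕ)).induction generalizing s with
  | _ m ih =>
  subst hm
  rcases Nat.eq_zero_or_pos s.e with he0 | hpos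
  · exact ⟨[], by simp, fun η c₀ cD _ _ ε _ => ⟨1, one_pos, fun D₀ Dj g hs => by
      have := hs.pos
      omega⟩⟩
  have concl : ∀ {keep nk e u y₀}, s.StepOK X L keep nk e u y₀ → P u → (∀ y v, nk y ≠ .top v) →
      Multiset.IsDershowitzMannaLT (s.next keep nk e u).complexity s.complexity →
      ∃ us : List V, (∀ u ∈ us, P u) ∧ s.Ctrl μ T L us := by
    intro keep nk e u y₀ hst hPu hnk hlt
    obtain ⟨us, h1, h2⟩ := ih _ hlt (s.next keep nk e u) hPu (next_top hnk hP) rfl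
    by_cases he : s.e = 1
    · exact ⟨s.u :: us, by simpa using ⟨hu, h1⟩, hst.ctrl_one hT he h2⟩
    · exact ⟨us, h1, hst.ctrl hT he h2⟩
  by_cases hlow : ∃ e j, s.kind (s.cl j) = .low e
  · obtain ⟨j₀, hj₀⟩ := Nat.find_spec hlow
    set e₁ := Nat.find hlow
    by_cases he1 : e₁ = 0
    · refine ⟨[], by simp, fun η c₀ cD _ _ ε _ => ⟨1, one_pos, fun D₀ Dj g hs => ?_⟩⟩
      have := hs.pt j₀
      rw [hj₀] at this
      have := this.1
      omega
    have hnk : ∀ y, (s.nkLow (s.cl j₀) y).weight s.D < e₁ := by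
      intro y
      rcases y with _ | ⟨j, β⟩
      · simp only [nkLow]
        split_ifs <;> simp only [PointKind.weight] <;> omega
      · simp only [nkLow]
        split
        · split_ifs <;> simp only [PointKind.weight] <;> omega
        · rename_i e he
          split_ifs with h
          · rw [h.1, hj₀] at he
            simp only [PointKind.low.injEq] at he
            have := h.2
            simp only [PointKind.weight]
            omega
          · simp only [PointKind.weight]; omega
        · simp only [PointKind.weight]; omega
    refine concl (stepOK_low hj₀ fun j e h => Nat.find_min' hlow ⟨j, h⟩) hu ?_ ?_
    · intro y v
      rcases y with _ | ⟨j, β⟩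
      · simp only [nkLow]; split_ifs <;> simp
      · simp only [nkLow]; split <;> (try split_ifs) <;> simp
    · refine s.complexity_next_lt' _ _ _ (s.cl j₀) (by simp [hj₀]) ?_ ?_ <;>
        simp only [hj₀, PointKind.weight]
      · omega
      · exact hnk
  push Not at hlow
  have hlow' : ∀ j e, s.kind (s.cl j) ≠ .low e := fun j e => hlow e j
  by_cases he : s.e = 1
  · by_cases htop : ∃ j u, s.kind (s.cl j) = .top u
    · obtain ⟨j₀, u, hj₀⟩ := htop
      refine concl (stepOK_top he hlow' hj₀) (hP _ _ hj₀) ?_ ?_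
      · intro y v
        rcases y with _ | ⟨j, β⟩
        · simp [nkTop]
        · simp only [nkTop]; split <;> (try split_ifs) <;> simp
      · refine s.complexity_next_lt _ _ _ _ (s.D + 1) (Or.inr ⟨s.cl j₀, by simp, by simp [hj₀, PointKind.weight]⟩)
          (Nat.lt_succ_self _) ?_
        intro y
        rcases y with _ | ⟨j, β⟩
        · simp [nkTop, PointKind.weight]
        · simp only [nkTop]; split <;> (try split_ifs) <;> simp only [PointKind.weight] <;> omega
    · push Not at htop
      by_cases hpar : ∃ j e, s.kind (s.cl j) = .par e
      · obtain ⟨j, e, hj⟩ := hpar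
        refine ⟨[], by simp, fun η c₀ cD _ _ ε _ => ⟨1, one_pos, fun D₀ Dj g hs => ?_⟩⟩
        have := hs.pt j
        rw [hj] at this
        have h1 := this.1
        have h2 := this.2.1
        omega
      · push Not at hpar
        refine ⟨[s.u], by simpa using hu, ctrl_terminal hT he fun j => ?_⟩
        rcases hk : s.kind (s.cl j) with _ | e | e | u
        · rfl
        · exact absurd hk (hpar j e)
        · exact absurd hk (hlow' j e)
        · exact absurd hk (htop j u)
  · refine concl (stepOK_par he hlow') hu ?_ ?_
    · intro y v
      rcases y with _ | ⟨j, β⟩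
      · simp [nkPar]
      · simp only [nkPar]; split <;> (try split_ifs) <;> simp
    · refine s.complexity_next_lt _ _ _ _ s.e (Or.inl rfl) (by omega) ?_
      intro y
      rcases y with _ | ⟨j, β⟩
      · simp [nkPar, PointKind.weight]; omega
      · simp only [nkPar]; split <;> (try split_ifs) <;> simp only [PointKind.weight] <;> omega

end PETInduction

section AverageLemmas

theorem avg_comm {ι κ : Type*} (S : Finset ι) (S' : Finset κ) (a : ι → κ → ℂ) :
    avg S (fun i => avg S' (a i)) = avg S' fun j => avg S fun i => a i j := by
  simp only [avg, Finset.mul_sum]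
  rw [Finset.sum_comm]
  refine Finset.sum_congr rfl fun _ _ => Finset.sum_congr rfl fun _ _ => by ring

theorem avg_congr {ι : Type*} {S : Finset ι} {a b : ι → ℂ} (h : ∀ i ∈ S, a i = b i) :
    avg S a = avg S b := by
  rw [avg, avg, Finset.sum_congr rfl h]

theorem avg_re {ι : Type*} (S : Finset ι) (a : ι → ℂ) :
    (avg S a).re = (S.card : ℝ)⁻¹ * ∑ i ∈ S, (a i).re := by
  have : ((S.card : ℂ))⁻¹ = (((S.card : ℝ)⁻¹ : ℝ) : ℂ) := by push_cast; rfl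
  rw [avg, this, Complex.re_ofReal_mul, Complex.re_sum]

theorem avg_product {ι κ : Type*} (S : Finset ι) (S' : Finset κ) (a : ι × κ → ℂ) :
    avg (S ×ˢ S') a = avg S fun i => avg S' fun j => a (i, j) := by
  simp only [avg, Finset.sum_product, Finset.card_product, Finset.mul_sum]
  push_cast
  refine Finset.sum_congr rfl fun _ _ => Finset.sum_congr rfl fun _ _ => by rw [mul_inv]; ring

theorem norm_avg_pow_le {ι : Type*} (S : Finset ι) (a : ι → ℂ) {k : ℕ} (hk : k ≠ 0) :
    ‖avg S a‖ ^ k ≤ (S.card : ℝ)⁻¹ * ∑ n ∈ S, ‖a n‖ ^ k := by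
  rcases S.eq_empty_or_nonempty with rfl | hS
  · simp [avg, hk]
  have hc : (S.card : ℝ) ≠ 0 := by exact_mod_cast hS.card_pos.ne'
  have h := Real.pow_arith_mean_le_arith_mean_pow S (fun _ => (S.card : ℝ)⁻¹) (fun i => ‖a i‖)
    (fun _ _ => by positivity) (by simp [hc]) (fun _ _ => norm_nonneg _) k
  rw [← Finset.mul_sum, ← Finset.mul_sum] at h
  refine le_trans (pow_le_pow_left₀ (norm_nonneg _) ?_ k) h
  rw [avg, norm_mul, norm_inv, Complex.norm_natCast]
  gcongr
  exact norm_sum_le _ _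

theorem integral_avg {X ι : Type*} [MeasurableSpace X] {μ : Measure X} (S : Finset ι) {a : ι → X → ℂ}
    (h : ∀ i, Integrable (a i) μ) :
    ∫ x, avg S (fun i => a i x) ∂μ = avg S fun i => ∫ x, a i x ∂μ := by
  simp only [avg]
  rw [integral_const_mul, integral_finsetSum _ fun i _ => h i]

end AverageLemmas

section Boxes

/-- The box `∏ [0, R_i)` as a set of lists. -/
def boxF : List ℕ → Finset (List ℕ)
  | [] => {[]}
  | R :: Rs => (range R ×ˢ boxF Rs).image fun p => p.1 :: p.2

theorem length_of_mem_boxF {Rs l : List ℕ} (h : l ∈ boxF Rs) : l.length = Rs.length := by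
  induction Rs generalizing l with
  | nil => rw [boxF, Finset.mem_singleton] at h; rw [h]
  | cons R Rs ih =>
    rw [boxF, Finset.mem_image] at h
    obtain ⟨p, hp, rfl⟩ := h
    simp [ih (Finset.mem_product.1 hp).2]

theorem sum_boxF_cons {E : Type*} [AddCommMonoid E] (R : ℕ) (Rs : List ℕ) (a : List ℕ → E) :
    ∑ l ∈ boxF (R :: Rs), a l = ∑ h ∈ range R, ∑ l ∈ boxF Rs, a (h :: l) := by
  rw [boxF, Finset.sum_image, Finset.sum_product]
  rintro ⟨a, b⟩ _ ⟨c, d⟩ _ h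
  simpa using h

theorem card_boxF_cons (R : ℕ) (Rs : List ℕ) : (boxF (R :: Rs)).card = R * (boxF Rs).card := by
  have := sum_boxF_cons R Rs fun _ => 1
  simpa using this

theorem avg_boxF_cons (R : ℕ) (Rs : List ℕ) (a : List ℕ → ℂ) :
    avg (boxF (R :: Rs)) a = avg (range R) fun h => avg (boxF Rs) fun l => a (h :: l) := by
  simp only [avg, sum_boxF_cons, card_boxF_cons, card_range, Finset.mul_sum]
  push_cast
  refine Finset.sum_congr rfl fun _ _ => Finset.sum_congr rfl fun _ _ => by rw [mul_inv]; ring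

end Boxes

section CubeOperator

variable {A : Type*} [CommMonoid A] [StarMul A]

/-- The product of `Φ` (with alternating conjugations) over the vertices of the cube with opposite
vertices `l`, `l'`. -/
def cubeProd : (List ℕ → A) → List ℕ → List ℕ → A
  | Φ, [], _ => Φ []
  | Φ, h :: l, [] => Φ (h :: l)
  | Φ, h :: l, h' :: l' => cubeProd (fun t => Φ (h :: t) * star (Φ (h' :: t))) l l'

theorem cubeProd_map {B : Type*} [CommMonoid B] [StarMul B] (φ : A → B)
    (hm : ∀ a b, φ (a * b) = φ a * φ b) (hs : ∀ a, φ (star a) = star (φ a)) (Φ : List ℕ → A)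
    (l l' : List ℕ) : cubeProd (fun t => φ (Φ t)) l l' = φ (cubeProd Φ l l') := by
  induction l generalizing l' Φ with
  | nil => rfl
  | cons h l ih =>
    cases l' with
    | nil => rfl
    | cons h' l' => simp only [cubeProd, ← ih, hm, hs]

theorem cubeProd_mul (Φ Ψ : List ℕ → A) (l l' : List ℕ) :
    cubeProd (fun t => Φ t * Ψ t) l l' = cubeProd Φ l l' * cubeProd Ψ l l' := by
  induction l generalizing l' Φ Ψ with
  | nil => rfl
  | cons h l ih =>
    cases l' with
    | nil => rfl
    | cons h' l' =>
      simp only [cubeProd, ← ih]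
      congr 1
      funext t
      rw [star_mul']
      exact mul_mul_mul_comm _ _ _ _

theorem cubeProd_star (Φ : List ℕ → A) (l l' : List ℕ) :
    cubeProd (fun t => star (Φ t)) l l' = star (cubeProd Φ l l') :=
  cubeProd_map star (fun a b => star_mul' a b) (fun _ => rfl) Φ l l'

/-- A predicate closed under products and conjugation. -/
structure StarClosed (p : A → Prop) : Prop where
  one : p 1
  mul : ∀ {a b}, p a → p b → p (a * b)
  star : ∀ {a}, p a → p (star a)

theorem cubeProd_mem {p : A → Prop} (hp : StarClosed p) {Φ : List ℕ → A} (hΦ : ∀ t, p (Φ t))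
    (l l' : List ℕ) : p (cubeProd Φ l l') := by
  induction l generalizing l' Φ with
  | nil => exact hΦ _
  | cons h l ih =>
    cases l' with
    | nil => exact hΦ _
    | cons h' l' => exact ih (fun t => hp.mul (hΦ _) (hp.star (hΦ _))) l'

/-- Products of functions each of which does not depend on all coordinates. -/
def IsLow (p : A → Prop) : ℕ → (List ℕ → A) → Prop
  | 0, b => b [] = 1
  | r + 1, b => ∃ (b₁ : List ℕ → A) (b₂ : ℕ → List ℕ → A), (∀ l, p (b₁ l)) ∧ (∀ h l, p (b₂ h l)) ∧
      (∀ h, IsLow p r (b₂ h)) ∧ ∀ h l, b (h :: l) = b₁ l * b₂ h l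

theorem IsLow.mul {p : A → Prop} (hp : StarClosed p) {r : ℕ} {b c : List ℕ → A} (hb : IsLow p r b)
    (hc : IsLow p r c) : IsLow p r (fun l => b l * c l) := by
  induction r generalizing b c with
  | zero =>
    simp only [IsLow] at *
    rw [hb, hc, mul_one]
  | succ r ih =>
    obtain ⟨b₁, b₂, h1, h2, h3, h4⟩ := hb
    obtain ⟨c₁, c₂, k1, k2, k3, k4⟩ := hc
    refine ⟨fun l => b₁ l * c₁ l, fun h l => b₂ h l * c₂ h l, fun l => hp.mul (h1 l) (k1 l),
      fun h l => hp.mul (h2 h l) (k2 h l), fun h => ih (h3 h) (k3 h), fun h l => ?_⟩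
    simp only [h4, k4]
    exact mul_mul_mul_comm _ _ _ _

theorem IsLow.map {B : Type*} [CommMonoid B] [StarMul B] {p : A → Prop} {q : B → Prop} (φ : A → B)
    (h1 : φ 1 = 1) (hm : ∀ a b, φ (a * b) = φ a * φ b) (hpq : ∀ a, p a → q (φ a)) {r : ℕ}
    {b : List ℕ → A} (hb : IsLow p r b) : IsLow q r (fun l => φ (b l)) := by
  induction r generalizing b with
  | zero =>
    simp only [IsLow] at *
    rw [hb, h1]
  | succ r ih =>
    obtain ⟨b₁, b₂, k1, k2, k3, k4⟩ := hb
    exact ⟨fun l => φ (b₁ l), fun h l => φ (b₂ h l), fun l => hpq _ (k1 l), fun h l => hpq _ (k2 h l),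
      fun h => ih (k3 h), fun h l => by simp only [k4, hm]⟩

theorem IsLow.star {p : A → Prop} (hp : StarClosed p) {r : ℕ} {b : List ℕ → A} (hb : IsLow p r b) :
    IsLow p r (fun l => star (b l)) :=
  hb.map Star.star (star_one A) (fun a b => star_mul' a b) fun _ => hp.star

theorem exists_isLow {p : A → Prop} (hp : StarClosed p) {Φ : List ℕ → A} (hΦ : ∀ t, p (Φ t))
    (l' : List ℕ) : ∃ b : List ℕ → A, IsLow p l'.length b ∧ (∀ l, p (b l)) ∧
      ∀ l, l.length = l'.length → cubeProd Φ l l' = Φ l * b l := by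
  induction l' generalizing Φ with
  | nil =>
    refine ⟨fun _ => 1, rfl, fun _ => hp.one, fun l hl => ?_⟩
    rw [List.length_eq_zero_iff.1 hl, cubeProd, mul_one]
  | cons h' l' ih =>
    choose b h1 h2 h3 using fun h : ℕ => ih (Φ := fun t => Φ (h :: t)) fun t => hΦ _
    refine ⟨fun l => match l with
      | [] => 1
      | h :: l => Star.star (cubeProd (fun t => Φ (h' :: t)) l l') * b h l,
      ⟨fun l => Star.star (cubeProd (fun t => Φ (h' :: t)) l l'), b,
        fun l => hp.star (cubeProd_mem hp (fun t => hΦ _) _ _), h2, h1, fun h l => rfl⟩, ?_, ?_⟩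
    · rintro (_ | ⟨h, l⟩)
      · exact hp.one
      · exact hp.mul (hp.star (cubeProd_mem hp (fun t => hΦ _) _ _)) (h2 h l)
    · rintro (_ | ⟨h, l⟩) hl
      · simp at hl
      · rw [cubeProd, cubeProd_mul, cubeProd_star, h3 h l (by simpa using hl), mul_assoc]
        congr 1
        exact mul_comm _ _

end CubeOperator

section GowersCauchySchwarz

variable {X : Type*} [MeasurableSpace X]

theorem starClosed_B1 : StarClosed (B1 : (X → ℂ) → Prop) where
  one := B1.one
  mul h h' := h.mul h'
  star h := h.conj

theorem starClosed_B1' {ι : Type*} : StarClosed (fun a : ι → X → ℂ => ∀ n, B1 (a n)) where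
  one _ := B1.one
  mul h h' n := (h n).mul (h' n)
  star h n := (h n).conj

variable {μ : Measure X} [IsProbabilityMeasure μ]

theorem gowersCauchySchwarz {ι : Type*} (S : Finset ι) (Rs : List ℕ) {Φ b : List ℕ → ι → X → ℂ}
    (hΦ : ∀ l n, B1 (Φ l n)) (hb : ∀ l n, B1 (b l n))
    (hlow : IsLow (fun a : ι → X → ℂ => ∀ n, B1 (a n)) Rs.length b) :
    ‖avg (boxF Rs) fun l => avg S fun n => ∫ x, Φ l n x * b l n x ∂μ‖ ^ 2 ^ Rs.length ≤
      ((boxF Rs).card : ℝ)⁻¹ * ((boxF Rs).card : ℝ)⁻¹ * ∑ l ∈ boxF Rs, ∑ l' ∈ boxF Rs,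
        ‖avg S fun n => ∫ x, cubeProd Φ l l' n x ∂μ‖ := by
  induction Rs generalizing Φ b with
  | nil =>
    simp only [IsLow, List.length_nil] at hlow
    simp [boxF, avg, cubeProd, hlow]
  | cons R Rs ih =>
    obtain ⟨b₁, b₂, h1, h2, h3, h4⟩ := hlow
    have e1 : (avg (boxF (R :: Rs)) fun l => avg S fun n => ∫ x, Φ l n x * b l n x ∂μ) =
        avg (boxF Rs ×ˢ S) fun p => ∫ x, (avg (range R) fun h => Φ (h :: p.1) p.2 x * b₂ h p.1 p.2 x) *
          b₁ p.1 p.2 x ∂μ := by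
      rw [avg_boxF_cons, avg_comm, avg_product]
      refine avg_congr fun l _ => ?_
      rw [avg_comm]
      refine avg_congr fun n _ => ?_
      rw [← integral_avg _ fun h => ((hΦ _ _).mul (hb _ _)).integrable]
      refine integral_congr_ae (ae_of_all _ fun x => ?_)
      simp only [h4, ← avg_mul_right, Pi.mul_apply]
      refine avg_congr fun h _ => by ring
    set c : ℕ × ℕ → ℂ := fun q => avg (boxF Rs) fun l => avg S fun n =>
      ∫ x, (Φ (q.1 :: l) * star (Φ (q.2 :: l))) n x * (b₂ q.1 l * star (b₂ q.2 l)) n x ∂μ with hc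
    have e2 : ‖avg (boxF (R :: Rs)) fun l => avg S fun n => ∫ x, Φ l n x * b l n x ∂μ‖ ^ 2 ≤
        ‖avg (range R ×ˢ range R) c‖ := by
      rw [e1]
      refine (sq_norm_avg_le _ _).trans ?_
      refine le_trans (mul_le_mul_of_nonneg_left (Finset.sum_le_sum fun p _ =>
        norm_integral_sq_le_nsq (B1.avg _ fun h => (hΦ _ _).mul (h2 h p.1 p.2)) (h1 _ _))
        (by positivity)) ?_
      refine le_trans (le_of_eq ?_) (Complex.re_le_norm _)
      have e3 : avg (range R ×ˢ range R) c = avg (boxF Rs ×ˢ S) fun p =>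
          avg (range R ×ˢ range R) fun q => ∫ x, (Φ (q.1 :: p.1) * star (Φ (q.2 :: p.1))) p.2 x *
            (b₂ q.1 p.1 * star (b₂ q.2 p.1)) p.2 x ∂μ := by
        rw [avg_comm (boxF Rs ×ˢ S)]
        refine avg_congr fun q _ => ?_
        rw [avg_product]
      rw [e3, avg_re]
      congr 1
      refine Finset.sum_congr rfl fun p _ => ?_
      have e6 : ∀ q : ℕ × ℕ, Integrable (fun x => (Φ (q.1 :: p.1) * star (Φ (q.2 :: p.1))) p.2 x *
            (b₂ q.1 p.1 * star (b₂ q.2 p.1)) p.2 x) μ := fun q =>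
        (((hΦ _ _).mul (hΦ _ _).conj).mul ((h2 _ _ _).mul (h2 _ _ _).conj)).integrable
      rw [← integral_avg _ e6]
      have e4 : ∀ x, (avg (range R ×ˢ range R) fun q => (Φ (q.1 :: p.1) * star (Φ (q.2 :: p.1))) p.2 x *
            (b₂ q.1 p.1 * star (b₂ q.2 p.1)) p.2 x) =
          ((‖avg (range R) fun h => Φ (h :: p.1) p.2 x * b₂ h p.1 p.2 x‖ ^ 2 : ℝ) : ℂ) := by
        intro x
        rw [avg_product, Complex.ofReal_pow, ← Complex.mul_conj', ← avg_conj, ← avg_mul_right]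
        refine avg_congr fun h _ => ?_
        rw [← avg_mul_left]
        refine avg_congr fun h' _ => ?_
        simp only [Pi.mul_apply, Pi.star_apply, map_mul]
        simp only [starRingEnd_apply]
        ring
      simp only [e4]
      rw [integral_complex_ofReal, Complex.ofReal_re]
      rfl
    rw [List.length_cons, pow_succ', pow_mul]
    refine (pow_le_pow_left₀ (by positivity) e2 _).trans ((norm_avg_pow_le _ _ (by positivity)).trans ?_)
    have e5 : ∀ q, ‖c q‖ ^ 2 ^ Rs.length ≤ _ := fun q =>
      ih (Φ := fun l => Φ (q.1 :: l) * star (Φ (q.2 :: l))) (b := fun l => b₂ q.1 l * star (b₂ q.2 l))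
        (fun l n => (hΦ _ _).mul (hΦ _ _).conj) (fun l n => (h2 _ _ _).mul (h2 _ _ _).conj)
        ((h3 _).mul starClosed_B1' ((h3 _).star starClosed_B1'))
    refine (mul_le_mul_of_nonneg_left (Finset.sum_le_sum fun q _ => e5 q) (by positivity)).trans ?_
    apply le_of_eq
    simp only [sum_boxF_cons, card_boxF_cons, Finset.card_product, Finset.sum_product, card_range,
      ← Finset.mul_sum]
    push_cast
    rw [mul_inv, mul_inv]
    have e7 : ∀ h : ℕ, ∑ l ∈ boxF Rs, ∑ h' ∈ range R, ∑ l' ∈ boxF Rs,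
          ‖avg S fun n => ∫ x, cubeProd Φ (h :: l) (h' :: l') n x ∂μ‖ =
          ∑ h' ∈ range R, ∑ l ∈ boxF Rs, ∑ l' ∈ boxF Rs,
          ‖avg S fun n => ∫ x, cubeProd Φ (h :: l) (h' :: l') n x ∂μ‖ :=
        fun h => Finset.sum_comm
    simp only [e7]
    simp only [cubeProd]
    ring

end GowersCauchySchwarz

section BoxAverages

variable {X V : Type*} [MeasurableSpace X] [AddCommGroup V] {μ : Measure X} {T : V → X → X}

/-- The combination of the vectors of a list with given coefficients. -/
def dotL : List ℕ → List V → V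
  | h :: l, u :: us => (h : ℤ) • u + dotL l us
  | _, _ => 0

theorem boxAvg_append (hT : IsMPAction μ T) (us ws : List V) (Rs Ss : List ℕ)
    (hl : us.length = Rs.length) (f : X → ℂ) :
    boxAvg μ T (us ++ ws) (Rs ++ Ss) f = ((boxF Rs).card : ℝ)⁻¹ * ((boxF Rs).card : ℝ)⁻¹ *
      ∑ l ∈ boxF Rs, ∑ l' ∈ boxF Rs,
        boxAvg μ T ws Ss (cubeProd (fun t x => f (T (dotL t us) x)) l l') := by
  induction us generalizing Rs f with
  | nil =>
    obtain rfl : Rs = [] := List.length_eq_zero_iff.1 hl.symm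
    simp [boxF, cubeProd, dotL, hT.zero]
  | cons u us ih =>
    rcases Rs with _ | ⟨R, Rs⟩
    · simp at hl
    · simp only [List.cons_append, boxAvg]
      rw [sum_boxF_cons, card_boxF_cons]
      simp only [sum_boxF_cons]
      have h1 : ∀ h h' : ℕ, boxAvg μ T (us ++ ws) (Rs ++ Ss) (mderiv T ((h : ℤ) • u) ((h' : ℤ) • u) f) =
          ((boxF Rs).card : ℝ)⁻¹ * ((boxF Rs).card : ℝ)⁻¹ * ∑ l ∈ boxF Rs, ∑ l' ∈ boxF Rs,
            boxAvg μ T ws Ss (cubeProd (fun t x => f (T (dotL t (u :: us)) x)) (h :: l) (h' :: l')) := by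
        intro h h'
        rw [ih Rs (by simpa using hl)]
        congr 1
        refine Finset.sum_congr rfl fun l _ => Finset.sum_congr rfl fun l' _ => ?_
        congr 1
        rw [cubeProd]
        congr 1
        funext t x
        simp only [mderiv, dotL, hT.apply_add]
        rfl
      simp only [h1]
      simp only [← Finset.mul_sum]
      push_cast
      rw [mul_inv]
      have h2 : ∀ h : ℕ, ∑ l ∈ boxF Rs, ∑ h' ∈ range R, ∑ l' ∈ boxF Rs,
          boxAvg μ T ws Ss (cubeProd (fun t x => f (T (dotL t (u :: us)) x)) (h :: l) (h' :: l')) =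
          ∑ h' ∈ range R, ∑ l ∈ boxF Rs, ∑ l' ∈ boxF Rs,
          boxAvg μ T ws Ss (cubeProd (fun t x => f (T (dotL t (u :: us)) x)) (h :: l) (h' :: l')) :=
        fun h => Finset.sum_comm
      simp only [h2]
      ring

end BoxAverages

section SpectralTruncation

open scoped InnerProductSpace

variable {H : Type*} [NormedAddCommGroup H] [InnerProductSpace ℂ H]

theorem finrank_le_of_orthonormal_card_le {M : Submodule ℂ H} {n : ℕ}
    (h : ∀ (m : ℕ) (e : Fin m → H), Orthonormal ℂ e → (∀ i, e i ∈ M) → m ≤ n) :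
    FiniteDimensional ℂ M ∧ Module.finrank ℂ M ≤ n := by
  have key : ∀ s : Finset M, LinearIndependent ℂ ((↑) : s → M) → s.card ≤ n := by
    intro s hs
    set W : Submodule ℂ M := Submodule.span ℂ (s : Set M) with hW
    have : FiniteDimensional ℂ W := FiniteDimensional.span_finset ℂ s
    have hrank : Module.finrank ℂ W = s.card := by
      rw [hW]
      exact finrank_span_finset_eq_card hs
    let b := stdOrthonormalBasis ℂ W
    have := h (Module.finrank ℂ W) (fun i => ((b i : W) : M)) ?_ ?_
    · omega
    · have h1 := b.orthonormal
      have h2 := h1.comp_linearIsometry (W.subtypeₗᵢ)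
      exact h2.comp_linearIsometry (M.subtypeₗᵢ)
    · intro i
      exact ((b i : W) : M).2
  have hr : Module.rank ℂ M ≤ n := rank_le key
  have : FiniteDimensional ℂ M := Module.rank_lt_aleph0_iff.1 (hr.trans_lt (Cardinal.natCast_lt_aleph0))
  refine ⟨this, ?_⟩
  rw [← Module.finrank_eq_rank] at hr
  exact_mod_cast hr

theorem exists_spectral_truncation [CompleteSpace H] (K : H →L[ℂ] H) (hK : K.IsPositive)
    (hle : ∀ x, (⟪K x, x⟫_ℂ).re ≤ ‖x‖ ^ 2)
    (htr : ∀ (m : ℕ) (e : Fin m → H), Orthonormal ℂ e → ∑ i, (⟪K (e i), e i⟫_ℂ).re ≤ 1)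
    {a : ℝ} (ha : 0 < a) :
    ∃ A : H →L[ℂ] H, (∀ B : H →L[ℂ] H, Commute B K → Commute B A) ∧
      FiniteDimensional ℂ A.range ∧ (Module.finrank ℂ A.range : ℝ) ≤ a⁻¹ ∧
      ∀ y ∈ A.range, ∀ z ∈ A.rangeᗮ, (⟪K (y + z), y + z⟫_ℂ).re ≤ a * ‖y + z‖ ^ 2 + ‖y‖ ^ 2 := by
  have hsa : IsSelfAdjoint K := hK.isSelfAdjoint
  have hK0 : 0 ≤ K := (ContinuousLinearMap.nonneg_iff_isPositive K).2 hK
  set φ : ℝ → ℝ := fun t => max (t - a) 0 with hφ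
  have hφc : Continuous φ := by fun_prop
  set A : H →L[ℂ] H := cfc φ K with hA
  have hA0 : 0 ≤ A := cfc_nonneg (fun t _ => le_max_right _ _)
  have hAp := (ContinuousLinearMap.nonneg_iff_isPositive A).1 hA0
  have hAsa : IsSelfAdjoint A := hAp.isSelfAdjoint
  have hmulK : K * A = a • A + A * A := by
    have h1 : K = cfc (fun t : ℝ => t) K := (cfc_id' ℝ K).symm
    calc K * A = cfc (fun t : ℝ => t) K * cfc φ K := by rw [← h1]
      _ = cfc (fun t => t * φ t) K := (cfc_mul _ _ K (by fun_prop) hφc.continuousOn).symm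
      _ = cfc (fun t => a * φ t + φ t * φ t) K := by
          congr 1
          funext t
          simp only [hφ]
          rcases le_total (t - a) 0 with h | h
          · rw [max_eq_right h]; ring
          · rw [max_eq_left h]; ring
      _ = a • A + A * A := by
          rw [cfc_add K (fun t => a * φ t) (fun t => φ t * φ t) (by fun_prop) (by fun_prop),
            cfc_mul φ φ K (by fun_prop) (by fun_prop), cfc_const_mul a φ K (by fun_prop)]
  have hAK : A ≤ K := by
    have h1 : K = cfc (fun t : ℝ => t) K := (cfc_id' ℝ K).symm
    calc A ≤ cfc (fun t : ℝ => t) K := by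
          refine cfc_mono (fun t ht => ?_) (by fun_prop) (by fun_prop)
          have : 0 ≤ t := spectrum_nonneg_of_nonneg hK0 ht
          simp only [hφ]
          exact max_le (by linarith) this
      _ = K := h1.symm
  have hKA : K ≤ a • 1 + A := by
    have h1 : K = cfc (fun t : ℝ => t) K := (cfc_id' ℝ K).symm
    have h2 : a • (1 : H →L[ℂ] H) + A = cfc (fun t => a + φ t) K := by
      rw [cfc_const_add a φ K (by fun_prop), Algebra.algebraMap_eq_smul_one]
    rw [h2]
    calc K = cfc (fun t : ℝ => t) K := h1
      _ ≤ _ := by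
        refine cfc_mono (fun t ht => ?_) (by fun_prop) (by fun_prop)
        simp only [hφ]
        have := le_max_left (t - a) 0
        linarith
  have hre : ∀ {B C : H →L[ℂ] H}, B ≤ C → ∀ x, (⟪B x, x⟫_ℂ).re ≤ (⟪C x, x⟫_ℂ).re := by
    intro B C h x
    have h1 := ((ContinuousLinearMap.le_def B C).1 h).re_inner_nonneg_left x
    simp only [sub_apply, inner_sub_left] at h1
    simpa using h1
  have hrange : ∀ y ∈ A.range, a * ‖y‖ ^ 2 ≤ (⟪K y, y⟫_ℂ).re := by
    rintro _ ⟨z, rfl⟩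
    have h1 : K (A z) = (a : ℂ) • A z + A (A z) := by
      have := congrArg (fun B : H →L[ℂ] H => B z) hmulK
      simpa using this
    have h2 := hAp.re_inner_nonneg_left (A z)
    change _ ≤ (⟪K (A z), A z⟫_ℂ).re
    rw [h1, inner_add_left, inner_smul_left]
    have h3 : ⟪A z, A z⟫_ℂ = ((‖A z‖ ^ 2 : ℝ) : ℂ) := by
      rw [inner_self_eq_norm_sq_to_K]; norm_cast
    rw [h3]
    simp only [Complex.conj_ofReal, ← Complex.ofReal_mul, Complex.add_re, Complex.ofReal_re]
    have h2' : 0 ≤ (⟪A (A z), A z⟫_ℂ).re := h2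
    change a * ‖A z‖ ^ 2 ≤ _
    linarith
  have hcard : ∀ (m : ℕ) (e : Fin m → H), Orthonormal ℂ e → (∀ i, e i ∈ A.range) →
      (m : ℝ) ≤ a⁻¹ := by
    intro m e he hm
    have h1 : ∑ i : Fin m, a ≤ 1 := by
      refine le_trans (Finset.sum_le_sum fun i _ => ?_) (htr m e he)
      have := hrange (e i) (hm i)
      rw [he.1 i] at this
      simpa using this
    rw [Finset.sum_const, Finset.card_univ, Fintype.card_fin, nsmul_eq_mul] at h1
    rw [← one_div, le_div_iff₀ ha]
    exact h1
  obtain ⟨hfd, hfr⟩ := finrank_le_of_orthonormal_card_le (M := A.range) (n := ⌊a⁻¹⌋₊)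
    (fun m e he hm => Nat.le_floor (hcard m e he hm))
  refine ⟨A, fun B hB => ?_, hfd, ?_, ?_⟩
  · exact (hB.symm.cfc_real φ).symm
  · exact (Nat.cast_le.2 hfr).trans (Nat.floor_le (by positivity))
  · intro y hy z hz
    have hAz : A z = 0 := by
      rw [← inner_self_eq_zero (𝕜 := ℂ)]
      have h1 : ⟪A (A z), z⟫_ℂ = ⟪A z, A z⟫_ℂ := hAp.inner_left_eq_inner_right (A z) z
      rw [← h1]
      exact hz _ ⟨A z, rfl⟩
    have h2 := hre hKA (y + z)
    have h3 := hre hAK y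
    have h4 := hle y
    have h5 : ⟪A y, z⟫_ℂ = 0 := hz _ ⟨y, rfl⟩
    have h6 : (⟪(a • (1 : H →L[ℂ] H) + A) (y + z), y + z⟫_ℂ).re
        = a * ‖y + z‖ ^ 2 + (⟪A y, y⟫_ℂ).re := by
      have e1 : (a • (1 : H →L[ℂ] H) + A) (y + z) = (a : ℂ) • (y + z) + A y := by
        simp [hAz]
      rw [e1, inner_add_left, inner_smul_left, inner_add_right (A y), h5, add_zero]
      have h3 : ⟪y + z, y + z⟫_ℂ = ((‖y + z‖ ^ 2 : ℝ) : ℂ) := by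
        rw [inner_self_eq_norm_sq_to_K]; norm_cast
      rw [h3]
      simp only [Complex.conj_ofReal, ← Complex.ofReal_mul, Complex.add_re, Complex.ofReal_re]
    linarith

end SpectralTruncation

section UltrafilterLimit

/-- The limit of a complex sequence along an ultrafilter. -/
def ulim (𝒱 : Ultrafilter ℕ) (a : ℕ → ℂ) : ℂ := limUnder (𝒱 : Filter ℕ) a

theorem tendsto_ulim {𝒱 : Ultrafilter ℕ} {a : ℕ → ℂ} {C : ℝ} (h : ∀ n, ‖a n‖ ≤ C) :
    Tendsto a 𝒱 (nhds (ulim 𝒱 a)) := by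
  have hc : IsCompact (Metric.closedBall (0 : ℂ) C) := isCompact_closedBall 0 C
  obtain ⟨z, -, hz⟩ := hc.ultrafilter_le_nhds (𝒱.map a) (by
    rw [le_principal_iff]
    refine Filter.mem_map.2 (Filter.univ_mem' fun n => ?_)
    simpa using h n)
  exact tendsto_nhds_limUnder ⟨z, hz⟩

theorem ulim_eq {𝒱 : Ultrafilter ℕ} {a : ℕ → ℂ} {z : ℂ} (h : Tendsto a 𝒱 (nhds z)) :
    ulim 𝒱 a = z := h.limUnder_eq

end UltrafilterLimit

section CompactPart

open scoped InnerProductSpace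

variable {H : Type*} [NormedAddCommGroup H] [InnerProductSpace ℂ H]

/-- An ultralimit of averages of rank-one operators. -/
theorem exists_ulim_rankOne [CompleteSpace H] {ι : Type*} (S : ℕ → Finset ι) (w : ι → H)
    (hw : ∀ p, ‖w p‖ ≤ 1) (𝒱 : Ultrafilter ℕ) :
    ∃ K : H →L[ℂ] H, ∀ v z,
      Tendsto (fun R => avg (S R) fun p => ⟪v, w p⟫_ℂ * ⟪w p, z⟫_ℂ) 𝒱 (nhds ⟪K v, z⟫_ℂ) := by
  set a : H → H → ℕ → ℂ := fun v z R => avg (S R) fun p => ⟪v, w p⟫_ℂ * ⟪w p, z⟫_ℂ with ha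
  have hbd : ∀ v z R, ‖a v z R‖ ≤ ‖v‖ * ‖z‖ := by
    intro v z R
    refine norm_avg_le _ (mul_nonneg (norm_nonneg _) (norm_nonneg _)) fun p _ => ?_
    rw [norm_mul]
    refine mul_le_mul ?_ ?_ (norm_nonneg _) (norm_nonneg _)
    · exact (norm_inner_le_norm _ _).trans (mul_le_of_le_one_right (norm_nonneg _) (hw p))
    · exact (norm_inner_le_norm _ _).trans (mul_le_of_le_one_left (norm_nonneg _) (hw p))
  have ht : ∀ v z, Tendsto (a v z) 𝒱 (nhds (ulim 𝒱 (a v z))) := fun v z => tendsto_ulim (hbd v z)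
  have hnorm : ∀ v z, ‖ulim 𝒱 (a v z)‖ ≤ 1 * ‖v‖ * ‖z‖ := by
    intro v z
    rw [one_mul]
    exact le_of_tendsto (ht v z).norm (Eventually.of_forall fun R => hbd v z R)
  let B : H →ₗ⋆[ℂ] H →ₗ[ℂ] ℂ := LinearMap.mk₂'ₛₗ (starRingEnd ℂ) (RingHom.id ℂ)
    (fun v z => ulim 𝒱 (a v z))
    (by
      intro v v' z
      refine ulim_eq (((ht v z).add (ht v' z)).congr fun R => ?_)
      simp only [ha]
      rw [← avg_add]
      congr 1
      funext p
      rw [inner_add_left]; ring)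
    (by
      intro c v z
      refine ulim_eq (((ht v z).const_mul _).congr fun R => ?_)
      simp only [ha]
      rw [← avg_mul_left]
      congr 1
      funext p
      rw [inner_smul_left]; ring)
    (by
      intro v z z'
      refine ulim_eq (((ht v z).add (ht v z')).congr fun R => ?_)
      simp only [ha]
      rw [← avg_add]
      congr 1
      funext p
      rw [inner_add_right]; ring)
    (by
      intro c v z
      refine ulim_eq (((ht v z).const_mul _).congr fun R => ?_)
      simp only [ha]
      rw [← avg_mul_left]
      congr 1
      funext p
      rw [inner_smul_right]; simp only [RingHom.id_apply]; ring)
  refine ⟨InnerProductSpace.continuousLinearMapOfBilin (B.mkContinuous₂ 1 hnorm), fun v z => ?_⟩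
  rw [InnerProductSpace.continuousLinearMapOfBilin_apply]
  exact ht v z

theorem norm_sq_le_of_invariant (U : H →ₗᵢ[ℂ] H) {κ : ℝ} (n : ℕ) :
    ∀ (M : Submodule ℂ H) [FiniteDimensional ℂ M], Module.finrank ℂ M = n →
      (∀ y ∈ M, U y ∈ M) → ∀ y ∈ M,
      (∀ χ ∈ M, ‖χ‖ = 1 → (∃ c : ℂ, U χ = c • χ) → ‖⟪χ, y⟫_ℂ‖ ≤ κ) → ‖y‖ ^ 2 ≤ n * κ ^ 2 := by
  induction n with
  | zero =>
    intro M _ hn _ y hy _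
    have : M = ⊥ := Submodule.finrank_eq_zero.1 hn
    rw [this, Submodule.mem_bot] at hy
    simp [hy]
  | succ n ih =>
    intro M _ hn hU y hy hc
    have : Nontrivial M := Module.nontrivial_of_finrank_pos (R := ℂ) (by omega)
    let f : Module.End ℂ M := U.toLinearMap.restrict hU
    obtain ⟨c, hcv⟩ := Module.End.exists_eigenvalue f
    obtain ⟨v, hv⟩ := hcv.exists_hasEigenvector
    have hv0 : (v : H) ≠ 0 := by simpa using hv.2
    have hv1 : U (v : H) = c • (v : H) := by
      have := congrArg (fun z : M => (z : H)) hv.apply_eq_smul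
      exact this
    set χ : H := ((‖(v : H)‖ : ℂ)⁻¹) • (v : H) with hχ
    have hχ1 : ‖χ‖ = 1 := by
      rw [hχ, norm_smul, norm_inv, Complex.norm_real, norm_norm]
      exact inv_mul_cancel₀ (norm_ne_zero_iff.2 hv0)
    have hχU : U χ = c • χ := by
      rw [hχ, map_smul, hv1, smul_comm]
    have hχM : χ ∈ M := M.smul_mem _ v.2
    have hχχ : ⟪χ, χ⟫_ℂ = 1 := by rw [inner_self_eq_norm_sq_to_K, hχ1]; simp
    have hc0 : c ≠ 0 := by
      rintro rfl
      rw [zero_smul] at hχU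
      have := U.norm_map χ
      rw [hχU, hχ1] at this
      simp at this
    set W : Submodule ℂ H := ℂ ∙ χ with hW
    have hWM : W ≤ M := (Submodule.span_singleton_le_iff_mem _ _).2 hχM
    have hWf : Module.finrank ℂ W = 1 := finrank_span_singleton (by
      intro h; rw [h] at hχ1; simp at hχ1)
    have hfin : Module.finrank ℂ (Wᗮ ⊓ M : Submodule ℂ H) = n :=
      Submodule.finrank_add_inf_finrank_orthogonal' hWM (by rw [hWf, hn]; ring)
    have : FiniteDimensional ℂ (Wᗮ ⊓ M : Submodule ℂ H) :=
      Submodule.finiteDimensional_of_le inf_le_right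
    have hmem : ∀ z, z ∈ Wᗮ ↔ ⟪χ, z⟫_ℂ = 0 := fun z => Submodule.mem_orthogonal_singleton_iff_inner_right
    set y' : H := y - ⟪χ, y⟫_ℂ • χ with hy'
    have hy'W : ⟪χ, y'⟫_ℂ = 0 := by
      rw [hy', inner_sub_right, inner_smul_right, hχχ]; ring
    have hdec : ‖y‖ ^ 2 = ‖y'‖ ^ 2 + ‖⟪χ, y⟫_ℂ‖ ^ 2 := by
      have h1 : y = y' + ⟪χ, y⟫_ℂ • χ := by rw [hy']; abel
      have h2 : ⟪y', ⟪χ, y⟫_ℂ • χ⟫_ℂ = 0 := by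
        rw [inner_smul_right, ← inner_conj_symm y', hy'W]; simp
      have h3 := norm_add_sq_eq_norm_sq_add_norm_sq_of_inner_eq_zero y' (⟪χ, y⟫_ℂ • χ) h2
      rw [← h1, norm_smul, hχ1, mul_one] at h3
      nlinarith
    have := ih (Wᗮ ⊓ M) hfin ?_ y' ?_ ?_
    · have h1 := hc χ hχM hχ1 ⟨c, hχU⟩
      have h2 : ‖⟪χ, y⟫_ℂ‖ ^ 2 ≤ κ ^ 2 := by gcongr
      push_cast
      rw [hdec]
      linarith
    · rintro z ⟨hz1, hz2⟩
      refine ⟨?_, hU z hz2⟩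
      rw [SetLike.mem_coe, hmem] at hz1
      rw [SetLike.mem_coe, hmem]
      have h1 : ⟪U χ, U z⟫_ℂ = ⟪χ, z⟫_ℂ := U.inner_map_map χ z
      rw [hz1, hχU, inner_smul_left] at h1
      exact (mul_eq_zero.1 h1).resolve_left (by simpa using hc0)
    · exact ⟨(hmem _).2 hy'W, M.sub_mem hy (M.smul_mem _ hχM)⟩
    · rintro ψ ⟨hψW, hψM⟩ hψ he
      have h1 : ⟪χ, ψ⟫_ℂ = 0 := (hmem ψ).1 hψW
      have h2 : ⟪ψ, y'⟫_ℂ = ⟪ψ, y⟫_ℂ := by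
        rw [hy', inner_sub_right, inner_smul_right, ← inner_conj_symm ψ χ, h1]; simp
      rw [h2]
      exact hc ψ hψM hψ he

end CompactPart

section EigenvectorCorrelation

open scoped InnerProductSpace

variable {H : Type*} [NormedAddCommGroup H] [InnerProductSpace ℂ H]

theorem tendsto_avg_range_shift {g : ℤ → ℂ} {C : ℝ} (hg : ∀ n, ‖g n‖ ≤ C) :
    Tendsto (fun R : ℕ => avg (range R ×ˢ range R) (fun p => g ((p.1 : ℤ) - p.2 - 1)) -
      avg (range R ×ˢ range R) (fun p => g ((p.1 : ℤ) - p.2))) atTop (nhds 0) := by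
  have hC : 0 ≤ C := (norm_nonneg _).trans (hg 0)
  have hlim : Tendsto (fun R : ℕ => 2 * C * (R : ℝ)⁻¹) atTop (nhds 0) := by
    simpa using tendsto_inv_atTop_nhds_zero_nat.const_mul (2 * C)
  refine squeeze_zero_norm (fun R => ?_) hlim
  rcases Nat.eq_zero_or_pos R with rfl | hR
  · simp [avg]
  rw [← avg_sub, avg, Finset.sum_product_right, norm_mul]
  have h1 : ∀ h' ∈ range R, ‖∑ h ∈ range R, (g ((h : ℤ) - (h' : ℕ) - 1) - g ((h : ℤ) - (h' : ℕ)))‖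
      ≤ 2 * C := by
    intro h' _
    have h2 := Finset.sum_range_sub' (fun h : ℕ => g ((h : ℤ) - h' - 1)) R
    have h3 : ∑ h ∈ range R, (g ((h : ℤ) - (h' : ℕ) - 1) - g ((h : ℤ) - (h' : ℕ)))
        = g ((0 : ℕ) - h' - 1) - g ((R : ℤ) - h' - 1) := by
      rw [← h2]
      refine Finset.sum_congr rfl fun h _ => ?_
      congr 2
      push_cast; ring
    rw [h3]
    calc _ ≤ _ := norm_sub_le _ _
      _ ≤ C + C := add_le_add (hg _) (hg _)
      _ = 2 * C := by ring
  have h2 := (norm_sum_le_of_le _ h1)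
  rw [Finset.sum_const, card_range, nsmul_eq_mul] at h2
  calc _ ≤ ‖((#(range R ×ˢ range R) : ℕ) : ℂ)⁻¹‖ * ((R : ℝ) * (2 * C)) := by gcongr
    _ = 2 * C * (R : ℝ)⁻¹ := by
      rw [card_product, card_range, norm_inv]
      have : (R : ℝ) ≠ 0 := by positivity
      simp
      field_simp

theorem exists_eigenvector_correlation [CompleteSpace H] (U : H →ₗᵢ[ℂ] H)
    (hU : Function.Surjective U) (w : ℤ → H) (hw : ∀ n, ‖w n‖ ≤ 1)
    (hUw : ∀ n, U (w n) = w (n + 1)) {δ : ℝ} (hδ : 0 < δ)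
    (h : ∀ᶠ R : ℕ in UF, δ ≤ (R : ℝ)⁻¹ * (R : ℝ)⁻¹ * ∑ h ∈ range R, ∑ h' ∈ range R,
      ‖⟪w ((h : ℤ) - (h' : ℤ)), w 0⟫_ℂ‖ ^ 2) :
    ∃ χ : H, ‖χ‖ = 1 ∧ (∃ c : ℂ, U χ = c • χ) ∧ δ / 3 ≤ ‖⟪χ, w 0⟫_ℂ‖ := by
  obtain ⟨K, hK⟩ := exists_ulim_rankOne (fun R => range R ×ˢ range R)
    (fun p : ℕ × ℕ => w ((p.1 : ℤ) - p.2)) (fun p => hw _) UF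
  set r : ℕ → H → ℝ := fun R v =>
    (R : ℝ)⁻¹ * (R : ℝ)⁻¹ * ∑ p ∈ range R ×ˢ range R, ‖⟪w ((p.1 : ℤ) - p.2), v⟫_ℂ‖ ^ 2 with hr
  have hr0 : ∀ R v, 0 ≤ r R v := fun R v => by simp only [hr]; positivity
  have hav : ∀ R v, avg (range R ×ˢ range R) (fun p => ⟪v, w ((p.1 : ℤ) - p.2)⟫_ℂ *
      ⟪w ((p.1 : ℤ) - p.2), v⟫_ℂ) = (r R v : ℂ) := by
    intro R v
    simp only [avg, hr]
    push_cast
    rw [card_product, card_range]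
    push_cast
    rw [mul_inv]
    congr 1
    refine Finset.sum_congr rfl fun p _ => ?_
    rw [← inner_conj_symm v, ← Complex.normSq_eq_conj_mul_self, Complex.normSq_eq_norm_sq]
    norm_cast
  have hre : ∀ v, Tendsto (fun R => r R v) UF (nhds (⟪K v, v⟫_ℂ).re) := by
    intro v
    have := (Complex.continuous_re.tendsto _).comp (hK v v)
    refine this.congr fun R => ?_
    simp only [Function.comp]
    rw [hav, Complex.ofReal_re]
  have hpos : K.IsPositive := by
    rw [ContinuousLinearMap.isPositive_iff_complex]
    intro v
    refine ⟨?_, ge_of_tendsto' (hre v) fun R => hr0 R v⟩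
    have h1 : Tendsto (fun R => (r R v : ℂ)) UF (nhds ((⟪K v, v⟫_ℂ).re : ℂ)) :=
      (Complex.continuous_ofReal.tendsto _).comp (hre v)
    have h2 := hK v v
    simp only [hav] at h2
    exact tendsto_nhds_unique h1 h2
  have hle : ∀ v, (⟪K v, v⟫_ℂ).re ≤ ‖v‖ ^ 2 := by
    intro v
    refine le_of_tendsto' (hre v) fun R => ?_
    calc r R v ≤ (R : ℝ)⁻¹ * (R : ℝ)⁻¹ * ∑ p ∈ range R ×ˢ range R, ‖v‖ ^ 2 := by
          simp only [hr]
          gcongr with p _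
          exact (norm_inner_le_norm _ _).trans (mul_le_of_le_one_left (norm_nonneg _) (hw _))
      _ = ((R : ℝ)⁻¹ * R) * ((R : ℝ)⁻¹ * R) * ‖v‖ ^ 2 := by
          rw [sum_const, card_product, card_range, nsmul_eq_mul]; push_cast; ring
      _ ≤ 1 * 1 * ‖v‖ ^ 2 := by
          have : (R : ℝ)⁻¹ * R ≤ 1 := inv_mul_le_one
          gcongr
      _ = ‖v‖ ^ 2 := by ring
  have htr : ∀ (m : ℕ) (e : Fin m → H), Orthonormal ℂ e → ∑ i, (⟪K (e i), e i⟫_ℂ).re ≤ 1 := by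
    intro m e he
    refine le_of_tendsto' (tendsto_finsetSum univ fun i _ => hre (e i)) fun R => ?_
    simp only [hr]
    rw [← mul_sum, sum_comm]
    calc _ ≤ (R : ℝ)⁻¹ * (R : ℝ)⁻¹ * ∑ p ∈ range R ×ˢ range R, (1 : ℝ) := by
          gcongr with p _
          have h1 := he.sum_inner_products_le (w ((p.1 : ℤ) - p.2)) (s := univ)
          have h2 : ‖w ((p.1 : ℤ) - p.2)‖ ^ 2 ≤ 1 := pow_le_one₀ (norm_nonneg _) (hw _)
          refine le_trans (le_of_eq ?_) (h1.trans h2)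
          refine Finset.sum_congr rfl fun i _ => ?_
          rw [norm_inner_symm]
      _ = ((R : ℝ)⁻¹ * R) * ((R : ℝ)⁻¹ * R) := by
          rw [sum_const, card_product, card_range, nsmul_eq_mul]; push_cast; ring
      _ ≤ 1 := by
          have h1 : (R : ℝ)⁻¹ * R ≤ 1 := inv_mul_le_one
          exact mul_le_one₀ h1 (by positivity) h1
  have hinv : ∀ v z, ⟪K (U v), U z⟫_ℂ = ⟪K v, z⟫_ℂ := by
    intro v z
    have h1 := (tendsto_avg_range_shift (g := fun n => ⟪v, w n⟫_ℂ * ⟪w n, z⟫_ℂ)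
      (C := ‖v‖ * ‖z‖) (fun n => by
        rw [norm_mul]
        refine mul_le_mul ?_ ?_ (norm_nonneg _) (norm_nonneg _)
        · exact (norm_inner_le_norm _ _).trans (mul_le_of_le_one_right (norm_nonneg _) (hw n))
        · exact (norm_inner_le_norm _ _).trans
            (mul_le_of_le_one_left (norm_nonneg _) (hw n)))).mono_left UF_le
    have h2 := h1.add (hK v z)
    rw [zero_add] at h2
    refine tendsto_nhds_unique (hK (U v) (U z)) (h2.congr fun R => ?_)
    simp only [sub_add_cancel]
    congr 1
    funext p
    have h3 : w ((p.1 : ℤ) - p.2) = U (w ((p.1 : ℤ) - p.2 - 1)) := by rw [hUw, sub_add_cancel]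
    rw [h3, U.inner_map_map, U.inner_map_map]
  have hcomm : Commute (U.toContinuousLinearMap) K := by
    ext v
    change U (K v) = K (U v)
    refine ext_inner_right ℂ fun z => ?_
    obtain ⟨z, rfl⟩ := hU z
    rw [U.inner_map_map, hinv]
  obtain ⟨A, hAc, hfd, hfr, hAle⟩ := exists_spectral_truncation K hpos hle htr
    (a := δ / 4) (by positivity)
  have hUA := hAc _ hcomm
  have hKx : δ ≤ (⟪K (w 0), w 0⟫_ℂ).re := by
    refine ge_of_tendsto (hre (w 0)) (h.mono fun R hR => hR.trans_eq ?_)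
    simp only [hr]
    rw [sum_product]
  set y : H := A.range.starProjection (w 0) with hy
  have hyM : y ∈ A.range := Submodule.starProjection_apply_mem _ _
  have hz : w 0 - y ∈ A.rangeᗮ := Submodule.sub_starProjection_mem_orthogonal _
  have h1 := hAle y hyM _ hz
  rw [add_sub_cancel] at h1
  have hx1 : ‖w 0‖ ^ 2 ≤ 1 := pow_le_one₀ (norm_nonneg _) (hw 0)
  by_contra! hcon
  have h2 := norm_sq_le_of_invariant U (κ := δ / 3) _ A.range rfl ?_ y hyM ?_
  · have h3 : (Module.finrank ℂ A.range : ℝ) * (δ / 3) ^ 2 ≤ (δ / 4)⁻¹ * (δ / 3) ^ 2 := by gcongr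
    have h4 : (δ / 4)⁻¹ * (δ / 3) ^ 2 = 4 * δ / 9 := by field_simp; norm_num
    nlinarith
  · rintro _ ⟨v, rfl⟩
    refine ⟨U v, ?_⟩
    have := congrArg (fun B : H →L[ℂ] H => B v) hUA.eq
    exact this.symm
  · intro χ hχM hχ hc
    have h3 : ⟪χ, y⟫_ℂ = ⟪χ, w 0⟫_ℂ := by
      have h4 : ⟪χ, w 0 - y⟫_ℂ = 0 := hz χ hχM
      rw [inner_sub_right, sub_eq_zero] at h4
      exact h4.symm
    rw [h3]
    exact (hcon χ hχ hc).le

end EigenvectorCorrelation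

section InverseTheorem

set_option linter.unusedSectionVars false

variable {X V : Type*} [MeasurableSpace X] [AddCommGroup V] {μ : Measure X} {T : V → X → X}

/-- A unimodular joint eigenfunction of the action with eigenvalue `l`. -/
def IsEig (μ : Measure X) (T : V → X → X) (χ : X → ℂ) (l : V → ℂ) : Prop :=
  Measurable χ ∧ (∀ x, ‖χ x‖ = 1) ∧ ∀ g, ∀ᵐ x ∂μ, χ (T g x) = l g * χ x

/-- Bounded functions invariant under `T u` are constant. -/
def InvConst (μ : Measure X) (T : V → X → X) (u : V) : Prop :=
  ∀ f : X → ℂ, B1 f → (∀ᵐ x ∂μ, f (T u x) = f x) → ∃ c : ℂ, ∀ᵐ x ∂μ, f x = c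

theorem IsEig.b1 {χ : X → ℂ} {l : V → ℂ} (h : IsEig μ T χ l) : B1 χ :=
  ⟨h.1, fun x => (h.2.1 x).le⟩

theorem ae_comp (hT : IsMPAction μ T) {p : X → Prop} (h : ∀ᵐ x ∂μ, p x) (g : V) :
    ∀ᵐ x ∂μ, p (T g x) := (hT.mp g).quasiMeasurePreserving.ae h

theorem exists_isEig_of_eigenfunction [IsProbabilityMeasure μ] (hT : IsMPAction μ T) {u : V}
    (hu : InvConst μ T u) {χ₀ : X → ℂ} (hm : Measurable χ₀) (h1 : ∫ x, ‖χ₀ x‖ ^ 2 ∂μ = 1)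
    {c : ℂ} (hc : ‖c‖ = 1) (hχ : ∀ᵐ x ∂μ, χ₀ (T u x) = c * χ₀ x) :
    ∃ χ l, IsEig μ T χ l ∧ ∀ᵐ x ∂μ, χ x = χ₀ x := by
  obtain ⟨a, ha⟩ := hu (fun x => ((‖χ₀ x‖ / (1 + ‖χ₀ x‖) : ℝ) : ℂ)) ⟨by fun_prop, fun x => by
      rw [Complex.norm_real, Real.norm_of_nonneg (by positivity)]
      exact div_le_one_of_le₀ (by linarith [norm_nonneg (χ₀ x)]) (by positivity)⟩ (by
      filter_upwards [hχ] with x hx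
      rw [hx, norm_mul, hc, one_mul])
  obtain ⟨x₀, hx₀⟩ := ha.exists
  have hr : ∀ᵐ x ∂μ, ‖χ₀ x‖ = ‖χ₀ x₀‖ := by
    filter_upwards [ha] with x hx
    rw [← hx₀] at hx
    have h2 : ‖χ₀ x‖ / (1 + ‖χ₀ x‖) = ‖χ₀ x₀‖ / (1 + ‖χ₀ x₀‖) := by exact_mod_cast hx
    have h3 : (1 + ‖χ₀ x‖) ≠ 0 := by positivity
    have h4 : (1 + ‖χ₀ x₀‖) ≠ 0 := by positivity
    rw [div_eq_div_iff h3 h4] at h2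
    linarith
  have hr1 : ‖χ₀ x₀‖ = 1 := by
    have h2 : ∫ x, ‖χ₀ x‖ ^ 2 ∂μ = ∫ _, ‖χ₀ x₀‖ ^ 2 ∂μ := by
      refine integral_congr_ae ?_
      filter_upwards [hr] with x hx
      rw [hx]
    rw [h1] at h2
    simp only [integral_const, probReal_univ, one_smul] at h2
    exact (pow_eq_one_iff_of_nonneg (norm_nonneg _) two_ne_zero).1 h2.symm
  rw [hr1] at hr
  classical
  set χ : X → ℂ := fun x => if ‖χ₀ x‖ = 1 then χ₀ x else 1 with hχd
  have hχm : Measurable χ :=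
    Measurable.ite (measurableSet_eq_fun (by fun_prop) measurable_const) hm measurable_const
  have hχ1 : ∀ x, ‖χ x‖ = 1 := by
    intro x
    simp only [hχd]
    split_ifs with h
    · exact h
    · simp
  have hae : ∀ᵐ x ∂μ, χ x = χ₀ x := by
    filter_upwards [hr] with x hx
    simp only [hχd, if_pos hx]
  have hχu : ∀ᵐ x ∂μ, χ (T u x) = c * χ x := by
    filter_upwards [hae, ae_comp hT hae u, hχ] with x h1 h2 h3
    rw [h2, h3, h1]
  have hb : B1 χ := ⟨hχm, fun x => (hχ1 x).le⟩
  have hcc : c * (starRingEnd ℂ) c = 1 := by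
    rw [Complex.mul_conj, Complex.normSq_eq_norm_sq, hc]; simp
  have hxx : ∀ x, (starRingEnd ℂ) (χ x) * χ x = 1 := by
    intro x
    rw [← Complex.normSq_eq_conj_mul_self, Complex.normSq_eq_norm_sq, hχ1]; simp
  have hl : ∀ g : V, ∃ l : ℂ, ∀ᵐ x ∂μ, χ (T g x) = l * χ x := by
    intro g
    obtain ⟨l, hl⟩ := hu (fun x => χ (T g x) * (starRingEnd ℂ) (χ x))
      ((hb.act hT g).mul hb.conj) (by
        filter_upwards [hχu, ae_comp hT hχu g] with x h1 h2
        rw [hT.apply_add, add_comm, ← hT.apply_add, h2, h1, map_mul]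
        linear_combination (χ (T g x) * (starRingEnd ℂ) (χ x)) * hcc)
    refine ⟨l, ?_⟩
    filter_upwards [hl] with x hx
    rw [← hx]
    linear_combination (-χ (T g x)) * hxx x
  choose l hl using hl
  exact ⟨χ, l, ⟨hχm, hχ1, hl⟩, hae⟩

/-- A function whose box averages in an ergodic direction are bounded below correlates with an
eigenfunction. -/
theorem exists_isEig_correlation [IsProbabilityMeasure μ] (hT : IsMPAction μ T) {u : V}
    (hu : InvConst μ T u) {f : X → ℂ} (hf : B1 f) {δ : ℝ} (hδ : 0 < δ)
    (h : ∀ᶠ R in UF, δ ≤ boxAvg μ T [u] [R] f) :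
    ∃ χ l, IsEig μ T χ l ∧ δ / 3 ≤ ‖∫ x, f x * (starRingEnd ℂ) (χ x) ∂μ‖ := by
  let w : ℤ → Lp ℂ 2 μ := fun n => ((hf.act hT (n • u)).memLp 2).toLp _
  have hw : ∀ n, w n =ᵐ[μ] fun x => f (T (n • u) x) := fun n => MemLp.coeFn_toLp _
  have hw1 : ∀ n, ‖w n‖ ≤ 1 := by
    intro n
    rw [Lp.norm_toLp]
    have h1 : eLpNorm (fun x => f (T (n • u) x)) 2 μ ≤ 1 := by
      refine (eLpNorm_le_of_ae_bound (C := 1) (Eventually.of_forall fun x => hf.2 _)).trans ?_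
      simp
    exact ENNReal.toReal_le_of_le_ofReal zero_le_one (by simpa using h1)
  let U := Lp.compMeasurePreservingₗᵢ ℂ (E := ℂ) (p := 2) (T u) (hT.mp u)
  have hUv : ∀ v : Lp ℂ 2 μ, U v =ᵐ[μ] fun x => v (T u x) := fun v =>
    Lp.coeFn_compMeasurePreserving v (hT.mp u)
  have hU : Function.Surjective U := by
    intro v
    refine ⟨Lp.compMeasurePreservingₗᵢ ℂ (E := ℂ) (p := 2) (T (-u)) (hT.mp (-u)) v, ?_⟩
    refine Lp.ext ?_
    have h1 := Lp.coeFn_compMeasurePreserving v (hT.mp (-u))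
    refine (hUv _).trans ?_
    filter_upwards [ae_comp hT h1 u] with x hx
    refine hx.trans ?_
    simp only [Function.comp]
    rw [hT.apply_add, neg_add_cancel, hT.apply_zero]
  have hUw : ∀ n, U (w n) = w (n + 1) := by
    intro n
    refine Lp.ext ?_
    filter_upwards [hUv (w n), ae_comp hT (hw n) u, hw (n + 1)] with x h1 h2 h3
    rw [h1, h2, h3, hT.apply_add, add_smul, one_smul]
  have hinner : ∀ v z : Lp ℂ 2 μ, inner ℂ v z = ∫ x, z x * (starRingEnd ℂ) (v x) ∂μ := by
    intro v z
    rw [L2.inner_def]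
    refine integral_congr_ae (Eventually.of_forall fun x => ?_)
    simp only [RCLike.inner_apply]
  obtain ⟨χ₀, hn, ⟨c, hc⟩, hcor⟩ := exists_eigenvector_correlation U hU w hw1 hUw hδ (by
    refine h.mono fun R hR => hR.trans_eq ?_
    simp only [boxAvg]
    congr 1
    refine Finset.sum_congr rfl fun a _ => Finset.sum_congr rfl fun b _ => ?_
    congr 1
    rw [hinner, ← hT.integral_comp (-((b : ℤ) • u)), ← RCLike.norm_conj (K := ℂ), ← integral_conj]
    congr 1
    refine integral_congr_ae ?_
    filter_upwards [hw ((a : ℤ) - b), hw 0] with x h1 h2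
    rw [h1, h2]
    simp only [mderiv, hT.apply_add]
    rw [map_mul, RingHomCompTriple.comp_apply, RingHom.id_apply, mul_comm, zero_smul, sub_smul,
      sub_eq_add_neg, add_neg_cancel])
  have hχm : Measurable χ₀ := (Lp.stronglyMeasurable χ₀).measurable
  have hχu : ∀ᵐ x ∂μ, χ₀ (T u x) = c * χ₀ x := by
    have h1 := hUv χ₀
    rw [hc] at h1
    filter_upwards [h1, Lp.coeFn_smul c χ₀] with x h2 h3
    rw [← h2, h3]; rfl
  have hc1 : ‖c‖ = 1 := by
    have := U.norm_map χ₀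
    rw [hc, norm_smul, hn, mul_one] at this
    exact this
  have h_int : ∫ x, ‖χ₀ x‖ ^ 2 ∂μ = 1 := by
    have h1 : inner ℂ χ₀ χ₀ = (1 : ℂ) := by rw [inner_self_eq_norm_sq_to_K, hn]; simp
    rw [hinner] at h1
    have h2 : ∫ x, χ₀ x * (starRingEnd ℂ) (χ₀ x) ∂μ = ∫ x, ((‖χ₀ x‖ ^ 2 : ℝ) : ℂ) ∂μ := by
      congr 1
      funext x
      rw [Complex.mul_conj, Complex.normSq_eq_norm_sq]
    rw [h2, integral_complex_ofReal] at h1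
    exact_mod_cast h1
  obtain ⟨χ, l, hχ, hae⟩ := exists_isEig_of_eigenfunction hT hu hχm h_int hc1 hχu
  refine ⟨χ, l, hχ, hcor.trans_eq ?_⟩
  rw [hinner]
  congr 1
  refine integral_congr_ae ?_
  filter_upwards [hae, hw 0] with x h1 h2
  rw [h1, h2, zero_smul, hT.apply_zero]

end InverseTheorem

section WeakLimits

variable {X : Type*} [MeasurableSpace X] {μ : Measure X}

theorem exists_weak_ulim_hilbert {H : Type*} [NormedAddCommGroup H] [InnerProductSpace ℂ H]
    [CompleteSpace H] (w : ℕ → H) {C : ℝ} (hw : ∀ N, ‖w N‖ ≤ C) (𝒱 : Ultrafilter ℕ) :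
    ∃ v : H, ∀ z, Tendsto (fun N => inner ℂ (w N) z) 𝒱 (nhds (inner ℂ v z)) := by
  have hbd : ∀ z N, ‖(inner ℂ (w N) z : ℂ)‖ ≤ C * ‖z‖ := fun z N =>
    (norm_inner_le_norm _ _).trans (mul_le_mul_of_nonneg_right (hw N) (norm_nonneg _))
  have ht := fun z => tendsto_ulim (𝒱 := 𝒱) (hbd z)
  let φ : H →ₗ[ℂ] ℂ :=
    { toFun := fun z => ulim 𝒱 fun N => inner ℂ (w N) z
      map_add' := fun z z' => ulim_eq (((ht z).add (ht z')).congr fun N => by rw [inner_add_right])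
      map_smul' := fun c z => ulim_eq (((ht z).const_mul c).congr fun N => by
        rw [inner_smul_right]) }
  let ψ : StrongDual ℂ H := φ.mkContinuous C fun z => le_of_tendsto (ht z).norm
    (Eventually.of_forall fun N => hbd z N)
  refine ⟨(InnerProductSpace.toDual ℂ H).symm ψ, fun z => ?_⟩
  rw [InnerProductSpace.toDual_symm_apply]
  exact ht z

theorem ae_norm_le_one_of_integral_le [IsProbabilityMeasure μ] {g : X → ℂ} (hg : MemLp g 2 μ)
    (hm : Measurable g) (h : ∀ b, B1 b → ‖∫ x, g x * b x ∂μ‖ ≤ ∫ x, ‖b x‖ ∂μ) :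
    ∀ᵐ x ∂μ, ‖g x‖ ≤ 1 := by
  classical
  set E : Set X := {x | 1 < ‖g x‖} with hE
  have hEm : MeasurableSet E := measurableSet_lt measurable_const hm.norm
  have hgi : Integrable g μ := hg.integrable (by norm_num)
  set b : X → ℂ := E.indicator fun x => (starRingEnd ℂ) (g x) * ((‖g x‖⁻¹ : ℝ) : ℂ) with hb
  have hbn : ∀ x, ‖b x‖ = E.indicator (fun _ => (1 : ℝ)) x := by
    intro x
    by_cases hx : x ∈ E
    · have : ‖g x‖ ≠ 0 := by
        have : 1 < ‖g x‖ := hx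
        linarith
      simp only [hb, Set.indicator_of_mem hx, norm_mul, RCLike.norm_conj, Complex.norm_real,
        norm_inv, norm_norm]
      exact mul_inv_cancel₀ this
    · simp only [hb, Set.indicator_of_notMem hx, norm_zero]
  have hb1 : B1 b := by
    refine ⟨Measurable.indicator (by fun_prop) hEm, fun x => ?_⟩
    rw [hbn]
    exact Set.indicator_le_self' (f := fun _ => (1 : ℝ)) (fun _ _ => zero_le_one) x
  have hgb : ∀ x, g x * b x = ((E.indicator (fun x => ‖g x‖) x : ℝ) : ℂ) := by
    intro x
    by_cases hx : x ∈ E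
    · have : (‖g x‖ : ℂ) ≠ 0 := by
        have h1 : 1 < ‖g x‖ := hx
        exact_mod_cast (by linarith : ‖g x‖ ≠ 0)
      simp only [hb, Set.indicator_of_mem hx]
      rw [← mul_assoc, Complex.mul_conj, Complex.normSq_eq_norm_sq]
      push_cast
      field_simp
    · simp only [hb, Set.indicator_of_notMem hx, mul_zero, Complex.ofReal_zero]
  have h1 := h b hb1
  simp only [hgb, hbn] at h1
  rw [integral_complex_ofReal, Complex.norm_real] at h1
  have h2 := (le_abs_self _).trans h1
  have h3 : ∫ x, E.indicator (fun x => ‖g x‖ - 1) x ∂μ ≤ 0 := by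
    have e1 : ∀ x, E.indicator (fun x => ‖g x‖ - 1) x =
        E.indicator (fun x => ‖g x‖) x - E.indicator (fun _ => (1 : ℝ)) x := fun x => by
      by_cases hx : x ∈ E <;> simp [hx]
    simp only [e1]
    rw [integral_sub (hgi.norm.indicator hEm) ((integrable_const _).indicator hEm)]
    linarith
  have hnn : ∀ x, 0 ≤ E.indicator (fun x => ‖g x‖ - 1) x := fun x =>
    Set.indicator_nonneg (fun x hx => by have : 1 < ‖g x‖ := hx; linarith) x
  have h4 := le_antisymm h3 (integral_nonneg hnn)
  rw [integral_eq_zero_iff_of_nonneg hnn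
    ((hgi.norm.sub (integrable_const 1)).indicator hEm)] at h4
  filter_upwards [h4] with x hx
  by_contra hcon
  have hxE : x ∈ E := not_le.1 hcon
  have : 1 < ‖g x‖ := hxE
  simp only [Set.indicator_of_mem hxE, Pi.zero_apply] at hx
  linarith

/-- Weak limits of bounded functions along an ultrafilter. -/
theorem exists_weak_ulim [IsProbabilityMeasure μ] (D : ℕ → X → ℂ) (hD : ∀ N, B1 (D N))
    (𝒱 : Ultrafilter ℕ) : ∃ g : X → ℂ, B1 g ∧ ∀ b, B1 b →
      Tendsto (fun N => ∫ x, D N x * b x ∂μ) 𝒱 (nhds (∫ x, g x * b x ∂μ)) := by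
  let w : ℕ → Lp ℂ 2 μ := fun N => ((hD N).conj.memLp 2).toLp _
  have hw : ∀ N, w N =ᵐ[μ] fun x => (starRingEnd ℂ) (D N x) := fun n => MemLp.coeFn_toLp _
  have hw1 : ∀ N, ‖w N‖ ≤ 1 := by
    intro N
    rw [Lp.norm_toLp]
    have h1 : eLpNorm (fun x => (starRingEnd ℂ) (D N x)) 2 μ ≤ 1 := by
      refine (eLpNorm_le_of_ae_bound (C := 1) (Eventually.of_forall fun x => (hD N).conj.2 _)).trans ?_
      simp
    exact ENNReal.toReal_le_of_le_ofReal zero_le_one (by simpa using h1)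
  obtain ⟨v, hv⟩ := exists_weak_ulim_hilbert w hw1 𝒱
  have hvm : Measurable v := (Lp.stronglyMeasurable v).measurable
  set g₀ : X → ℂ := fun x => (starRingEnd ℂ) (v x) with hg₀
  have key : ∀ b, B1 b →
      Tendsto (fun N => ∫ x, D N x * b x ∂μ) 𝒱 (nhds (∫ x, g₀ x * b x ∂μ)) := by
    intro b hb
    have hz : ((hb.memLp (μ := μ) 2).toLp b : X → ℂ) =ᵐ[μ] b := MemLp.coeFn_toLp _
    have h1 := hv ((hb.memLp 2).toLp b)
    have h2 : inner ℂ v ((hb.memLp 2).toLp b) = ∫ x, g₀ x * b x ∂μ := by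
      rw [L2.inner_def]
      refine integral_congr_ae ?_
      filter_upwards [hz] with x hx
      rw [hx, RCLike.inner_apply, mul_comm]
    rw [h2] at h1
    refine h1.congr fun N => ?_
    rw [L2.inner_def]
    refine integral_congr_ae ?_
    filter_upwards [hz, hw N] with x hx h3
    rw [hx, h3, RCLike.inner_apply, mul_comm, RingHomCompTriple.comp_apply, RingHom.id_apply]
  have hle : ∀ᵐ x ∂μ, ‖g₀ x‖ ≤ 1 := by
    refine ae_norm_le_one_of_integral_le ?_ (by fun_prop) fun b hb => ?_
    · exact (Lp.memLp v).star
    · refine le_of_tendsto (key b hb).norm (Eventually.of_forall fun N => ?_)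
      refine (norm_integral_le_integral_norm _).trans ?_
      refine integral_mono ((hD N).mul hb).integrable.norm hb.integrable.norm fun x => ?_
      simp only [norm_mul]
      exact mul_le_of_le_one_left (norm_nonneg _) ((hD N).2 x)
  classical
  refine ⟨fun x => if ‖g₀ x‖ ≤ 1 then g₀ x else 0, ⟨?_, fun x => ?_⟩, fun b hb => ?_⟩
  · exact Measurable.ite (measurableSet_le (by fun_prop) measurable_const) (by fun_prop)
      measurable_const
  · change ‖if ‖g₀ x‖ ≤ 1 then g₀ x else 0‖ ≤ 1
    split_ifs with h
    · exact h
    · simp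
  · have : ∫ x, (if ‖g₀ x‖ ≤ 1 then g₀ x else 0) * b x ∂μ = ∫ x, g₀ x * b x ∂μ := by
      refine integral_congr_ae ?_
      filter_upwards [hle] with x hx
      rw [if_pos hx]
    rw [this]
    exact key b hb

end WeakLimits

section IteratedUltrafilter

theorem eventually_GU_append {n : ℕ} {P : List ℕ → Prop} :
    (∀ᶠ Rs in GU (n + 1), P Rs) ↔ ∀ᶠ Rs in GU n, ∀ᶠ R in UF, P (Rs ++ [R]) := by
  induction n generalizing P with
  | zero =>
    rw [eventually_GU_succ, eventually_GU_zero]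
    simp only [eventually_GU_zero, List.nil_append]
  | succ n ih =>
    rw [eventually_GU_succ, eventually_GU_succ]
    simp only [ih, List.cons_append]

theorem eventually_GU_length (n : ℕ) : ∀ᶠ Rs in GU n, Rs.length = n ∧ (boxF Rs).Nonempty := by
  induction n with
  | zero =>
    rw [eventually_GU_zero]
    exact ⟨rfl, ⟨[], by simp [boxF]⟩⟩
  | succ n ih =>
    rw [eventually_GU_succ]
    filter_upwards [UF_le (eventually_gt_atTop 0)] with R hR
    filter_upwards [ih] with Rs h
    refine ⟨by simp [h.1], ?_⟩
    rw [← Finset.card_pos, card_boxF_cons]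
    exact Nat.mul_pos hR h.2.card_pos

end IteratedUltrafilter

section Pigeonhole

theorem exists_le_sum_of_le_sum_sum {ι : Type*} {S : Finset ι} (hS : S.Nonempty) {a : ι → ι → ℝ}
    {η : ℝ} (h : η ≤ (S.card : ℝ)⁻¹ * (S.card : ℝ)⁻¹ * ∑ i ∈ S, ∑ j ∈ S, a i j) :
    ∃ j ∈ S, η ≤ (S.card : ℝ)⁻¹ * ∑ i ∈ S, a i j := by
  have hc : (0 : ℝ) < S.card := by exact_mod_cast hS.card_pos
  refine Finset.exists_le_of_sum_le hS ?_
  rw [Finset.sum_const, nsmul_eq_mul, ← Finset.mul_sum, Finset.sum_comm]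
  rw [Finset.sum_comm] at h
  rw [mul_assoc] at h
  calc (S.card : ℝ) * η ≤ S.card * ((S.card : ℝ)⁻¹ * ((S.card : ℝ)⁻¹ * ∑ y ∈ S, ∑ x ∈ S, a x y)) := by
        gcongr
    _ = _ := by rw [mul_inv_cancel_left₀ hc.ne', Finset.sum_comm]

end Pigeonhole

section Characters

variable {X V : Type*} [MeasurableSpace X] {μ : Measure X} {T : V → X → X}

theorem IsEig.const {c : ℂ} (hc : ‖c‖ = 1) : IsEig μ T (fun _ => c) 1 :=
  ⟨measurable_const, fun _ => hc, fun _ => Eventually.of_forall fun _ => by simp⟩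

theorem IsEig.mul {χ χ' : X → ℂ} {l l' : V → ℂ} (h : IsEig μ T χ l) (h' : IsEig μ T χ' l') :
    IsEig μ T (fun x => χ x * χ' x) (l * l') :=
  ⟨h.1.mul h'.1, fun x => by rw [norm_mul, h.2.1, h'.2.1, mul_one], fun g => by
    filter_upwards [h.2.2 g, h'.2.2 g] with x h1 h2
    rw [h1, h2, Pi.mul_apply]; ring⟩

theorem IsEig.conj {χ : X → ℂ} {l : V → ℂ} (h : IsEig μ T χ l) :
    IsEig μ T (fun x => (starRingEnd ℂ) (χ x)) (star l) :=
  ⟨Complex.continuous_conj.measurable.comp h.1, fun x => by rw [RCLike.norm_conj, h.2.1], fun g => by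
    filter_upwards [h.2.2 g] with x h1
    rw [h1, map_mul, Pi.star_apply]; rfl⟩

theorem IsEig.norm_eq_one [IsProbabilityMeasure μ] {χ : X → ℂ} {l : V → ℂ} (h : IsEig μ T χ l)
    (g : V) : ‖l g‖ = 1 := by
  obtain ⟨x, hx⟩ := (h.2.2 g).exists
  have := congrArg norm hx
  rwa [norm_mul, h.2.1, h.2.1, mul_one, eq_comm] at this

theorem IsEig.ae_const [IsProbabilityMeasure μ] {u : V} (hu : InvConst μ T u) {χ : X → ℂ}
    {l : V → ℂ} (h : IsEig μ T χ l) (hl : l u = 1) : ∃ c : ℂ, ‖c‖ = 1 ∧ ∀ᵐ x ∂μ, χ x = c := by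
  obtain ⟨c, hc⟩ := hu χ ⟨h.1, fun x => (h.2.1 x).le⟩ (by filter_upwards [h.2.2 u] with x hx; rw [hx, hl, one_mul])
  obtain ⟨x, hx⟩ := hc.exists
  exact ⟨c, by rw [← hx, h.2.1], hc⟩

/-- Unimodular joint eigenfunctions, together with the zero function. -/
def EigOrZero (μ : Measure X) (T : V → X → X) (ψ : X → ℂ) : Prop := ψ = 0 ∨ ∃ l, IsEig μ T ψ l

theorem starClosed_eigOrZero : StarClosed (EigOrZero μ T) where
  one := Or.inr ⟨1, IsEig.const (c := 1) (by simp)⟩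
  mul := by
    rintro a b (rfl | ⟨l, hl⟩) (rfl | ⟨l', hl'⟩)
    · left; simp
    · left; simp
    · left; simp
    · exact Or.inr ⟨_, hl.mul hl'⟩
  star := by
    rintro a (rfl | ⟨l, hl⟩)
    · left; simp
    · exact Or.inr ⟨_, hl.conj⟩

theorem EigOrZero.b1 {ψ : X → ℂ} (h : EigOrZero μ T ψ) : B1 ψ := by
  rcases h with rfl | ⟨l, hl⟩
  · exact B1.const (c := 0) (by simp)
  · exact ⟨hl.1, fun x => (hl.2.1 x).le⟩

end Characters

section Cubes

variable {A : Type*} [CommMonoid A] [StarMul A]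

theorem cubeProd_one (l l' : List ℕ) : cubeProd (fun _ => (1 : A)) l l' = 1 := by
  induction l generalizing l' with
  | nil => rfl
  | cons h l ih =>
    cases l' with
    | nil => rfl
    | cons h' l' =>
      rw [cubeProd]
      simp only [star_one, mul_one]
      exact ih l'

theorem cubeProd_prod {ι : Type*} (s : Finset ι) (Φ : ι → List ℕ → A) (l l' : List ℕ) :
    cubeProd (fun t => ∏ j ∈ s, Φ j t) l l' = ∏ j ∈ s, cubeProd (Φ j) l l' := by
  classical
  induction s using Finset.induction_on with
  | empty => simp only [Finset.prod_empty]; exact cubeProd_one l l'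
  | insert a s ha ih =>
    simp only [Finset.prod_insert ha]
    rw [cubeProd_mul, ih]

theorem cubeProd_const {c : A} (hc : c * star c = 1) {l l' : List ℕ} (hl : l.length = l'.length)
    (h0 : l ≠ []) : cubeProd (fun _ => c) l l' = 1 := by
  cases l with
  | nil => exact absurd rfl h0
  | cons h l =>
    cases l' with
    | nil => simp at hl
    | cons h' l' =>
      rw [cubeProd]
      simp only [hc]
      exact cubeProd_one l l'

theorem cubeProd_comp {X Y : Type*} (g : Y → X) (Φ : List ℕ → X → ℂ) (l l' : List ℕ) :
    cubeProd (fun t y => Φ t (g y)) l l' = fun y => cubeProd Φ l l' (g y) :=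
  cubeProd_map (fun (a : X → ℂ) (y : Y) => a (g y)) (fun _ _ => rfl) (fun _ => rfl) Φ l l'

theorem cubeProd_apply {ι : Type*} {X : Type*} (n : ι) (Φ : List ℕ → ι → X → ℂ) (l l' : List ℕ) :
    cubeProd Φ l l' n = cubeProd (fun t => Φ t n) l l' :=
  (cubeProd_map (fun a : ι → X → ℂ => a n) (fun _ _ => rfl) (fun _ => rfl) Φ l l').symm

theorem cubeProd_mul_fun {X : Type*} (Φ Ψ : List ℕ → X → ℂ) (l l' : List ℕ) :
    cubeProd (fun t x => Φ t x * Ψ t x) l l' = fun x => cubeProd Φ l l' x * cubeProd Ψ l l' x :=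
  cubeProd_mul Φ Ψ l l'

theorem cubeProd_conj_fun {X : Type*} (Φ : List ℕ → X → ℂ) (l l' : List ℕ) :
    cubeProd (fun t x => (starRingEnd ℂ) (Φ t x)) l l' =
      fun x => (starRingEnd ℂ) (cubeProd Φ l l' x) :=
  cubeProd_star Φ l l'

variable {X : Type*} [MeasurableSpace X] {μ : Measure X} [IsProbabilityMeasure μ]

theorem pow_sum_norm_integral_le (Rs : List ℕ) {Φ b : List ℕ → X → ℂ}
    (hΦ : ∀ l, B1 (Φ l)) (hb : ∀ l, B1 (b l)) (hlow : IsLow B1 Rs.length b) :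
    (((boxF Rs).card : ℝ)⁻¹ * ∑ l ∈ boxF Rs, ‖∫ x, Φ l x * b l x ∂μ‖ ^ 2) ^ 2 ^ Rs.length ≤
      ((boxF Rs).card : ℝ)⁻¹ * ((boxF Rs).card : ℝ)⁻¹ * ∑ l ∈ boxF Rs, ∑ l' ∈ boxF Rs,
        ‖∫ x, cubeProd Φ l l' x ∂μ‖ ^ 2 := by
  let dbl : (X → ℂ) → Unit → X × X → ℂ := fun a _ z => a z.1 * (starRingEnd ℂ) (a z.2)
  have hd1 : dbl 1 = 1 := by funext _ z; simp [dbl]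
  have hdm : ∀ a b, dbl (a * b) = dbl a * dbl b := fun a b => by
    funext _ z; simp [dbl]; ring
  have hds : ∀ a, dbl (star a) = star (dbl a) := fun a => by
    funext _ z; simp [dbl]
  have hdB : ∀ a, B1 a → ∀ n, B1 (dbl a n) := fun a ha _ =>
    (ha.comp measurable_fst).mul (ha.comp measurable_snd).conj
  have hdi : ∀ a : X → ℂ, ∫ z, dbl a () z ∂(μ.prod μ) = ((‖∫ x, a x ∂μ‖ ^ 2 : ℝ) : ℂ) := fun a => by
    simp only [dbl]
    rw [integral_prod_mul a (fun y => (starRingEnd ℂ) (a y)), integral_conj, Complex.mul_conj,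
      Complex.normSq_eq_norm_sq]
  have h := gowersCauchySchwarz (μ := μ.prod μ) ({()} : Finset Unit) Rs (Φ := fun l => dbl (Φ l))
    (b := fun l => dbl (b l)) (fun l => hdB _ (hΦ l)) (fun l => hdB _ (hb l))
    (hlow.map dbl hd1 hdm hdB)
  have e1 : ∀ a : Unit → ℂ, avg ({()} : Finset Unit) a = a () := fun a => by simp [avg]
  simp only [e1] at h
  have e2 : ∀ l, ∫ z, dbl (Φ l) () z * dbl (b l) () z ∂(μ.prod μ) =
      ((‖∫ x, Φ l x * b l x ∂μ‖ ^ 2 : ℝ) : ℂ) := fun l => by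
    rw [← hdi fun x => Φ l x * b l x]
    exact integral_congr_ae (Eventually.of_forall fun z => by simp only [dbl, map_mul]; ring)
  have e3 : ∀ l l', ∫ z, cubeProd (fun l => dbl (Φ l)) l l' () z ∂(μ.prod μ) =
      ((‖∫ x, cubeProd Φ l l' x ∂μ‖ ^ 2 : ℝ) : ℂ) := fun l l' => by
    rw [cubeProd_map dbl hdm hds, hdi]
  simp only [e2, e3, Complex.norm_real, norm_pow, norm_norm] at h
  refine le_trans (le_of_eq ?_) h
  congr 1
  have e4 : (avg (boxF Rs) fun l => ((‖∫ x, Φ l x * b l x ∂μ‖ ^ 2 : ℝ) : ℂ)) =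
      (((boxF Rs).card : ℝ)⁻¹ * ∑ l ∈ boxF Rs, ‖∫ x, Φ l x * b l x ∂μ‖ ^ 2 : ℝ) := by
    rw [avg]; push_cast; rfl
  rw [e4, Complex.norm_real, Real.norm_of_nonneg (by positivity)]

end Cubes

section DualFunctions

variable {X V G : Type*} [MeasurableSpace X] [AddCommGroup V] {μ : Measure X}
  [IsProbabilityMeasure μ] {T : V → X → X}

theorem norm_avg_integral_eig_sq_le (S : Finset G) {q : G → V} {H : X → ℂ}
    {F : G → X → ℂ} (hH : B1 H) (hF : ∀ n, B1 (F n)) {χ : X → ℂ} {l : V → ℂ}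
    (h : IsEig μ T χ l) :
    ‖avg S fun n => ∫ x, H x * (starRingEnd ℂ) (F n x) * χ (T (q n) x) ∂μ‖ ^ 2 ≤
      nsq μ fun x => avg S fun n => star (l (q n)) * F n x := by
  have hl : ∀ n, ‖star (l (q n))‖ ≤ 1 := fun n => by rw [norm_star, h.norm_eq_one]
  have hW : B1 fun x => avg S fun n => star (l (q n)) * F n x :=
    B1.avg S fun n => (B1.const (hl n)).mul (hF n)
  have e1 : (avg S fun n => ∫ x, H x * (starRingEnd ℂ) (F n x) * χ (T (q n) x) ∂μ) =
      ∫ x, (starRingEnd ℂ) (avg S fun n => star (l (q n)) * F n x) * (H x * χ x) ∂μ := by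
    simp only [← avg_conj, ← avg_mul_right]
    rw [integral_avg S fun n => ((B1.conj ((B1.const (hl n)).mul (hF n))).mul
      (hH.mul h.b1)).integrable]
    refine avg_congr fun n _ => integral_congr_ae ?_
    filter_upwards [h.2.2 (q n)] with x hx
    rw [hx, map_mul, starRingEnd_apply (star (l (q n))), star_star]
    ring
  rw [e1]
  refine (norm_integral_sq_le_nsq hW.conj (hH.mul h.b1)).trans (le_of_eq ?_)
  simp only [nsq, RCLike.norm_conj]

/-- `f` is the weak limit along `𝒱` of the dual functions attached to the averages with
coefficients `F` and iterates `q`. -/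
structure IsDualFun (μ : Measure X) (T : V → X → X) (I : ℕ → Finset G) (𝒱 : Ultrafilter ℕ)
    (q : G → V) (H : ℕ → X → ℂ) (F : G → X → ℂ) (f : X → ℂ) : Prop where
  b1 : B1 f
  bH : ∀ N, B1 (H N)
  bF : ∀ n, B1 (F n)
  lim : ∀ b, B1 b → Tendsto (fun N => avg (I N) fun n =>
    ∫ x, H N x * (starRingEnd ℂ) (F n x) * b (T (q n) x) ∂μ) 𝒱 (nhds (∫ x, f x * b x ∂μ))

theorem IsDualFun.integral_eig {I : ℕ → Finset G} {𝒱 : Ultrafilter ℕ}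
    {q : G → V} {H : ℕ → X → ℂ} {F : G → X → ℂ} {f : X → ℂ} (hf : IsDualFun μ T I 𝒱 q H F f)
    {χ : X → ℂ} {l : V → ℂ} (h : IsEig μ T χ l)
    (h0 : Tendsto (fun N => nsq μ fun x => avg (I N) fun n => star (l (q n)) * F n x) 𝒱 (nhds 0)) :
    ∫ x, f x * χ x ∂μ = 0 := by
  have h1 := (hf.lim χ h.b1).norm.pow 2
  have h2 := le_of_tendsto_of_tendsto h1 h0 (Eventually.of_forall fun N =>
    norm_avg_integral_eig_sq_le (I N) (hf.bH N) hf.bF h)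
  have h3 : ‖∫ x, f x * χ x ∂μ‖ ^ 2 = 0 := le_antisymm h2 (by positivity)
  simpa using h3

open Classical in
/-- Selection of eigenfunctions correlating with the cube derivatives of `f`. -/
theorem exists_eig_selection (hT : IsMPAction μ T) {us : List V} {u : V} (hu : InvConst μ T u)
    {Rs : List ℕ} (hl : us.length = Rs.length) (hne : (boxF Rs).Nonempty) {f : X → ℂ} (hf : B1 f)
    {δ : ℝ} (hδ : 0 < δ) (h : ∀ᶠ R in UF, δ ≤ boxAvg μ T (us ++ [u]) (Rs ++ [R]) f) :
    ∃ b ψ : List ℕ → X → ℂ, IsLow B1 Rs.length b ∧ (∀ l, B1 (b l)) ∧ (∀ l, EigOrZero μ T (ψ l)) ∧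
      δ ^ 2 / 12 ≤ ‖avg (boxF Rs) fun l => ∫ x, f (T (dotL l us) x) * (b l x * ψ l x) ∂μ‖ ∧
      ∀ l ∈ boxF Rs, ψ l ≠ 0 → δ / 6 ≤ ‖∫ x, f (T (dotL l us) x) * (b l x * ψ l x) ∂μ‖ := by
  set Φ : List ℕ → X → ℂ := fun t x => f (T (dotL t us) x) with hΦ
  have hΦ1 : ∀ t, B1 (Φ t) := fun t => hf.act hT _
  have hc1 : ∀ l l', B1 (cubeProd Φ l l') := fun l l' => cubeProd_mem starClosed_B1 hΦ1 l l'
  set good : List ℕ → List ℕ → Prop := fun l l' =>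
    ∀ᶠ R in UF, δ / 2 ≤ boxAvg μ T [u] [R] (cubeProd Φ l l') with hgood
  have hc : (0 : ℝ) < (boxF Rs).card := by exact_mod_cast hne.card_pos
  have hdens : δ / 2 ≤ ((boxF Rs).card : ℝ)⁻¹ * ((boxF Rs).card : ℝ)⁻¹ *
      ∑ l ∈ boxF Rs, ∑ l' ∈ boxF Rs, if good l l' then (1 : ℝ) else 0 := by
    have h1 : ∀ᶠ R in UF, ∀ l ∈ boxF Rs, ∀ l' ∈ boxF Rs, boxAvg μ T [u] [R] (cubeProd Φ l l') ≤
        (if good l l' then (1 : ℝ) else 0) + δ / 2 := by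
      rw [Filter.eventually_all_finset]
      intro l _
      rw [Filter.eventually_all_finset]
      intro l' _
      by_cases hg : good l l'
      · refine Eventually.of_forall fun R => ?_
        rw [if_pos hg]
        have := boxAvg_le_one hT [u] [R] (hc1 l l')
        linarith
      · rw [if_neg hg]
        rw [hgood] at hg
        have hg := Ultrafilter.eventually_not.2 hg
        filter_upwards [hg] with R hR
        linarith [not_le.1 hR]
    obtain ⟨R, hR, hR1⟩ := (h.and h1).exists
    rw [boxAvg_append hT us [u] Rs [R] hl] at hR
    have h2 : ∑ l ∈ boxF Rs, ∑ l' ∈ boxF Rs, boxAvg μ T [u] [R] (cubeProd Φ l l') ≤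
        ∑ l ∈ boxF Rs, ∑ l' ∈ boxF Rs, ((if good l l' then (1 : ℝ) else 0) + δ / 2) :=
      Finset.sum_le_sum fun l h => Finset.sum_le_sum fun l' h' => hR1 l h l' h'
    have h3 := hR.trans (mul_le_mul_of_nonneg_left h2 (by positivity))
    simp only [Finset.sum_add_distrib, Finset.sum_const, nsmul_eq_mul, mul_add] at h3
    have h4 : ((boxF Rs).card : ℝ)⁻¹ * ((boxF Rs).card : ℝ)⁻¹ *
        ((boxF Rs).card * ((boxF Rs).card * (δ / 2))) = δ / 2 := by field_simp
    linarith
  obtain ⟨l', hl', hdens⟩ := exists_le_sum_of_le_sum_sum hne hdens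
  obtain ⟨b, hblow, hb1, hb⟩ := exists_isLow starClosed_B1 hΦ1 l'
  have hlen : ∀ l ∈ boxF Rs, l.length = l'.length := fun l h => by
    rw [length_of_mem_boxF h, length_of_mem_boxF hl']
  have hsel : ∀ l, ∃ ψ : X → ℂ, EigOrZero μ T ψ ∧
      (δ / 6 * (if good l l' then (1 : ℝ) else 0) ≤ (∫ x, cubeProd Φ l l' x * ψ x ∂μ).re) ∧
      (ψ ≠ 0 → good l l') := by
    intro l
    by_cases hg : good l l'
    · obtain ⟨χ, Λ, hχ, hcor⟩ := exists_isEig_correlation hT hu (hc1 l l') (half_pos hδ) hg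
      set z := ∫ x, cubeProd Φ l l' x * (starRingEnd ℂ) (χ x) ∂μ with hz
      have hz0 : 0 < ‖z‖ := by linarith
      have hzc : (‖z‖ : ℂ) ≠ 0 := by exact_mod_cast hz0.ne'
      have hcn : ‖(starRingEnd ℂ) z * (‖z‖ : ℂ)⁻¹‖ = 1 := by
        rw [norm_mul, RCLike.norm_conj, norm_inv, Complex.norm_real, norm_norm]
        exact mul_inv_cancel₀ hz0.ne'
      refine ⟨_, Or.inr ⟨_, (IsEig.const hcn).mul hχ.conj⟩, ?_, fun _ => hg⟩
      have e1 : ∫ x, cubeProd Φ l l' x * ((starRingEnd ℂ) z * (‖z‖ : ℂ)⁻¹ *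
          (starRingEnd ℂ) (χ x)) ∂μ = ((‖z‖ : ℝ) : ℂ) := by
        calc _ = ∫ x, (starRingEnd ℂ) z * (‖z‖ : ℂ)⁻¹ *
              (cubeProd Φ l l' x * (starRingEnd ℂ) (χ x)) ∂μ :=
              integral_congr_ae (Eventually.of_forall fun x => by ring)
          _ = (starRingEnd ℂ) z * (‖z‖ : ℂ)⁻¹ * z := by rw [integral_const_mul]
          _ = _ := by
            have : (starRingEnd ℂ) z * z = (‖z‖ : ℂ) * ‖z‖ := by
              rw [mul_comm, Complex.mul_conj, Complex.normSq_eq_norm_sq]; push_cast; ring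
            calc _ = (starRingEnd ℂ) z * z * (‖z‖ : ℂ)⁻¹ := by ring
              _ = _ := by rw [this, mul_inv_cancel_right₀ hzc]
      rw [e1, if_pos hg, Complex.ofReal_re]
      linarith
    · refine ⟨0, Or.inl rfl, ?_, fun h => absurd rfl h⟩
      rw [if_neg hg]
      simp
  choose ψ hψ hψre hψ0 using hsel
  have h_int : ∀ l ∈ boxF Rs, ∫ x, f (T (dotL l us) x) * (b l x * ψ l x) ∂μ =
      ∫ x, cubeProd Φ l l' x * ψ l x ∂μ := fun l hl => by
    rw [hb l (hlen l hl)]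
    exact integral_congr_ae (Eventually.of_forall fun x => by
      simp only [Pi.mul_apply, hΦ]; ring)
  refine ⟨b, ψ, by rwa [← length_of_mem_boxF hl'], hb1, hψ, ?_, fun l hl h0 => ?_⟩
  · rw [avg_congr h_int]
    refine le_trans ?_ (Complex.re_le_norm _)
    rw [avg_re]
    calc δ ^ 2 / 12 = δ / 6 * (δ / 2) := by ring
      _ ≤ δ / 6 * (((boxF Rs).card : ℝ)⁻¹ * ∑ l ∈ boxF Rs, if good l l' then (1 : ℝ) else 0) := by
          gcongr
      _ = ((boxF Rs).card : ℝ)⁻¹ * ∑ l ∈ boxF Rs, δ / 6 * (if good l l' then (1 : ℝ) else 0) := by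
          rw [← Finset.mul_sum]; ring
      _ ≤ _ := by
          gcongr with l _
          exact hψre l
  · rw [h_int l hl]
    refine le_trans ?_ (Complex.re_le_norm _)
    have := hψre l
    rwa [if_pos (hψ0 l h0), mul_one] at this

end DualFunctions

section DualFunctions

variable {X V G : Type*} [MeasurableSpace X] [AddCommGroup V] {μ : Measure X}
  {T : V → X → X}

theorem cubeProd_dual_eq (hT : IsMPAction μ T) {ι : Type*} (J : Finset ι) {c : ℂ} (hc : ‖c‖ = 1)
    (f : ι → X → ℂ) (p : ι → V) (q : V) (H : X → ℂ) (ψ : List ℕ → X → ℂ) (us : List V)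
    {l l' : List ℕ} (hl : l.length = l'.length) (h0 : l ≠ []) :
    ∫ x, cubeProd (fun t x => H (T (dotL t us - q) x) *
      (starRingEnd ℂ) (c * ∏ j ∈ J, f j (T (p j) (T (dotL t us - q) x))) * ψ t x) l l' x ∂μ =
    ∫ x, cubeProd (fun t x => H (T (dotL t us) x)) l l' x *
      (starRingEnd ℂ) (∏ j ∈ J, cubeProd (fun t x => f j (T (dotL t us) x)) l l' (T (p j) x)) *
        cubeProd ψ l l' (T q x) ∂μ := by
  have hcc : (fun _ : X => c) * star (fun _ : X => c) = 1 := by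
    funext x
    change c * (starRingEnd ℂ) c = 1
    rw [Complex.mul_conj, Complex.normSq_eq_norm_sq, hc]
    simp
  set A : List ℕ → X → ℂ := fun t x => H (T (dotL t us) x) with hA
  set E : ι → List ℕ → X → ℂ := fun j t x => f j (T (dotL t us) x) with hE
  set P : List ℕ → X → ℂ := fun t => ∏ j ∈ J, fun x => E j t (T (p j) x) with hP
  have hA1 := cubeProd_comp (T (-q)) A l l'
  have hP1 := cubeProd_comp (T (-q)) P l l'
  have hP2 : cubeProd P l l' = ∏ j ∈ J, fun x => cubeProd (E j) l l' (T (p j) x) := by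
    rw [hP, cubeProd_prod J (fun j t x => E j t (T (p j) x))]
    exact Finset.prod_congr rfl fun j _ => cubeProd_comp (T (p j)) (E j) l l'
  have hP3 : cubeProd (fun t x => (starRingEnd ℂ) (c * P t (T (-q) x))) l l' =
      fun x => (starRingEnd ℂ) (cubeProd P l l' (T (-q) x)) := by
    rw [cubeProd_conj_fun (fun t x => c * P t (T (-q) x)),
      cubeProd_mul_fun (fun _ _ => c) (fun t x => P t (T (-q) x)), cubeProd_const hcc hl h0, hP1]
    simp only [Pi.one_apply, one_mul]
  have e1 : (fun (t : List ℕ) (x : X) => H (T (dotL t us - q) x) *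
      (starRingEnd ℂ) (c * ∏ j ∈ J, f j (T (p j) (T (dotL t us - q) x))) * ψ t x) =
      fun t x => A t (T (-q) x) * (starRingEnd ℂ) (c * P t (T (-q) x)) * ψ t x := by
    funext t x
    have e2 : ∀ j, p j + (dotL t us + -q) = dotL t us + p j + -q := fun j => by abel
    simp only [hA, hP, hE, Finset.prod_apply, hT.apply_add, sub_eq_add_neg, e2]
  rw [e1, cubeProd_mul_fun (fun t x => A t (T (-q) x) * (starRingEnd ℂ) (c * P t (T (-q) x))) ψ,
    cubeProd_mul_fun (fun t x => A t (T (-q) x)), hA1, hP3, hP2, ← hT.integral_comp q]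
  refine integral_congr_ae (Eventually.of_forall fun x => ?_)
  simp only [hT.apply_add, neg_add_cancel, hT.apply_zero, Finset.prod_apply]
  rfl

open Classical in
/-- Many of the cubes built from the selected eigenfunctions have trivial eigenvalues. -/
theorem trivial_density_le [IsProbabilityMeasure μ] (hT : IsMPAction μ T) {ι : Type*}
    {J : Finset ι} {f : ι → X → ℂ} (hf : ∀ j, B1 (f j)) {p : ι → G → V} {q : G → V} {c : G → ℂ}
    (hc : ∀ n, ‖c n‖ = 1) {I : ℕ → Finset G} {𝒱 : Ultrafilter ℕ} {H : ℕ → X → ℂ} {g : X → ℂ}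
    (hg : IsDualFun μ T I 𝒱 q H (fun n x => c n * ∏ j ∈ J, f j (T (p j n) x)) g)
    (hb : ∀ χ l, IsEig μ T χ l → l ≠ 1 → ∀ f' : ι → X → ℂ, (∀ j, B1 (f' j)) →
      Tendsto (fun N => nsq μ fun x => avg (I N) fun n =>
        star (l (q n)) * ∏ j ∈ J, f' j (T (p j n) x)) 𝒱 (nhds 0))
    {us : List V} {Rs : List ℕ} (hl : us.length = Rs.length) (hus : us ≠ [])
    (hne : (boxF Rs).Nonempty) {b ψ : List ℕ → X → ℂ} (hblow : IsLow B1 Rs.length b)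
    (hb1 : ∀ l, B1 (b l)) (hψ : ∀ l, EigOrZero μ T (ψ l)) {κ : ℝ} (hκ : 0 < κ)
    (h : κ ≤ ‖avg (boxF Rs) fun l => ∫ x, g (T (dotL l us) x) * (b l x * ψ l x) ∂μ‖) :
    (κ / 2) ^ 2 ^ Rs.length / 2 ≤ ((boxF Rs).card : ℝ)⁻¹ * ((boxF Rs).card : ℝ)⁻¹ *
      ∑ l ∈ boxF Rs, ∑ l' ∈ boxF Rs, if IsEig μ T (cubeProd ψ l l') 1 then (1 : ℝ) else 0 := by
  have hcard : (0 : ℝ) < (boxF Rs).card := by exact_mod_cast hne.card_pos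
  set Φ : ℕ → List ℕ → G → X → ℂ := fun N l n x => H N (T (dotL l us - q n) x) *
    (starRingEnd ℂ) (c n * ∏ j ∈ J, f j (T (p j n) (T (dotL l us - q n) x))) * ψ l x with hΦ
  have hΦ1 : ∀ N l n, B1 (Φ N l n) := fun N l n =>
    (((hg.bH N).act hT _).mul ((hg.bF n).act hT _).conj).mul (hψ l).b1
  have hlim : ∀ l, Tendsto (fun N => avg (I N) fun n => ∫ x, Φ N l n x * b l x ∂μ) 𝒱
      (nhds (∫ x, g (T (dotL l us) x) * (b l x * ψ l x) ∂μ)) := by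
    intro l
    have h1 := hg.lim (fun x => b l (T (-dotL l us) x) * ψ l (T (-dotL l us) x))
      (((hb1 l).act hT _).mul ((hψ l).b1.act hT _))
    have e1 : ∫ x, g x * (b l (T (-dotL l us) x) * ψ l (T (-dotL l us) x)) ∂μ =
        ∫ x, g (T (dotL l us) x) * (b l x * ψ l x) ∂μ := by
      rw [← hT.integral_comp (dotL l us)]
      simp only [hT.apply_add, neg_add_cancel, hT.apply_zero]
    rw [e1] at h1
    refine h1.congr fun N => avg_congr fun n _ => ?_
    rw [← hT.integral_comp (dotL l us - q n)]
    refine integral_congr_ae (Eventually.of_forall fun x => ?_)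
    have e2 : -dotL l us + (q n + (dotL l us - q n)) = 0 := by abel
    simp only [hΦ, hT.apply_add, e2, hT.apply_zero]
    ring
  have hlim2 : Tendsto (fun N => avg (boxF Rs) fun l => avg (I N) fun n =>
      ∫ x, Φ N l n x * b l x ∂μ) 𝒱
      (nhds (avg (boxF Rs) fun l => ∫ x, g (T (dotL l us) x) * (b l x * ψ l x) ∂μ)) :=
    (tendsto_finsetSum _ fun l _ => hlim l).const_mul _
  have hev1 := hlim2.norm.eventually_const_lt (lt_of_lt_of_le (half_lt_self hκ) h)
  set η : ℝ := (κ / 2) ^ 2 ^ Rs.length / 2 with hη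
  have hη0 : 0 < η := by positivity
  have hev2 : ∀ᶠ N in (𝒱 : Filter ℕ), ∀ l ∈ boxF Rs, ∀ l' ∈ boxF Rs,
      ‖avg (I N) fun n => ∫ x, cubeProd (Φ N) l l' n x ∂μ‖ ≤
        (if IsEig μ T (cubeProd ψ l l') 1 then (1 : ℝ) else 0) + η := by
    rw [Filter.eventually_all_finset]
    intro l hlm
    rw [Filter.eventually_all_finset]
    intro l' hlm'
    have hmem : ∀ N n, B1 (cubeProd (Φ N) l l' n) := fun N n =>
      cubeProd_mem starClosed_B1' (hΦ1 N) l l' n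
    by_cases htriv : IsEig μ T (cubeProd ψ l l') 1
    · refine Eventually.of_forall fun N => ?_
      rw [if_pos htriv]
      have := norm_avg_le (I N) zero_le_one fun n _ => (hmem N n).norm_integral_le (μ := μ)
      linarith
    rw [if_neg htriv, zero_add]
    have hlen : l.length = l'.length := by
      rw [length_of_mem_boxF hlm, length_of_mem_boxF hlm']
    have hl0 : l ≠ [] := by
      rintro rfl
      have := length_of_mem_boxF hlm
      rw [← hl] at this
      exact hus (List.length_eq_zero_iff.1 this.symm)
    have e1 : ∀ N n, ∫ x, cubeProd (Φ N) l l' n x ∂μ =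
        ∫ x, cubeProd (fun t x => H N (T (dotL t us) x)) l l' x * (starRingEnd ℂ)
          (∏ j ∈ J, cubeProd (fun t x => f j (T (dotL t us) x)) l l' (T (p j n) x)) *
            cubeProd ψ l l' (T (q n) x) ∂μ := fun N n => by
      rw [cubeProd_apply, ← cubeProd_dual_eq hT J (hc n) f (fun j => p j n) (q n) (H N) ψ us hlen hl0]
    simp only [e1]
    rcases cubeProd_mem starClosed_eigOrZero hψ l l' with h0 | ⟨Λ, hΛ⟩
    · refine Eventually.of_forall fun N => ?_
      simp only [h0, Pi.zero_apply, mul_zero, integral_zero, avg, Finset.sum_const_zero, norm_zero]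
      exact hη0.le
    · have hΛ1 : Λ ≠ 1 := fun h => htriv (h ▸ hΛ)
      have hB : ∀ j, B1 (cubeProd (fun t x => f j (T (dotL t us) x)) l l') := fun j =>
        cubeProd_mem starClosed_B1 (fun t => (hf j).act hT _) l l'
      have hH : ∀ N, B1 (cubeProd (fun t x => H N (T (dotL t us) x)) l l') := fun N =>
        cubeProd_mem starClosed_B1 (fun t => (hg.bH N).act hT _) l l'
      have hz := hb _ _ hΛ hΛ1 (fun j => cubeProd (fun t x => f j (T (dotL t us) x)) l l') hB
      filter_upwards [hz.eventually_le_const (pow_pos hη0 2)] with N hN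
      have hle := norm_avg_integral_eig_sq_le (I N) (q := q) (hH N)
        (fun n => B1.prod J fun j _ => (hB j).act hT (p j n)) hΛ
      exact (pow_le_pow_iff_left₀ (norm_nonneg _) hη0.le two_ne_zero).1 (hle.trans hN)
  obtain ⟨N, hN1, hN2⟩ := (hev1.and hev2).exists
  have hgcs := gowersCauchySchwarz (μ := μ) (I N) Rs (hΦ1 N) (b := fun l _ => b l)
    (fun l _ => hb1 l) (hblow.map (fun a (_ : G) => a) rfl (fun _ _ => rfl) fun _ h _ => h)
  have h1 : (κ / 2) ^ 2 ^ Rs.length ≤ _ :=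
    (pow_le_pow_left₀ (by positivity) hN1.le _).trans hgcs
  have h2 := h1.trans (mul_le_mul_of_nonneg_left
    (Finset.sum_le_sum fun l h => Finset.sum_le_sum fun l' h' => hN2 l h l' h') (by positivity))
  simp only [Finset.sum_add_distrib, Finset.sum_const, nsmul_eq_mul, mul_add] at h2
  have h4 : ((boxF Rs).card : ℝ)⁻¹ * ((boxF Rs).card : ℝ)⁻¹ *
      ((boxF Rs).card * ((boxF Rs).card * η)) = η := by field_simp
  rw [h4] at h2
  have h5 : (κ / 2) ^ 2 ^ Rs.length = 2 * η := by rw [hη]; ring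
  linarith

end DualFunctions

section DegreeLowering

variable {X V G : Type*} [MeasurableSpace X] [AddCommGroup V] {μ : Measure X}
  [IsProbabilityMeasure μ] {T : V → X → X}

theorem boxAvg_eq_sum_cubeProd (hT : IsMPAction μ T) (us : List V) (Rs : List ℕ)
    (hl : us.length = Rs.length) (f : X → ℂ) :
    boxAvg μ T us Rs f = ((boxF Rs).card : ℝ)⁻¹ * ((boxF Rs).card : ℝ)⁻¹ *
      ∑ l ∈ boxF Rs, ∑ l' ∈ boxF Rs,
        ‖∫ x, cubeProd (fun t x => f (T (dotL t us) x)) l l' x ∂μ‖ ^ 2 := by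
  have := boxAvg_append hT us [] Rs [] hl f
  simpa only [List.append_nil, boxAvg] using this

theorem lowered_le_boxAvg (hT : IsMPAction μ T) {ι : Type*}
    {J : Finset ι} {f : ι → X → ℂ} (hf : ∀ j, B1 (f j)) {p : ι → G → V} {q : G → V} {c : G → ℂ}
    (hc : ∀ n, ‖c n‖ = 1) {I : ℕ → Finset G} {𝒱 : Ultrafilter ℕ} {H : ℕ → X → ℂ} {g : X → ℂ}
    (hg : IsDualFun μ T I 𝒱 q H (fun n x => c n * ∏ j ∈ J, f j (T (p j n) x)) g)
    (hb : ∀ χ l, IsEig μ T χ l → l ≠ 1 → ∀ f' : ι → X → ℂ, (∀ j, B1 (f' j)) →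
      Tendsto (fun N => nsq μ fun x => avg (I N) fun n =>
        star (l (q n)) * ∏ j ∈ J, f' j (T (p j n) x)) 𝒱 (nhds 0))
    {us : List V} {u : V} (hu : InvConst μ T u) {Rs : List ℕ} (hl : us.length = Rs.length)
    (hus : us ≠ []) (hne : (boxF Rs).Nonempty) {δ : ℝ} (hδ : 0 < δ)
    (h : ∀ᶠ R in UF, δ ≤ boxAvg μ T (us ++ [u]) (Rs ++ [R]) g) :
    ((δ / 6) ^ 2 * ((δ ^ 2 / 12 / 2) ^ 2 ^ us.length / 2)) ^ 2 ^ us.length ≤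
      boxAvg μ T us Rs g := by
  classical
  have hcard : (0 : ℝ) < (boxF Rs).card := by exact_mod_cast hne.card_pos
  obtain ⟨b, ψ, hblow, hb1, hψ, hcor, hcor'⟩ := exists_eig_selection hT hu hl hne hg.b1 hδ h
  have hd := trivial_density_le hT hf hc hg hb hl hus hne hblow hb1 hψ (by positivity) hcor
  obtain ⟨l', hl', hd⟩ := exists_le_sum_of_le_sum_sum hne hd
  rw [hl]
  set η : ℝ := (δ ^ 2 / 12 / 2) ^ 2 ^ Rs.length / 2
  obtain ⟨w, hwlow, hwE, hw⟩ := exists_isLow starClosed_eigOrZero hψ l'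
  rw [length_of_mem_boxF hl'] at hwlow
  have hw1 : ∀ l, B1 (w l) := fun l => (hwE l).b1
  have hlow : IsLow B1 Rs.length fun l => b l * star (w l) :=
    hblow.mul starClosed_B1 ((hwlow.map (q := B1) id rfl (fun _ _ => rfl) fun _ h => h.b1).star
      starClosed_B1)
  have hmain := pow_sum_norm_integral_le (μ := μ) Rs (Φ := fun l x => g (T (dotL l us) x))
    (fun l => hg.b1.act hT _) (fun l => (hb1 l).mul (hw1 l).conj) hlow
  rw [boxAvg_eq_sum_cubeProd hT us Rs hl]
  refine le_trans ?_ hmain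
  have hη0 : 0 ≤ η := by positivity
  refine pow_le_pow_left₀ (by positivity) ?_ _
  calc (δ / 6) ^ 2 * η ≤ (δ / 6) ^ 2 * (((boxF Rs).card : ℝ)⁻¹ *
        ∑ l ∈ boxF Rs, if IsEig μ T (cubeProd ψ l l') 1 then (1 : ℝ) else 0) := by gcongr
    _ = ((boxF Rs).card : ℝ)⁻¹ * ∑ l ∈ boxF Rs,
        (δ / 6) ^ 2 * (if IsEig μ T (cubeProd ψ l l') 1 then (1 : ℝ) else 0) := by
        rw [← Finset.mul_sum]; ring
    _ ≤ _ := by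
        gcongr with l hlm
        split_ifs with ht
        · rw [mul_one]
          gcongr
          have hlen : l.length = l'.length := by
            rw [length_of_mem_boxF hlm, length_of_mem_boxF hl']
          rw [hw l hlen] at ht
          have hn : ∀ x, ‖ψ l x‖ * ‖w l x‖ = 1 := fun x => by
            rw [← norm_mul]; exact ht.2.1 x
          have hwn : ∀ x, ‖w l x‖ = 1 := fun x => by
            refine le_antisymm ((hw1 l).2 x) ?_
            rw [← hn x]
            exact mul_le_of_le_one_left (norm_nonneg _) ((hψ l).b1.2 x)
          obtain ⟨θ, hθ, hθe⟩ := ht.ae_const hu rfl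
          have h0 : ψ l ≠ 0 := by
            intro h0
            obtain ⟨x, _⟩ := hθe.exists
            have := hn x
            rw [h0] at this
            simp at this
          refine (hcor' l hlm h0).trans (le_of_eq ?_)
          have e1 : ∫ x, g (T (dotL l us) x) * (b l x * ψ l x) ∂μ =
              θ * ∫ x, g (T (dotL l us) x) * (b l x * star (w l) x) ∂μ := by
            rw [← integral_const_mul]
            refine integral_congr_ae ?_
            filter_upwards [hθe] with x hx
            have e2 : w l x * star (w l) x = 1 := by
              rw [Pi.star_apply, RCLike.star_def, Complex.mul_conj, Complex.normSq_eq_norm_sq, hwn]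
              simp
            rw [Pi.mul_apply] at hx
            rw [← hx]
            linear_combination (-(g (T (dotL l us) x) * b l x * ψ l x)) * e2
          rw [e1, norm_mul, hθ, one_mul]
          rfl
        · rw [mul_zero]; positivity

/-- Dual functions whose coefficients do not correlate with eigenfunctions are small. -/
theorem isSmall_of_isDualFun (hT : IsMPAction μ T) {ι : Type*}
    {J : Finset ι} {f : ι → X → ℂ} (hf : ∀ j, B1 (f j)) {p : ι → G → V} {q : G → V} {c : G → ℂ}
    (hc : ∀ n, ‖c n‖ = 1) {I : ℕ → Finset G} {𝒱 : Ultrafilter ℕ} {H : ℕ → X → ℂ} {g : X → ℂ}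
    (hg : IsDualFun μ T I 𝒱 q H (fun n x => c n * ∏ j ∈ J, f j (T (p j n) x)) g)
    (ha : ∀ χ l, IsEig μ T χ l → Tendsto (fun N => nsq μ fun x => avg (I N) fun n =>
        star (l (q n)) * (c n * ∏ j ∈ J, f j (T (p j n) x))) 𝒱 (nhds 0))
    (hb : ∀ χ l, IsEig μ T χ l → l ≠ 1 → ∀ f' : ι → X → ℂ, (∀ j, B1 (f' j)) →
      Tendsto (fun N => nsq μ fun x => avg (I N) fun n =>
        star (l (q n)) * ∏ j ∈ J, f' j (T (p j n) x)) 𝒱 (nhds 0))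
    {us : List V} (hu : ∀ u ∈ us, InvConst μ T u) {δ : ℝ} (hδ : 0 < δ) : IsSmall μ T us g δ := by
  have horth : ∀ χ l, IsEig μ T χ l → ∫ x, g x * χ x ∂μ = 0 := fun χ l h =>
    hg.integral_eig h (ha χ l h)
  induction us using List.reverseRecOn generalizing δ with
  | nil =>
    rw [IsSmall, List.length_nil, eventually_GU_zero, boxAvg]
    have := horth _ _ (IsEig.const (c := 1) (by simp))
    simp only [mul_one] at this
    rw [this]
    simpa using hδ.le
  | append_singleton us u ih =>
    have huu : InvConst μ T u := hu u (by simp)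
    have ih := fun δ (hδ : 0 < δ) => ih (fun v hv => hu v (by simp [hv])) (δ := δ) hδ
    by_contra hcon
    rw [IsSmall, ← Ultrafilter.eventually_not, List.length_append, List.length_singleton,
      eventually_GU_append] at hcon
    rcases eq_or_ne us [] with rfl | hus
    · rw [List.length_nil, eventually_GU_zero] at hcon
      simp only [List.nil_append, not_le] at hcon
      obtain ⟨χ, l, hχ, hle⟩ := exists_isEig_correlation hT huu hg.b1 hδ
        (hcon.mono fun _ h => h.le)
      rw [horth _ _ hχ.conj, norm_zero] at hle
      linarith
    · set δ' : ℝ := ((δ / 6) ^ 2 * ((δ ^ 2 / 12 / 2) ^ 2 ^ us.length / 2)) ^ 2 ^ us.length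
      have hδ' : 0 < δ' := by positivity
      obtain ⟨Rs, ⟨h1, h2, h3⟩, h4⟩ :=
        ((hcon.and (eventually_GU_length us.length)).and (ih _ (half_pos hδ'))).exists
      have h5 := lowered_le_boxAvg hT hf hc hg hb huu h2.symm hus h3 hδ
        (h1.mono fun _ h => (not_le.1 h).le)
      have h6 : δ' ≤ δ' / 2 := h5.trans h4
      linarith

end DegreeLowering

section DegreeLowering

variable {X V G : Type*} [MeasurableSpace X] [AddCommGroup V] {μ : Measure X}
  [IsProbabilityMeasure μ] {T : V → X → X}

theorem integral_mul_conj_self (f : X → ℂ) :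
    ∫ x, f x * (starRingEnd ℂ) (f x) ∂μ = ((nsq μ f : ℝ) : ℂ) := by
  rw [nsq, ← integral_complex_ofReal]
  refine integral_congr_ae (Eventually.of_forall fun x => ?_)
  simp only [Complex.mul_conj, Complex.normSq_eq_norm_sq]

/-- Degree lowering: averages controlled by box averages in ergodic directions vanish as soon as
their coefficients do not correlate with eigenfunctions along the controlled iterate. -/
theorem tendsto_nsq_of_ctrl (hT : IsMPAction μ T) {ι : Type*}
    {J : Finset ι} {f : ι → X → ℂ} (hf : ∀ j, B1 (f j)) {p : ι → G → V} {q : G → V} {c : G → ℂ}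
    (hc : ∀ n, ‖c n‖ = 1) {I : ℕ → Finset G} {us : List V} (hu : ∀ u ∈ us, InvConst μ T u)
    (hctrl : ∀ ε : ℝ, 0 < ε → ∃ δ : ℝ, 0 < δ ∧ ∀ g : X → ℂ, B1 g → IsSmall μ T us g δ →
      ∀ᶠ N in atTop, nsq μ (fun x => avg (I N) fun n =>
        c n * (∏ j ∈ J, f j (T (p j n) x)) * g (T (q n) x)) ≤ ε)
    (ha : ∀ χ l, IsEig μ T χ l → Tendsto (fun N => nsq μ fun x => avg (I N) fun n =>
        star (l (q n)) * (c n * ∏ j ∈ J, f j (T (p j n) x))) atTop (nhds 0))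
    (hb : ∀ χ l, IsEig μ T χ l → l ≠ 1 → ∀ f' : ι → X → ℂ, (∀ j, B1 (f' j)) →
      Tendsto (fun N => nsq μ fun x => avg (I N) fun n =>
        star (l (q n)) * ∏ j ∈ J, f' j (T (p j n) x)) atTop (nhds 0))
    {g₀ : X → ℂ} (hg₀ : B1 g₀) :
    Tendsto (fun N => nsq μ fun x => avg (I N) fun n =>
        c n * (∏ j ∈ J, f j (T (p j n) x)) * g₀ (T (q n) x)) atTop (nhds 0) := by
  set F : G → X → ℂ := fun n x => c n * ∏ j ∈ J, f j (T (p j n) x) with hF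
  have hF1 : ∀ n, B1 (F n) := fun n =>
    (B1.const (hc n).le).mul (B1.prod J fun j _ => (hf j).act hT (p j n))
  set A : (X → ℂ) → ℕ → X → ℂ := fun g N x => avg (I N) fun n => F n x * g (T (q n) x) with hA
  have hA1 : ∀ {g}, B1 g → ∀ N, B1 (A g N) := fun hg N =>
    B1.avg (I N) fun n => (hF1 n).mul (hg.act hT (q n))
  change Tendsto (fun N => nsq μ (A g₀ N)) atTop (nhds 0)
  by_contra hcon
  obtain ⟨ε, hε, hfreq⟩ : ∃ ε : ℝ, 0 < ε ∧ ∃ᶠ N in atTop, ε < nsq μ (A g₀ N) := by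
    by_contra h
    push Not at h
    refine hcon (tendsto_order.2 ⟨fun a ha => Eventually.of_forall fun N =>
      ha.trans_le (nsq_nonneg _), fun a ha => ?_⟩)
    have := h (a / 2) (half_pos ha)
    filter_upwards [this] with N hN
    linarith
  have hne : (atTop ⊓ 𝓟 {N | ε < nsq μ (A g₀ N)}).NeBot := frequently_mem_iff_neBot.1 hfreq
  set 𝒱 : Ultrafilter ℕ := Ultrafilter.of (atTop ⊓ 𝓟 {N | ε < nsq μ (A g₀ N)}) with h𝒱
  have hV := Ultrafilter.of_le (atTop ⊓ 𝓟 {N | ε < nsq μ (A g₀ N)})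
  have hVtop : (𝒱 : Filter ℕ) ≤ atTop := hV.trans inf_le_left
  have hVε : ∀ᶠ N in (𝒱 : Filter ℕ), ε < nsq μ (A g₀ N) :=
    (hV.trans inf_le_right) (mem_principal_self _)
  set D : ℕ → X → ℂ := fun N x => avg (I N) fun n =>
    A g₀ N (T (-q n) x) * (starRingEnd ℂ) (F n (T (-q n) x)) with hD
  have hD1 : ∀ N, B1 (D N) := fun N => B1.avg (I N) fun n =>
    ((hA1 hg₀ N).act hT _).mul ((hF1 n).act hT _).conj
  obtain ⟨g, hg, hlim⟩ := exists_weak_ulim (μ := μ) D hD1 𝒱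
  have hDb : ∀ N b, B1 b → ∫ x, D N x * b x ∂μ = avg (I N) fun n =>
      ∫ x, A g₀ N x * (starRingEnd ℂ) (F n x) * b (T (q n) x) ∂μ := by
    intro N b hb
    simp only [hD, ← avg_mul_right]
    rw [integral_avg (I N) fun n =>
      ((((hA1 hg₀ N).act hT _).mul ((hF1 n).act hT _).conj).mul hb).integrable]
    refine avg_congr fun n _ => ?_
    rw [← hT.integral_comp (q n)]
    simp only [hT.apply_add, neg_add_cancel, hT.apply_zero]
  have hDA : ∀ N b, B1 b → ∫ x, D N x * (starRingEnd ℂ) (b x) ∂μ =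
      ∫ x, (starRingEnd ℂ) (A b N x) * A g₀ N x ∂μ := by
    intro N b hb
    rw [hDb N _ hb.conj]
    have hH := hA1 hg₀ N
    generalize A g₀ N = H at hH ⊢
    simp only [hA, ← avg_conj, ← avg_mul_right]
    rw [integral_avg (I N) fun n =>
      (B1.mul (B1.conj ((hF1 n).mul (hb.act hT _))) hH).integrable]
    refine avg_congr fun n _ => integral_congr_ae (Eventually.of_forall fun x => ?_)
    simp only [map_mul]
    ring
  have hdual : IsDualFun μ T I 𝒱 q (A g₀) F g :=
    ⟨hg, hA1 hg₀, hF1, fun b hb => (hlim b hb).congr fun N => hDb N b hb⟩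
  have h1 : ε ≤ ‖∫ x, g x * (starRingEnd ℂ) (g₀ x) ∂μ‖ := by
    refine ge_of_tendsto (hlim _ hg₀.conj).norm ?_
    filter_upwards [hVε] with N hN
    rw [hDA N _ hg₀]
    simp only [mul_comm ((starRingEnd ℂ) _)]
    rw [integral_mul_conj_self, Complex.norm_real, Real.norm_of_nonneg (nsq_nonneg _)]
    exact hN.le
  have h2 : ε ^ 2 ≤ nsq μ g :=
    (pow_le_pow_left₀ hε.le h1 2).trans (norm_integral_sq_le_nsq hg hg₀.conj)
  have h3 : ∀ᶠ N in (𝒱 : Filter ℕ), (ε ^ 2 / 2) ^ 2 ≤ nsq μ (A g N) := by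
    have h4 := (hlim _ hg.conj).norm
    rw [integral_mul_conj_self, Complex.norm_real, Real.norm_of_nonneg (nsq_nonneg _)] at h4
    have h5 : ε ^ 2 / 2 < nsq μ g := by
      have : 0 < ε ^ 2 := by positivity
      linarith
    filter_upwards [h4.eventually_const_lt h5] with N hN
    rw [hDA N _ hg] at hN
    have h6 := norm_integral_sq_le_nsq (μ := μ) (hA1 hg N).conj (hA1 hg₀ N)
    have h7 : nsq μ (fun x => (starRingEnd ℂ) (A g N x)) = nsq μ (A g N) := by
      simp only [nsq, RCLike.norm_conj]
    rw [h7] at h6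
    exact (pow_le_pow_left₀ (by positivity) hN.le 2).trans h6
  obtain ⟨δ, hδ, hδc⟩ := hctrl ((ε ^ 2 / 2) ^ 2 / 2) (by positivity)
  have hsmall := isSmall_of_isDualFun hT hf hc hdual (fun χ l h => (ha χ l h).mono_left hVtop)
    (fun χ l h hl f' hf' => (hb χ l h hl f' hf').mono_left hVtop) hu hδ
  obtain ⟨N, h8, h9⟩ := (h3.and (hVtop (hδc g hg hsmall))).exists
  have h10 : (ε ^ 2 / 2) ^ 2 ≤ (ε ^ 2 / 2) ^ 2 / 2 := h8.trans h9
  have : 0 < (ε ^ 2 / 2) ^ 2 := by positivity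
  linarith

end DegreeLowering

section InitialShape

/-- Every nonzero integer vector is a multiple of a primitive vector. -/
theorem exists_primitive {d : ℕ} {v : Fin d → ℤ} (hv : v ≠ 0) :
    ∃ (u : Fin d → ℤ) (k : ℤ), k ≠ 0 ∧ v = k • u ∧
      ∀ (x : Fin d → ℤ) (b c : ℤ), b ≠ 0 → b • x = c • u → ∃ r : ℤ, x = r • u := by
  obtain ⟨i₀, hi₀⟩ : ∃ i, v i ≠ 0 := by
    by_contra! h
    exact hv (funext h)
  obtain ⟨u, hu, hu1⟩ := Finset.extract_gcd v (s := Finset.univ) ⟨i₀, mem_univ _⟩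
  refine ⟨u, Finset.univ.gcd v, ?_, funext fun i => hu i (mem_univ _), fun x b c hb h => ?_⟩
  · intro h0
    exact hi₀ (Finset.gcd_eq_zero_iff.1 h0 i₀ (mem_univ _))
  · have h1 : b ∣ Finset.univ.gcd fun i => c * u i := by
      refine Finset.dvd_gcd fun i _ => ⟨x i, ?_⟩
      have := congrFun h i
      simpa using this.symm
    rw [Finset.gcd_mul_left, hu1, mul_one] at h1
    obtain ⟨r, hr⟩ := (dvd_normalize_iff).1 h1
    refine ⟨r, ?_⟩
    funext i
    have := congrFun h i
    simp only [Pi.smul_apply, smul_eq_mul, hr, mul_assoc] at this ⊢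
    exact mul_left_cancel₀ hb this

variable {L : ℕ}

theorem RepresentedBy₁.cast_eq {r : (Fin L → ℤ) → ℤ} {R : MvPolynomial (Fin L) ℚ}
    (h : RepresentedBy₁ r R) : (fun n => Int.castAddHom ℚ (r n)) = evalInt R := funext fun n => h n

theorem RepresentedBy₁.degLT {r : (Fin L → ℤ) → ℤ} {R : MvPolynomial (Fin L) ℚ}
    (h : RepresentedBy₁ r R) {e : ℕ} (he : R.totalDegree < e) : DegLT e r := by
  refine DegLT.of_map (Int.castAddHom ℚ) Int.cast_injective ?_
  rw [h.cast_eq]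
  refine degLT_evalInt fun s hs => ?_
  exact (MvPolynomial.le_totalDegree hs).trans_lt he

theorem RepresentedBy₁.exists_hasLead {r : (Fin L → ℤ) → ℤ} {R : MvPolynomial (Fin L) ℚ}
    (h : RepresentedBy₁ r R) {η : Fin L → ℤ}
    (hη : evalInt (R.homogeneousComponent R.totalDegree) η ≠ 0) :
    ∃ c : ℤ, c ≠ 0 ∧ HasLead η R.totalDegree c r := by
  have h1 := (hasLead_evalInt R η).2
  rw [← h.cast_eq] at h1
  obtain ⟨c, hc, h2⟩ := LeadAlong.exists_of_map (Int.castAddHom ℚ) Int.cast_injective h1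
  refine ⟨c, ?_, h.degLT (Nat.lt_succ_self _), h2⟩
  rintro rfl
  rw [map_zero] at hc
  refine mul_ne_zero ?_ hη hc.symm
  exact_mod_cast R.totalDegree.factorial_ne_zero

theorem RepresentedBy₁.totalDegree_pos {r : (Fin L → ℤ) → ℤ} {R : MvPolynomial (Fin L) ℚ}
    (h : RepresentedBy₁ r R) {n m : Fin L → ℤ} (hnm : r n ≠ r m) : 1 ≤ R.totalDegree := by
  by_contra! h0
  exact hnm ((h.degLT h0).eq_of_one n m)

theorem RepresentedBy₁.ne_zero {r : (Fin L → ℤ) → ℤ} {R : MvPolynomial (Fin L) ℚ}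
    (h : RepresentedBy₁ r R) {n m : Fin L → ℤ} (hnm : r n ≠ r m) : R ≠ 0 := by
  rintro rfl
  have := h.totalDegree_pos hnm
  simp at this

theorem HasLead.smul {V : Type*} [AddCommGroup V] {η : Fin L → ℤ} {e : ℕ} {c : ℤ}
    {r : (Fin L → ℤ) → ℤ} (h : HasLead η e c r) (u : V) : HasLead η e (c • u) fun n => r n • u := by
  simpa using h.map (zmultiplesHom V u)

theorem DegLT.smul {V : Type*} [AddCommGroup V] {e : ℕ}
    {r : (Fin L → ℤ) → ℤ} (h : DegLT e r) (u : V) : DegLT e fun n => r n • u := by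
  simpa using h.map (zmultiplesHom V u)

/-- The kind of the point `P j • v j` relative to `P m • v m` for polynomials that are dependent
in the sense of the main theorem. -/
theorem exists_pointKind {d : ℕ} {Pm Pj : (Fin L → ℤ) → ℤ} {Qm Qj : MvPolynomial (Fin L) ℚ}
    (hm : RepresentedBy₁ Pm Qm) (hj : RepresentedBy₁ Pj Qj) {vm vj u : Fin d → ℤ} {k : ℤ}
    (hk : k ≠ 0) (hvm : vm = k • u)
    (hu : ∀ (x : Fin d → ℤ) (b c : ℤ), b ≠ 0 → b • x = c • u → ∃ r : ℤ, x = r • u)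
    (hncm : ∃ n n', Pm n • vm ≠ Pm n' • vm) (hncj : ∃ n n', Pj n • vj ≠ Pj n' • vj)
    (hed : ∃ n n', Pm n • vm - Pj n • vj ≠ Pm n' • vm - Pj n' • vj)
    (hle : Qj.totalDegree ≤ Qm.totalDegree)
    (hdep : Qj.totalDegree = Qm.totalDegree →
      (∃ a b : ℤ, (a, b) ≠ (0, 0) ∧ a • vm + b • vj = 0) ∨
      (∃ a b : ℤ, (a, b) ≠ (0, 0) ∧ ∀ n n', a * Pm n + b * Pj n = a * Pm n' + b * Pj n')) :
    ∃ (kind : PointKind (Fin d → ℤ)) (R : MvPolynomial (Fin L) ℚ), R ≠ 0 ∧ kind ≠ .none ∧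
      (∀ w, kind = .top w → w = u ∨ (Qj.totalDegree = Qm.totalDegree ∧
        ∀ n, ∃ r : ℤ, (Pm n • vm - Pj n • vj) - (Pm 0 • vm - Pj 0 • vj) = r • w)) ∧
      ∀ η : Fin L → ℤ, evalInt (Qm.homogeneousComponent Qm.totalDegree) η ≠ 0 →
        evalInt R η ≠ 0 → ∃ c : ℤ, c ≠ 0 ∧
          PointOK η Qm.totalDegree Qm.totalDegree u (fun n => Pm n • vm) kind c
            (fun n => Pm n • vm - Pj n • vj) := by
  obtain ⟨m₁, m₂, hm12⟩ := hncm
  obtain ⟨j₁, j₂, hj12⟩ := hncj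
  have hPm : Pm m₁ ≠ Pm m₂ := fun h => hm12 (by rw [h])
  have hPj : Pj j₁ ≠ Pj j₂ := fun h => hj12 (by rw [h])
  have hvm0 : vm ≠ 0 := by rintro rfl; simp at hm12
  have hvj0 : vj ≠ 0 := by rintro rfl; simp at hj12
  rcases hle.lt_or_eq with hlt | heq
  · refine ⟨.low Qj.totalDegree, 1, one_ne_zero, by simp, by simp, fun η hη _ => ?_⟩
    obtain ⟨c, hc, hlead⟩ := hm.exists_hasLead hη
    refine ⟨c * k, mul_ne_zero hc hk, hj.totalDegree_pos hPj, ?_, ?_⟩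
    · have := (hlead.smul vm).sub_degLT ((hj.degLT hlt).smul vj)
      rwa [hvm, ← mul_smul, ← hvm] at this
    · simpa using (hj.degLT (Nat.lt_succ_self _)).smul vj
  · rcases hdep heq with ⟨a, b, hab, h⟩ | ⟨a, b, hab, h⟩
    · have hb : b ≠ 0 := by
        rintro rfl
        simp only [zero_smul, add_zero, smul_eq_zero, hvm0, or_false] at h
        exact hab (by rw [h])
      obtain ⟨l, hl⟩ := hu vj b (-(a * k)) hb (by
        rw [neg_smul, mul_smul, ← hvm]; exact eq_neg_of_add_eq_zero_right h)
      set r : (Fin L → ℤ) → ℤ := fun n => k * Pm n - l * Pj n with hr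
      set R : MvPolynomial (Fin L) ℚ := MvPolynomial.C (k : ℚ) * Qm - MvPolynomial.C (l : ℚ) * Qj
      have hrR : RepresentedBy₁ r R := by
        intro n
        simp only [hr, R, map_sub, map_mul, MvPolynomial.eval_C, Int.cast_sub, Int.cast_mul, hm n,
          hj n]
      have hD : ∀ n, Pm n • vm - Pj n • vj = r n • u := by
        intro n
        rw [hvm, hl, ← mul_smul, ← mul_smul, ← sub_smul]
        congr 1
        simp only [hr]; ring
      have hrn : ∃ n n', r n ≠ r n' := by
        obtain ⟨n, n', hn⟩ := hed
        exact ⟨n, n', fun h => hn (by rw [hD, hD, h])⟩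
      obtain ⟨n, n', hn⟩ := hrn
      have hRle : R.totalDegree ≤ Qm.totalDegree := by
        refine (MvPolynomial.totalDegree_sub _ _).trans (max_le ?_ ?_)
        · refine (MvPolynomial.totalDegree_mul _ _).trans ?_
          rw [MvPolynomial.totalDegree_C, zero_add]
        · refine (MvPolynomial.totalDegree_mul _ _).trans ?_
          rw [MvPolynomial.totalDegree_C, zero_add, heq]
      refine ⟨if R.totalDegree = Qm.totalDegree then .top u else .par R.totalDegree,
        R.homogeneousComponent R.totalDegree,
        homogeneousComponent_totalDegree_ne_zero (hrR.ne_zero hn), ?_, ?_, fun η _ hη => ?_⟩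
      · split <;> simp
      · intro w hw
        split at hw
        · simp only [PointKind.top.injEq] at hw
          exact Or.inl hw.symm
        · simp at hw
      · obtain ⟨c, hc, hlead⟩ := hrR.exists_hasLead hη
        refine ⟨c, hc, ?_⟩
        rw [show (fun n => Pm n • vm - Pj n • vj) = fun n => r n • u from funext hD]
        split_ifs with hif
        · refine ⟨le_rfl, ?_⟩
          rw [← hif]
          exact hlead.smul u
        · exact ⟨hrR.totalDegree_pos hn, lt_of_le_of_ne hRle hif, hlead.smul u⟩
    · have hb : b ≠ 0 := by
        rintro rfl
        have h1 := h m₁ m₂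
        simp only [zero_mul, add_zero] at h1
        by_cases ha : a = 0
        · exact hab (by rw [ha])
        · exact hPm (mul_left_cancel₀ ha h1)
      have hDb : ∀ n n', b • ((Pm n • vm - Pj n • vj) - (Pm n' • vm - Pj n' • vj)) =
          (Pm n - Pm n') • (b • vm + a • vj) := by
        intro n n'
        have h1 := h n n'
        have h2 : b * (Pj n - Pj n') = - (a * (Pm n - Pm n')) := by linarith
        have h3 := congrArg (· • vj) h2
        funext t
        have h4 := congrFun h3 t
        simp only [Pi.smul_apply, smul_eq_mul, Pi.sub_apply, Pi.add_apply] at h4 ⊢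
        linear_combination -h4
      have hw0 : b • vm + a • vj ≠ 0 := by
        intro h0
        obtain ⟨n, n', hn⟩ := hed
        have h1 := hDb n n'
        rw [h0, smul_zero, smul_eq_zero] at h1
        exact hn (sub_eq_zero.1 (h1.resolve_left hb))
      obtain ⟨w, l, hl0, hl, hw⟩ := exists_primitive hw0
      have hex : ∀ n, ∃ r : ℤ,
          (Pm n • vm - Pj n • vj) - (Pm 0 • vm - Pj 0 • vj) = r • w := by
        intro n
        refine hw _ b ((Pm n - Pm 0) * l) hb ?_
        rw [hDb, mul_smul, ← hl]
      have hwne : w ≠ 0 := by rintro rfl; simp at hl; exact hw0 hl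
      refine ⟨.top w, 1, one_ne_zero, by simp, ?_, fun η hη _ => ?_⟩
      · intro w' hw'
        simp only [PointKind.top.injEq] at hw'
        subst hw'
        exact Or.inr ⟨heq, hex⟩
      · choose r hr using hex
        have hbr : ∀ n, b * r n = l * (Pm n - Pm 0) := by
          intro n
          have h1 := hDb n 0
          rw [hr, hl, ← mul_smul, ← mul_smul] at h1
          have := smul_left_injective ℤ hwne h1
          rw [this, mul_comm]
        obtain ⟨c, hc, hlead⟩ := hm.exists_hasLead hη
        have h1 : HasLead η Qm.totalDegree (l * c) fun n => b * r n := by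
          have h2 := (hlead.sub_degLT
            (degLT_const (Pm 0) (hm.totalDegree_pos hPm))).map (AddMonoidHom.mulLeft l)
          simpa [hbr] using h2
        have hinj : Function.Injective (AddMonoidHom.mulLeft b) := fun x y h =>
          mul_left_cancel₀ hb h
        obtain ⟨c', hc', h2⟩ := LeadAlong.exists_of_map (AddMonoidHom.mulLeft b) hinj h1.2
        have h3 : HasLead η Qm.totalDegree c' r :=
          ⟨DegLT.of_map (AddMonoidHom.mulLeft b) hinj h1.1, h2⟩
        refine ⟨c', ?_, le_rfl, ?_⟩
        · rintro rfl
          rw [map_zero] at hc'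
          exact mul_ne_zero hl0 hc hc'.symm
        · have h4 := (h3.smul w).add_degLT
            (degLT_const (Pm 0 • vm - Pj 0 • vj) (hm.totalDegree_pos hPm))
          convert h4 using 2 with n
          rw [← hr, sub_add_cancel]

end InitialShape

section Folner

theorem tendsto_overlap (a : ℤ) :
    Tendsto (fun N : ℕ => ((Finset.Ico (max a 0) (min (a + (N + 1 : ℕ)) ((N + 1 : ℕ) : ℤ))).card : ℝ) /
      ((N + 1 : ℕ) : ℝ)) atTop (nhds 1) := by
  have h1 : Tendsto (fun N : ℕ => 1 - (|a| : ℝ) / ((N : ℝ) + 1)) atTop (nhds 1) := by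
    have := (tendsto_const_nhds (x := (1 : ℝ))).sub
      ((tendsto_const_nhds (x := (|a| : ℝ))).mul tendsto_one_div_add_atTop_nhds_zero_nat)
    simpa [div_eq_mul_inv] using this
  refine tendsto_of_tendsto_of_tendsto_of_le_of_le h1 tendsto_const_nhds (fun N => ?_) (fun N => ?_)
  · have hN : (0 : ℝ) < (N : ℝ) + 1 := by positivity
    push_cast
    rw [le_div_iff₀ hN, sub_mul, div_mul_cancel₀ _ hN.ne', one_mul, Int.card_Ico]
    have h2 : ((N : ℤ) + 1) - |a| ≤
        ((min (a + (N + 1 : ℕ)) ((N + 1 : ℕ) : ℤ) - max a 0).toNat : ℤ) := by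
      push_cast
      rcases abs_cases a with h | h <;> omega
    exact_mod_cast h2
  · have hN : (0 : ℝ) < ((N + 1 : ℕ) : ℝ) := by positivity
    rw [div_le_one hN, Int.card_Ico]
    norm_cast
    omega

/-- Boxes form a Følner sequence. -/
theorem exists_isFolner (L : ℕ) : ∃ I, IsFolner L I := by
  classical
  refine ⟨fun N => Fintype.piFinset fun _ => Finset.Ico (0 : ℤ) ((N + 1 : ℕ) : ℤ), fun N => ?_,
    fun g => ?_⟩
  · refine ⟨0, Fintype.mem_piFinset.2 fun i => ?_⟩
    simp
  · set I : ℕ → Finset (Fin L → ℤ) :=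
      fun N => Fintype.piFinset fun _ => Finset.Ico (0 : ℤ) ((N + 1 : ℕ) : ℤ) with hI
    have himg : ∀ N, (I N).image (g + ·) =
        Fintype.piFinset fun i => Finset.Ico (g i) (g i + ((N + 1 : ℕ) : ℤ)) := by
      intro N
      ext x
      simp only [hI, Finset.mem_image, Fintype.mem_piFinset, Finset.mem_Ico]
      constructor
      · rintro ⟨y, hy, rfl⟩ i
        have := hy i
        simp only [Pi.add_apply]
        omega
      · intro h
        refine ⟨x - g, fun i => ?_, by abel⟩
        have := h i
        simp only [Pi.sub_apply]
        omega
    have hinter : ∀ N, (I N).image (g + ·) ∩ I N = Fintype.piFinset fun i =>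
        Finset.Ico (max (g i) 0) (min (g i + ((N + 1 : ℕ) : ℤ)) ((N + 1 : ℕ) : ℤ)) := by
      intro N
      rw [himg]
      ext x
      simp only [hI, Finset.mem_inter, Fintype.mem_piFinset, Finset.mem_Ico, ← forall_and]
      refine forall_congr' fun i => ?_
      omega
    have hcard : ∀ N, ((I N).card : ℝ) = ∏ _i : Fin L, ((N + 1 : ℕ) : ℝ) := by
      intro N
      simp only [hI, Fintype.card_piFinset, Int.card_Ico]
      simp
    have hpos : ∀ N, (0 : ℝ) < (I N).card := by
      intro N
      rw [hcard]
      positivity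
    have hratio : ∀ N, ((((I N).image (g + ·)) ∆ I N).card : ℝ) / ((I N).card : ℝ) =
        2 * (1 - ∏ i, ((Finset.Ico (max (g i) 0)
          (min (g i + (N + 1 : ℕ)) ((N + 1 : ℕ) : ℤ))).card : ℝ) / ((N + 1 : ℕ) : ℝ)) := by
      intro N
      have h1 : (((((I N).image (g + ·)) ∆ I N).card : ℕ) : ℝ) =
          2 * ((I N).card - (((I N).image (g + ·)) ∩ I N).card) := by
        have hc : ((I N).image (g + ·)).card = (I N).card :=
          Finset.card_image_of_injective _ (add_right_injective g)
        have h2 : (((I N).image (g + ·)) ∆ I N).card =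
            ((I N).image (g + ·) \ I N).card + (I N \ (I N).image (g + ·)).card := by
          rw [symmDiff_def, Finset.sup_eq_union,
            Finset.card_union_of_disjoint disjoint_sdiff_sdiff]
        have h3 := Finset.card_sdiff_add_card_inter ((I N).image (g + ·)) (I N)
        have h4 := Finset.card_sdiff_add_card_inter (I N) ((I N).image (g + ·))
        rw [Finset.inter_comm] at h4
        rw [h2]
        have h3' : (((I N).image (g + ·) \ I N).card : ℝ) +
          (((I N).image (g + ·)) ∩ I N).card = (I N).card := by rw [← hc]; exact_mod_cast h3
        have h4' : ((I N \ (I N).image (g + ·)).card : ℝ) +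
          (((I N).image (g + ·)) ∩ I N).card = (I N).card := by exact_mod_cast h4
        push_cast
        linarith
      have h5 : ((((I N).image (g + ·)) ∩ I N).card : ℝ) = ∏ i, ((Finset.Ico (max (g i) 0)
          (min (g i + (N + 1 : ℕ)) ((N + 1 : ℕ) : ℤ))).card : ℝ) := by
        rw [hinter, Fintype.card_piFinset, Nat.cast_prod]
      rw [h1, h5, Finset.prod_div_distrib, ← hcard, mul_div_assoc, sub_div, div_self (hpos N).ne']
    simp only [hratio]
    have := tendsto_finsetProd (Finset.univ : Finset (Fin L)) fun i _ => tendsto_overlap (g i)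
    simpa using (this.const_sub 1).const_mul 2

end Folner

section ErgodicSequences

variable {X : Type*} [MeasurableSpace X] {μ : Measure X} [IsProbabilityMeasure μ] {d L k : ℕ}
  {T : (Fin d → ℤ) → X → X}

omit [IsProbabilityMeasure μ] in
theorem ae_zsmul_of_inv (hT : IsMPAction μ T) {f : X → ℂ} {u : Fin d → ℤ}
    (hinv : ∀ᵐ x ∂μ, f (T u x) = f x) (r : ℤ) : ∀ᵐ x ∂μ, f (T (r • u) x) = f x := by
  have hpow : ∀ r : ℕ, ∀ᵐ x ∂μ, f (T ((r : ℤ) • u) x) = f x := by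
    intro r
    induction r with
    | zero => exact Eventually.of_forall fun x => by simp [hT.apply_zero]
    | succ r ih =>
      filter_upwards [ih, ae_comp hT hinv ((r : ℤ) • u)] with x h2 h3
      rw [hT.apply_add] at h3
      rw [← h2, ← h3]
      congr 2
      push_cast
      rw [add_smul, one_smul, add_comm]
  rcases Int.eq_nat_or_neg r with ⟨m, rfl | rfl⟩
  · exact hpow m
  · filter_upwards [ae_comp hT (hpow m) ((-(m : ℤ)) • u)] with x hx
    rw [hT.apply_add, ← add_smul, add_neg_cancel, zero_smul, hT.apply_zero] at hx
    exact hx.symm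

omit [IsProbabilityMeasure μ] in
theorem InvConst.of_ergodicSeq (hT : IsMPAction μ T) {q : (Fin L → ℤ) → Fin d → ℤ}
    (h : ErgodicSeq μ T q) {u : Fin d → ℤ} (hq : ∀ n, ∃ r : ℤ, q n - q 0 = r • u) :
    InvConst μ T u := by
  intro f hf hinv
  obtain ⟨I, hI⟩ := exists_isFolner L
  have h1 := h f hf.1 ⟨1, hf.2⟩ I hI
  have hq' : ∀ n, ∀ᵐ x ∂μ, f (T (q n) x) = f (T (q 0) x) := by
    intro n
    obtain ⟨r, hr⟩ := hq n
    filter_upwards [ae_comp hT (ae_zsmul_of_inv hT hinv r) (q 0)] with x hx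
    rw [← hx, hT.apply_add, ← hr, sub_add_cancel]
  have h2 : ∀ᵐ x ∂μ, ∀ n, f (T (q n) x) = f (T (q 0) x) := ae_all_iff.2 hq'
  have h3 : ∀ N, eLpNorm (fun x => (((I N).card : ℂ))⁻¹ * (∑ n ∈ I N, f (T (q n) x)) -
      ∫ y, f y ∂μ) 2 μ = eLpNorm (fun x => f (T (q 0) x) - ∫ y, f y ∂μ) 2 μ := by
    intro N
    refine eLpNorm_congr_ae ?_
    filter_upwards [h2] with x hx
    simp only [hx]
    congr 1
    exact avg_const (hI.1 N) _
  simp only [h3] at h1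
  have h4 := tendsto_nhds_unique tendsto_const_nhds h1
  rw [eLpNorm_eq_zero_iff ((hf.act hT _).1.sub_const _).aestronglyMeasurable (by simp)] at h4
  refine ⟨∫ y, f y ∂μ, ?_⟩
  filter_upwards [ae_comp hT h4 (-q 0)] with x hx
  simp only [hT.apply_add, add_neg_cancel, hT.apply_zero, Pi.zero_apply] at hx
  exact sub_eq_zero.1 hx

theorem ProdErgodic.ergodicSeq {q : Fin k → (Fin L → ℤ) → Fin d → ℤ}
    (hT : IsMPAction μ T) (h : ProdErgodic μ T q) (m : Fin k) : ErgodicSeq μ T (q m) := by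
  intro f hf hfb I hI
  obtain ⟨C, hC⟩ := hfb
  have h1 := h (fun x => f (x m)) (hf.comp (measurable_pi_apply m)) ⟨C, fun x => hC _⟩ I hI
  have hmp := measurePreserving_eval (fun _ : Fin k => μ) m
  have h2 : ∫ y : Fin k → X, f (y m) ∂(Measure.pi fun _ : Fin k => μ) = ∫ y, f y ∂μ := by
    have h3 : ∫ y, f y ∂μ =
        ∫ y, f y ∂(Measure.pi fun _ : Fin k => μ).map (Function.eval m) := by rw [hmp.map_eq]
    rw [h3, integral_map (measurable_pi_apply m).aemeasurable hf.aestronglyMeasurable]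
  simp only [h2] at h1
  refine h1.congr fun N => ?_
  refine eLpNorm_comp_measurePreserving (f := fun y : Fin k → X => y m)
    (g := fun x => (((I N).card : ℂ))⁻¹ * (∑ n ∈ I N, f (T (q m n) x)) - ∫ y, f y ∂μ) ?_ hmp
  exact (((Finset.measurable_fun_sum _ fun n _ => hf.comp (hT.measurable _)).const_mul _).sub_const
    _).aestronglyMeasurable

omit [IsProbabilityMeasure μ] in
theorem IsEig.integral_eq_zero (hT : IsMPAction μ T) {χ : X → ℂ} {l : (Fin d → ℤ) → ℂ}
    (h : IsEig μ T χ l) (hl : l ≠ 1) : ∫ x, χ x ∂μ = 0 := by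
  obtain ⟨g, hg⟩ := Function.ne_iff.1 hl
  have h1 : ∫ x, χ x ∂μ = l g * ∫ x, χ x ∂μ := by
    conv_lhs => rw [← hT.integral_comp g]
    rw [← integral_const_mul]
    exact integral_congr_ae (h.2.2 g)
  by_contra h0
  exact hg (mul_right_cancel₀ h0 (by rw [← h1, Pi.one_apply, one_mul]))

/-- Ergodicity of the product kills the averages of products of nontrivial characters. -/
theorem ProdErgodic.tendsto_avg_prod {q : Fin k → (Fin L → ℤ) → Fin d → ℤ}
    (hT : IsMPAction μ T) (h : ProdErgodic μ T q) {χ : Fin k → X → ℂ}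
    {l : Fin k → (Fin d → ℤ) → ℂ} (hχ : ∀ j, IsEig μ T (χ j) (l j)) {j₀ : Fin k} (hj : l j₀ ≠ 1)
    {I : ℕ → Finset (Fin L → ℤ)} (hI : IsFolner L I) :
    Tendsto (fun N => ‖avg (I N) fun n => ∏ j, l j (q j n)‖) atTop (nhds 0) := by
  have h1 := h (fun x => ∏ j, χ j (x j))
    (Finset.measurable_fun_prod _ fun j _ => (hχ j).1.comp (measurable_pi_apply j))
    ⟨1, fun x => by simp [norm_prod, (hχ _).2.1]⟩ I hI
  have h0 : ∫ y : Fin k → X, ∏ j, χ j (y j) ∂(Measure.pi fun _ : Fin k => μ) = 0 := by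
    rw [integral_fintype_prod_eq_prod (𝕜 := ℂ)]
    exact Finset.prod_eq_zero (mem_univ j₀) ((hχ j₀).integral_eq_zero hT hj)
  rw [h0] at h1
  have h2 : ∀ᵐ x ∂(Measure.pi fun _ : Fin k => μ), ∀ n j,
      χ j (T (q j n) (x j)) = l j (q j n) * χ j (x j) := by
    refine ae_all_iff.2 fun n => ae_all_iff.2 fun j => ?_
    exact (measurePreserving_eval (fun _ : Fin k => μ) j).quasiMeasurePreserving.ae
      ((hχ j).2.2 (q j n))
  have h3 : ∀ N, eLpNorm (fun x : Fin k → X => (((I N).card : ℂ))⁻¹ *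
      (∑ n ∈ I N, ∏ j, χ j (T (q j n) (x j))) - 0) 2 (Measure.pi fun _ : Fin k => μ) =
      ENNReal.ofReal ‖avg (I N) fun n => ∏ j, l j (q j n)‖ := by
    intro N
    rw [eLpNorm_congr_norm_ae (g := fun _ => avg (I N) fun n => ∏ j, l j (q j n))]
    · rw [eLpNorm_const _ (by simp) (IsProbabilityMeasure.ne_zero _)]
      simp
    · filter_upwards [h2] with x hx
      simp only [hx, Finset.prod_mul_distrib, ← Finset.sum_mul, sub_zero]
      rw [avg, ← mul_assoc, norm_mul _ (∏ j, χ j (x j)), norm_prod]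
      simp [(hχ _).2.1]
  simp only [h3] at h1
  have := (ENNReal.tendsto_toReal ENNReal.zero_ne_top).comp h1
  simpa [Function.comp_def] using this

end ErgodicSequences

section Telescoping

variable {X V G : Type*} [MeasurableSpace X] [AddCommGroup V] {μ : Measure X}
  [IsProbabilityMeasure μ] {T : V → X → X}

theorem exists_b1_scale {f : X → ℂ} (hf : Measurable f) (hb : ∃ C : ℝ, ∀ x, ‖f x‖ ≤ C) :
    ∃ (c : ℂ) (g : X → ℂ), B1 g ∧ f = fun x => c * g x := by
  obtain ⟨C, hC⟩ := hb
  have h0 : (0 : ℝ) < max C 1 := lt_max_of_lt_right one_pos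
  refine ⟨(max C 1 : ℝ), fun x => ((max C 1 : ℝ) : ℂ)⁻¹ * f x, ⟨hf.const_mul _, fun x => ?_⟩, ?_⟩
  · rw [norm_mul, norm_inv, Complex.norm_real, Real.norm_of_nonneg h0.le, inv_mul_le_one₀ h0]
    exact (hC x).trans (le_max_left _ _)
  · funext x
    rw [mul_inv_cancel_left₀]
    exact_mod_cast h0.ne'

omit [IsProbabilityMeasure μ] in
theorem tendsto_eLpNorm_const_mul {F : ℕ → X → ℂ} (c : ℂ)
    (hF : Tendsto (fun N => eLpNorm (F N) 2 μ) atTop (nhds 0)) :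
    Tendsto (fun N => eLpNorm (fun x => c * F N x) 2 μ) atTop (nhds 0) := by
  have h1 : ∀ N, eLpNorm (fun x => c * F N x) 2 μ = ‖c‖ₑ * eLpNorm (F N) 2 μ := fun N =>
    eLpNorm_const_smul c (F N) 2 μ
  simp only [h1]
  have := ENNReal.Tendsto.const_mul hF (Or.inr (by simp : ‖c‖ₑ ≠ ⊤))
  simpa using this

omit [IsProbabilityMeasure μ] in
theorem tendsto_eLpNorm_add {F F' : ℕ → X → ℂ} (hm : ∀ N, Measurable (F N))
    (hm' : ∀ N, Measurable (F' N))
    (hF : Tendsto (fun N => eLpNorm (F N) 2 μ) atTop (nhds 0))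
    (hF' : Tendsto (fun N => eLpNorm (F' N) 2 μ) atTop (nhds 0)) :
    Tendsto (fun N => eLpNorm (fun x => F N x + F' N x) 2 μ) atTop (nhds 0) := by
  have h := hF.add hF'
  rw [add_zero] at h
  exact tendsto_of_tendsto_of_tendsto_of_le_of_le tendsto_const_nhds h (fun _ => zero_le)
    fun N => eLpNorm_add_le (hm N).aestronglyMeasurable (hm' N).aestronglyMeasurable (by simp)

theorem tendsto_eLpNorm_telescope (hT : IsMPAction μ T) {ι : Type*} {J : Finset ι}
    {p : ι → G → V} {h : G → X → ℂ} (hh : ∀ n, B1 (h n)) {H : ℂ} {I : ℕ → Finset G}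
    (hzero : ∀ f : ι → X → ℂ, (∀ j, B1 (f j)) → (∃ j ∈ J, ∫ x, f j x ∂μ = 0) →
      Tendsto (fun N => eLpNorm (fun x => avg (I N) fun n =>
        (∏ j ∈ J, f j (T (p j n) x)) * h n x) 2 μ) atTop (nhds 0))
    (hbase : Tendsto (fun N => eLpNorm (fun x => (avg (I N) fun n => h n x) - H) 2 μ)
      atTop (nhds 0))
    {f : ι → X → ℂ} (hf : ∀ j, Measurable (f j)) (hfb : ∀ j, ∃ C : ℝ, ∀ x, ‖f j x‖ ≤ C) :
    Tendsto (fun N => eLpNorm (fun x => (avg (I N) fun n =>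
        (∏ j ∈ J, f j (T (p j n) x)) * h n x) - (∏ j ∈ J, ∫ x, f j x ∂μ) * H) 2 μ)
      atTop (nhds 0) := by
  classical
  have hm : ∀ (f : ι → X → ℂ), (∀ j, Measurable (f j)) → ∀ N, Measurable fun x =>
      avg (I N) fun n => (∏ j ∈ J, f j (T (p j n) x)) * h n x := fun f hf N =>
    (Finset.measurable_fun_sum _ fun n _ => (Finset.measurable_fun_prod _ fun j _ =>
      (hf j).comp (hT.measurable _)).mul (hh n).1).const_mul _
  have hzero' : ∀ f : ι → X → ℂ, (∀ j, Measurable (f j)) → (∀ j, ∃ C : ℝ, ∀ x, ‖f j x‖ ≤ C) →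
      (∃ j ∈ J, ∫ x, f j x ∂μ = 0) → Tendsto (fun N => eLpNorm (fun x => avg (I N) fun n =>
        (∏ j ∈ J, f j (T (p j n) x)) * h n x) 2 μ) atTop (nhds 0) := by
    intro f hf hfb hj
    choose c g hg hfg using fun j => exists_b1_scale (hf j) (hfb j)
    by_cases hc : ∃ j ∈ J, c j = 0
    · obtain ⟨j, hj, hc⟩ := hc
      have h0 : ∀ N, (fun x => avg (I N) fun n => (∏ j ∈ J, f j (T (p j n) x)) * h n x) =
          fun _ => 0 := by
        intro N
        funext x
        simp only [avg]
        rw [Finset.sum_eq_zero, mul_zero]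
        intro n _
        rw [Finset.prod_eq_zero hj (by rw [hfg j]; simp [hc]), zero_mul]
      simp only [h0, eLpNorm_zero']
      exact tendsto_const_nhds
    · push Not at hc
      have h1 := tendsto_eLpNorm_const_mul (∏ j ∈ J, c j) (hzero g hg (by
        obtain ⟨j, hj, hj0⟩ := hj
        refine ⟨j, hj, ?_⟩
        rw [hfg j, integral_const_mul] at hj0
        exact (mul_eq_zero.1 hj0).resolve_left (hc j hj)))
      refine h1.congr fun N => ?_
      congr 1
      funext x
      rw [← avg_mul_left]
      congr 1
      funext n
      rw [← mul_assoc, ← Finset.prod_mul_distrib]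
      congr 1
      exact Finset.prod_congr rfl fun j _ => by rw [hfg j]
  have key : ∀ (A : Finset ι) (f : ι → X → ℂ), (∀ j, Measurable (f j)) →
      (∀ j, ∃ C : ℝ, ∀ x, ‖f j x‖ ≤ C) → (∀ j ∈ J, j ∉ A → ∃ a : ℂ, f j = fun _ => a) →
      Tendsto (fun N => eLpNorm (fun x => (avg (I N) fun n =>
        (∏ j ∈ J, f j (T (p j n) x)) * h n x) - (∏ j ∈ J, ∫ x, f j x ∂μ) * H) 2 μ)
        atTop (nhds 0) := by
    intro A
    induction A using Finset.induction_on with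
    | empty =>
      intro f hf hfb hc
      have h1 : ∀ j ∈ J, ∀ x, f j x = ∫ y, f j y ∂μ := by
        intro j hj x
        obtain ⟨a, ha⟩ := hc j hj (by simp)
        simp [ha]
      refine (tendsto_eLpNorm_const_mul (∏ j ∈ J, ∫ x, f j x ∂μ) hbase).congr fun N => ?_
      congr 1
      funext x
      rw [mul_sub, ← avg_mul_left]
      congr 2
      funext n
      rw [Finset.prod_congr rfl fun j hj => h1 j hj _]
    | insert a A ha ih =>
      intro f hf hfb hc
      by_cases haJ : a ∈ J
      swap
      · refine ih f hf hfb fun j hj hjA => hc j hj ?_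
        rw [Finset.mem_insert, not_or]
        exact ⟨fun h => haJ (h ▸ hj), hjA⟩
      set b : ℂ := ∫ x, f a x ∂μ with hb
      set f1 : ι → X → ℂ := Function.update f a fun x => f a x - b with hf1
      set f2 : ι → X → ℂ := Function.update f a fun _ => b with hf2
      have hm1 : ∀ j, Measurable (f1 j) := by
        intro j
        by_cases hj : j = a
        · subst hj; simpa [hf1] using (hf j).sub_const b
        · simpa [hf1, hj] using hf j
      have hm2 : ∀ j, Measurable (f2 j) := by
        intro j
        by_cases hj : j = a
        · subst hj; simp [hf2]
        · simpa [hf2, hj] using hf j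
      have hb1 : ∀ j, ∃ C : ℝ, ∀ x, ‖f1 j x‖ ≤ C := by
        intro j
        by_cases hj : j = a
        · subst hj
          obtain ⟨C, hC⟩ := hfb j
          exact ⟨C + ‖b‖, fun x => by
            simpa [hf1] using (norm_sub_le _ _).trans (add_le_add_left (hC x) _)⟩
        · simpa [hf1, hj] using hfb j
      have hb2 : ∀ j, ∃ C : ℝ, ∀ x, ‖f2 j x‖ ≤ C := by
        intro j
        by_cases hj : j = a
        · subst hj; exact ⟨‖b‖, by simp [hf2]⟩
        · simpa [hf2, hj] using hfb j
      have h1 := hzero' f1 hm1 hb1 ⟨a, haJ, by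
        obtain ⟨C, hC⟩ := hfb a
        simp only [hf1, Function.update_self]
        rw [integral_sub (Integrable.of_bound (hf a).aestronglyMeasurable C (ae_of_all _ hC))
          (integrable_const _)]
        simp [hb]⟩
      have h2 := ih f2 hm2 hb2 (by
        intro j hj hjA
        by_cases hja : j = a
        · subst hja; exact ⟨b, by simp [hf2]⟩
        · obtain ⟨e, he⟩ := hc j hj (by simp [hja, hjA])
          exact ⟨e, by simpa [hf2, hja] using he⟩)
      refine (tendsto_eLpNorm_add (hm f1 hm1) (fun N => (hm f2 hm2 N).sub_const _) h1 h2).congr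
        fun N => ?_
      congr 1
      funext x
      rw [← add_sub_assoc, ← avg_add]
      have e1 : ∏ j ∈ J, ∫ x, f2 j x ∂μ = ∏ j ∈ J, ∫ x, f j x ∂μ := by
        refine Finset.prod_congr rfl fun j _ => ?_
        by_cases hj : j = a
        · subst hj; simp [hf2, hb]
        · simp [hf2, hj]
      rw [e1]
      congr 2
      funext n
      rw [← add_mul]
      congr 1
      rw [← Finset.mul_prod_erase J _ haJ, ← Finset.mul_prod_erase J _ haJ,
        ← Finset.mul_prod_erase J (fun j => f j (T (p j n) x)) haJ]
      have e2 : ∏ j ∈ J.erase a, f1 j (T (p j n) x) = ∏ j ∈ J.erase a, f j (T (p j n) x) :=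
        Finset.prod_congr rfl fun j hj => by simp [hf1, Finset.ne_of_mem_erase hj]
      have e3 : ∏ j ∈ J.erase a, f2 j (T (p j n) x) = ∏ j ∈ J.erase a, f j (T (p j n) x) :=
        Finset.prod_congr rfl fun j hj => by simp [hf2, Finset.ne_of_mem_erase hj]
      rw [e2, e3, ← add_mul]
      simp [hf1, hf2]
  exact key J f hf hfb fun j hj hjJ => absurd hj hjJ

end Telescoping

section JointErgodicity

variable {X : Type*} [MeasurableSpace X] {μ : Measure X} [IsProbabilityMeasure μ] {d L k : ℕ}
  {T : (Fin d → ℤ) → X → X}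

/-- The factor of highest degree controls the multiple averages through box averages along
ergodic directions. -/
theorem exists_ctrl_list (hT : IsMPAction μ T)
    {P : Fin k → (Fin L → ℤ) → ℤ} {v : Fin k → Fin d → ℤ} {Q : Fin k → MvPolynomial (Fin L) ℚ}
    (hrep : ∀ i, RepresentedBy₁ (P i) (Q i))
    (hnc : ∀ i, ∃ n m : Fin L → ℤ, P i n • v i ≠ P i m • v i)
    (hed : ∀ i j, i ≠ j → ∃ n m : Fin L → ℤ,
      P i n • v i - P j n • v j ≠ P i m • v i - P j m • v j)
    (hdep : ∀ i j, i ≠ j → (Q i).totalDegree = (Q j).totalDegree →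
      (∃ a b : ℤ, (a, b) ≠ (0, 0) ∧ a • v i + b • v j = 0) ∨
      (∃ a b : ℤ, (a, b) ≠ (0, 0) ∧
        ∀ n m : Fin L → ℤ, a * P i n + b * P j n = a * P i m + b * P j m))
    (herg : ∀ i, ErgodicSeq μ T fun n => P i n • v i)
    (herg2 : ∀ i j, i ≠ j → (Q i).totalDegree = (Q j).totalDegree →
      ErgodicSeq μ T fun n => P i n • v i - P j n • v j)
    {m : Fin k} {J : Finset (Fin k)}
    (hJ : ∀ j ∈ J, j ≠ m ∧ (Q j).totalDegree ≤ (Q m).totalDegree) :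
    ∃ us : List (Fin d → ℤ), (∀ u ∈ us, InvConst μ T u) ∧
      ∀ c : (Fin L → ℤ) → ℂ, (∀ n, ‖c n‖ ≤ 1) → ∀ f : Fin k → X → ℂ, (∀ j, B1 (f j)) →
      ∀ I, IsFolner L I → ∀ ε : ℝ, 0 < ε → ∃ δ : ℝ, 0 < δ ∧ ∀ g : X → ℂ, B1 g →
        IsSmall μ T us g δ → ∀ᶠ N in atTop, nsq μ (fun x => avg (I N) fun n =>
          c n * (∏ j ∈ J, f j (T (P j n • v j) x)) * g (T (P m n • v m) x)) ≤ ε := by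
  have hvm : v m ≠ 0 := by
    obtain ⟨n, n', h⟩ := hnc m
    intro h0
    simp [h0] at h
  obtain ⟨u, a, ha, hva, hu⟩ := exists_primitive hvm
  have huinv : InvConst μ T u := (InvConst.of_ergodicSeq hT (herg m)) fun n =>
    ⟨(P m n - P m 0) * a, by rw [mul_smul, ← hva, sub_smul]⟩
  have hpoint := fun j : J => exists_pointKind (hrep m) (hrep j) ha hva hu (hnc m) (hnc j)
    (hed m j (hJ j j.2).1.symm) (hJ j j.2).2 fun h => hdep m j (hJ j j.2).1.symm h.symm
  choose kind R hR hne htop hpt using hpoint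
  let s : PolyShape (Fin d → ℤ) :=
    { ι := J, κ := J, fι := inferInstance, fκ := inferInstance, D := (Q m).totalDegree,
      e := (Q m).totalDegree, u := u, cl := id, kind := kind }
  obtain ⟨us, hus, hctrl⟩ := PolyShape.exists_ctrl (L := L) hT (InvConst μ T) s huinv (by
    intro j w hw
    rcases htop j w hw with rfl | ⟨hd, hr⟩
    · exact huinv
    · exact (InvConst.of_ergodicSeq hT (herg2 m j (hJ j j.2).1.symm hd.symm)) hr)
  refine ⟨us, hus, fun c hc f hf I hI ε hε => ?_⟩
  obtain ⟨n₁, n₂, hn12⟩ := hnc m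
  have hP12 : P m n₁ ≠ P m n₂ := fun h => hn12 (by rw [h])
  obtain ⟨η, hη⟩ := exists_evalInt_ne_zero
    (mul_ne_zero (homogeneousComponent_totalDegree_ne_zero ((hrep m).ne_zero hP12))
      (Finset.prod_ne_zero_iff.2 fun j (_ : j ∈ (Finset.univ : Finset J)) => hR j))
  simp only [evalInt, map_mul, map_prod] at hη
  have hη1 := left_ne_zero_of_mul hη
  have hη2 := fun j : J => Finset.prod_ne_zero_iff.1 (right_ne_zero_of_mul hη) j (mem_univ _)
  choose cD hcD hpt' using fun j => hpt j η hη1 (hη2 j)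
  obtain ⟨c₀, hc₀, hlead⟩ := (hrep m).exists_hasLead hη1
  obtain ⟨δ, hδ, h⟩ := hctrl η (c₀ * a) cD (mul_ne_zero hc₀ ha) hcD ε hε
  refine ⟨δ, hδ, fun g hg hsmall => ?_⟩
  have hreal : s.Real η (c₀ * a) cD (fun n => P m n • v m)
      (fun j n => P m n • v m - P j n • v j) (fun j => f j) :=
    { pos := (hrep m).totalDegree_pos hP12
      lead := by
        have := hlead.smul (v m)
        change HasLead η (Q m).totalDegree ((c₀ * a) • u) _
        rwa [mul_smul, ← hva]
      b1 := fun j => hf j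
      one := fun j h => absurd h (hne j)
      pt := hpt'
      pair := by
        intro i j hij
        obtain rfl : i = j := hij
        exact PairOK.self _ _ _ }
  filter_upwards [h _ _ _ hreal c hc g hg hsmall I hI] with N hN
  refine le_of_eq_of_le ?_ hN
  congr 1
  funext x
  congr 1
  funext n
  rw [petTerm]
  simp only [sub_sub_cancel]
  rw [Finset.prod_coe_sort J fun j => f j (T (P j n • v j) x)]
  ring

/-- Multiple averages vanish if one of the functions has zero integral, or if they are twisted by
a nontrivial character. -/
theorem tendsto_nsq_avg_char_mul (hT : IsMPAction μ T)
    {P : Fin k → (Fin L → ℤ) → ℤ} {v : Fin k → Fin d → ℤ} {Q : Fin k → MvPolynomial (Fin L) ℚ}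
    (hrep : ∀ i, RepresentedBy₁ (P i) (Q i))
    (hnc : ∀ i, ∃ n m : Fin L → ℤ, P i n • v i ≠ P i m • v i)
    (hed : ∀ i j, i ≠ j → ∃ n m : Fin L → ℤ,
      P i n • v i - P j n • v j ≠ P i m • v i - P j m • v j)
    (hdep : ∀ i j, i ≠ j → (Q i).totalDegree = (Q j).totalDegree →
      (∃ a b : ℤ, (a, b) ≠ (0, 0) ∧ a • v i + b • v j = 0) ∨
      (∃ a b : ℤ, (a, b) ≠ (0, 0) ∧
        ∀ n m : Fin L → ℤ, a * P i n + b * P j n = a * P i m + b * P j m))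
    (hprod : ProdErgodic μ T fun i n => P i n • v i)
    (herg2 : ∀ i j, i ≠ j → (Q i).totalDegree = (Q j).totalDegree →
      ErgodicSeq μ T fun n => P i n • v i - P j n • v j)
    {I : ℕ → Finset (Fin L → ℤ)} (hI : IsFolner L I) (S : Finset (Fin k))
    (χ : Fin k → X → ℂ) (l : Fin k → (Fin d → ℤ) → ℂ) (hχ : ∀ j, IsEig μ T (χ j) (l j))
    (f : Fin k → X → ℂ) (hf : ∀ j, B1 (f j))
    (h : (∃ j, j ∉ S ∧ l j ≠ 1) ∨ ∃ j ∈ S, ∫ x, f j x ∂μ = 0) :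
    Tendsto (fun N => nsq μ fun x => avg (I N) fun n =>
      (∏ j ∈ Sᶜ, l j (P j n • v j)) * ∏ j ∈ S, f j (T (P j n • v j) x)) atTop (nhds 0) := by
  have herg := fun i => hprod.ergodicSeq hT i
  induction S using Finset.strongInduction generalizing χ l f with
  | H S ih =>
    rcases S.eq_empty_or_nonempty with rfl | hS
    · obtain ⟨j, -, hj⟩ : ∃ j, j ∉ (∅ : Finset (Fin k)) ∧ l j ≠ 1 := by simpa using h
      have h1 := (hprod.tendsto_avg_prod hT hχ hj hI).pow 2
      simpa [nsq] using h1
    · obtain ⟨m, hm, hmax⟩ := S.exists_max_image (fun i => (Q i).totalDegree) hS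
      set J := S.erase m with hJdef
      have hJS : J ⊂ S := Finset.erase_ssubset hm
      have hmJ : m ∉ J := Finset.notMem_erase m S
      have hJc : Jᶜ = insert m Sᶜ := by rw [hJdef, Finset.compl_erase]
      have hmS : m ∉ Sᶜ := by simpa using hm
      obtain ⟨us, hus, hctrl⟩ := exists_ctrl_list hT hrep hnc hed hdep herg herg2 (m := m) (J := J)
        fun j hj => ⟨Finset.ne_of_mem_erase hj, hmax j (Finset.mem_of_mem_erase hj)⟩
      have hupd : ∀ (χ' : Fin k → X → ℂ) (l' : Fin k → (Fin d → ℤ) → ℂ),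
          (∀ j, IsEig μ T (χ' j) (l' j)) → ∀ ψ w, IsEig μ T ψ w → ∀ f' : Fin k → X → ℂ,
          (∀ j, B1 (f' j)) → (w ≠ 1 ∨ (∃ j, j ∉ S ∧ l' j ≠ 1) ∨ ∃ j ∈ J, ∫ x, f' j x ∂μ = 0) →
          Tendsto (fun N => nsq μ fun x => avg (I N) fun n =>
            star (w (P m n • v m)) * ((∏ j ∈ Sᶜ, l' j (P j n • v j)) *
              ∏ j ∈ J, f' j (T (P j n • v j) x))) atTop (nhds 0) := by
        intro χ' l' hχ' ψ w hψ f' hf' hor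
        have h1 := ih J hJS (Function.update χ' m fun x => (starRingEnd ℂ) (ψ x))
          (Function.update l' m (star w)) (by
            intro j
            by_cases hj : j = m
            · subst hj; simpa using hψ.conj
            · simpa [hj] using hχ' j) f' hf' (by
            rcases hor with hw | ⟨j, hj, hl⟩ | h_int
            · refine Or.inl ⟨m, hmJ, ?_⟩
              rw [Function.update_self]
              intro h0
              exact hw (by rw [← star_star w, h0, star_one])
            · have hjm : j ≠ m := by rintro rfl; exact hj hm
              exact Or.inl ⟨j, fun h0 => hj (hJS.1 h0), by simpa [hjm] using hl⟩
            · exact Or.inr h_int)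
        refine h1.congr fun N => ?_
        congr 1
        funext x
        congr 1
        funext n
        rw [hJc, Finset.prod_insert hmS, Function.update_self, mul_assoc]
        congr 2
        refine Finset.prod_congr rfl fun j hj => ?_
        rw [Function.update_of_ne (by rintro rfl; exact hmS hj)]
      have caseA : ∀ (χ' : Fin k → X → ℂ) (l' : Fin k → (Fin d → ℤ) → ℂ),
          (∀ j, IsEig μ T (χ' j) (l' j)) → ∀ f' : Fin k → X → ℂ, (∀ j, B1 (f' j)) →
          ((∃ j, j ∉ S ∧ l' j ≠ 1) ∨ ∃ j ∈ J, ∫ x, f' j x ∂μ = 0) →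
          Tendsto (fun N => nsq μ fun x => avg (I N) fun n =>
            (∏ j ∈ Sᶜ, l' j (P j n • v j)) * (∏ j ∈ J, f' j (T (P j n • v j) x)) *
              f' m (T (P m n • v m) x)) atTop (nhds 0) := by
        intro χ' l' hχ' f' hf' hor
        have hc : ∀ n, ‖∏ j ∈ Sᶜ, l' j (P j n • v j)‖ = 1 := fun n => by
          rw [norm_prod]
          exact Finset.prod_eq_one fun j _ => (hχ' j).norm_eq_one _
        refine tendsto_nsq_of_ctrl hT hf' hc hus
          (fun ε hε => hctrl _ (fun n => (hc n).le) f' hf' I hI ε hε)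
          (fun ψ w hψ => hupd χ' l' hχ' ψ w hψ f' hf' (Or.inr hor))
          (fun ψ w hψ hw f'' hf'' => ?_) (hf' m)
        simpa using hupd (fun _ _ => 1) (fun _ => 1) (fun _ => IsEig.const (by simp)) ψ w hψ f''
          hf'' (Or.inl hw)
      have hsplit : ∀ n x, (∏ j ∈ Sᶜ, l j (P j n • v j)) * ∏ j ∈ S, f j (T (P j n • v j) x) =
          (∏ j ∈ Sᶜ, l j (P j n • v j)) * (∏ j ∈ J, f j (T (P j n • v j) x)) *
              f m (T (P m n • v m) x) := by
        intro n x
        rw [← Finset.prod_erase_mul S _ hm, mul_assoc]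
      simp only [hsplit]
      by_cases hA : (∃ j, j ∉ S ∧ l j ≠ 1) ∨ ∃ j ∈ J, ∫ x, f j x ∂μ = 0
      · exact caseA χ l hχ f hf hA
      · push Not at hA
        have hfm : ∫ x, f m x ∂μ = 0 := by
          rcases h with ⟨j, hj, hl⟩ | ⟨j, hj, hj0⟩
          · exact absurd (hA.1 j hj) hl
          · by_cases hjm : j = m
            · rwa [← hjm]
            · exact absurd hj0 (hA.2 j (Finset.mem_erase.2 ⟨hjm, hj⟩))
        have h1 : ∀ n, ∏ j ∈ Sᶜ, l j (P j n • v j) = 1 := fun n =>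
          Finset.prod_eq_one fun j hj => by rw [hA.1 j (by simpa using hj)]; rfl
        simp only [h1, one_mul]
        have hB : ∀ f' : Fin k → X → ℂ, (∀ j, B1 (f' j)) → ∀ N, B1 fun x => avg (I N) fun n =>
            (∏ j ∈ J, f' j (T (P j n • v j) x)) * f m (T (P m n • v m) x) := fun f' hf' N =>
          B1.avg _ fun n => (B1.prod J fun j _ => (hf' j).act hT _).mul ((hf m).act hT _)
        rw [← tendsto_eLpNorm_iff fun N => (hB f hf N).memLp 2]
        have h2 := tendsto_eLpNorm_telescope (μ := μ) hT (J := J) (p := fun j n => P j n • v j)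
          (h := fun n x => f m (T (P m n • v m) x)) (H := 0) (I := I) (f := f)
          (fun n => (hf m).act hT _) ?_ ?_ (fun j => (hf j).1) (fun j => ⟨1, (hf j).2⟩)
        · simpa using h2
        · intro f' hf' h0
          rw [tendsto_eLpNorm_iff fun N => (hB f' hf' N).memLp 2]
          have h3 := caseA (fun _ _ => 1) (fun _ => 1) (fun _ => IsEig.const (by simp))
            (Function.update f' m (f m)) (by
              intro j
              by_cases hj : j = m
              · subst hj; simpa using hf j
              · simpa [hj] using hf' j) (by
              obtain ⟨j, hj, hj0⟩ := h0
              refine Or.inr ⟨j, hj, ?_⟩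
              rwa [Function.update_of_ne (by rintro rfl; exact hmJ hj)])
          refine h3.congr fun N => ?_
          congr 1
          funext x
          congr 1
          funext n
          simp only [Pi.one_apply, Finset.prod_const_one, one_mul, Function.update_self]
          congr 1
          refine Finset.prod_congr rfl fun j hj => ?_
          rw [Function.update_of_ne (by rintro rfl; exact hmJ hj)]
        · have h3 := herg m (f m) (hf m).1 ⟨1, (hf m).2⟩ I hI
          rw [hfm] at h3
          exact h3

/-- Product ergodicity and ergodicity of the differences of equal degree imply joint
ergodicity. -/
theorem jointlyErgodic_of_prodErgodic (hT : IsMPAction μ T)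
    {P : Fin k → (Fin L → ℤ) → ℤ} {v : Fin k → Fin d → ℤ} {Q : Fin k → MvPolynomial (Fin L) ℚ}
    (hrep : ∀ i, RepresentedBy₁ (P i) (Q i))
    (hnc : ∀ i, ∃ n m : Fin L → ℤ, P i n • v i ≠ P i m • v i)
    (hed : ∀ i j, i ≠ j → ∃ n m : Fin L → ℤ,
      P i n • v i - P j n • v j ≠ P i m • v i - P j m • v j)
    (hdep : ∀ i j, i ≠ j → (Q i).totalDegree = (Q j).totalDegree →
      (∃ a b : ℤ, (a, b) ≠ (0, 0) ∧ a • v i + b • v j = 0) ∨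
      (∃ a b : ℤ, (a, b) ≠ (0, 0) ∧
        ∀ n m : Fin L → ℤ, a * P i n + b * P j n = a * P i m + b * P j m))
    (hprod : ProdErgodic μ T fun i n => P i n • v i)
    (herg2 : ∀ i j, i ≠ j → (Q i).totalDegree = (Q j).totalDegree →
      ErgodicSeq μ T fun n => P i n • v i - P j n • v j) :
    JointlyErgodic μ T fun i n => P i n • v i := by
  intro f hf hfb I hI
  have h1 := tendsto_eLpNorm_telescope (μ := μ) hT (J := Finset.univ)
    (p := fun j n => P j n • v j) (h := fun _ _ => 1) (H := 1) (I := I)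
    (fun _ => B1.one) ?_ ?_ hf hfb
  · simpa [avg] using h1
  · intro f' hf' h0
    rw [tendsto_eLpNorm_iff fun N => (B1.avg _ fun n =>
      (B1.prod Finset.univ fun j _ => (hf' j).act hT _).mul B1.one).memLp 2]
    have h2 := tendsto_nsq_avg_char_mul hT hrep hnc hed hdep hprod herg2 hI Finset.univ
      (fun _ _ => 1) (fun _ => 1) (fun _ => IsEig.const (by simp)) f' hf' (Or.inr h0)
    simpa using h2
  · have h2 : ∀ N, (avg (I N) fun _ => (1 : ℂ)) = 1 := fun N => avg_const (hI.1 N) 1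
    simp [h2]

end JointErgodicity

section Linear

universe u₁

variable {X Z : Type u₁} {V : Type*} [MeasurableSpace X] [MeasurableSpace Z] [AddCommGroup V] {μ : Measure X}
  [IsProbabilityMeasure μ] {ρ : Measure Z} [IsProbabilityMeasure ρ] {T : V → X → X} {L : ℕ}

theorem exists_phase (z : ℂ) : ∃ c : ℂ, ‖c‖ ≤ 1 ∧ (‖z‖ : ℂ) = c * z := by
  rcases eq_or_ne z 0 with rfl | hz
  · exact ⟨0, by simp⟩
  · refine ⟨‖z‖ / z, ?_, by field_simp⟩
    rw [norm_div, Complex.norm_real, norm_norm]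
    exact div_self_le_one _

/-- Averages of a family whose correlations are dominated by those of a function vanish if the
function is small along the leading direction. -/
theorem tendsto_nsq_of_correlation_le (hT : IsMPAction μ T) {f : X → ℂ} (hf : B1 f) {w : V}
    (hsmall : ∀ δ : ℝ, 0 < δ → IsSmall μ T [w] f δ) {η : Fin L → ℤ} {I : ℕ → Finset (Fin L → ℤ)}
    (hI : IsFolner L I) {e : ℕ} {c : ℤ} (hc : c ≠ 0) {q : (Fin L → ℤ) → V}
    (hq : HasLead η (e + 1) (c • w) q) {u : (Fin L → ℤ) → Z → ℂ} (hu : ∀ n, B1 (u n))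
    (huf : ∀ n n', ‖∫ z, u n z * (starRingEnd ℂ) (u n' z) ∂ρ‖ ≤
      ‖∫ x, f (T (q n) x) * (starRingEnd ℂ) (f (T (q n') x)) ∂μ‖) :
    Tendsto (fun N => nsq ρ fun z => avg (I N) fun n => u n z) atTop (nhds 0) := by
  classical
  have key : ∀ a b : V, ∫ x, f (T a x) * (starRingEnd ℂ) (f (T b x)) ∂μ =
      ∫ x, f (T (a - b) x) * (starRingEnd ℂ) (f x) ∂μ := by
    intro a b
    rw [← hT.integral_comp b fun x => f (T (a - b) x) * (starRingEnd ℂ) (f x)]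
    simp only [hT.apply_add, sub_add_cancel]
  induction e generalizing c q Z with
  | zero =>
    rw [tendsto_order]
    refine ⟨fun a ha => Eventually.of_forall fun N => ha.trans_le (nsq_nonneg _), fun ε hε => ?_⟩
    have hcR : (0 : ℝ) < (c : ℝ) ^ 2 := by positivity
    obtain ⟨R, -, hR0, hRc⟩ := (hsmall (((ε / 2) ^ 2 / 4) * (((ε / 2) / 4) / (4 * (c : ℝ) ^ 2)))
      (by positivity)).exists_card_le hT (by positivity) (by positivity) hc 0
    refine (nsq_avg_le_of_card (μ := ρ) hI hu η hR0 (ε := ε / 2) (by positivity) _ hRc ?_).mono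
      fun N hN => hN.trans_lt (by linarith)
    intro h hh h' hh' hhB
    have hsm' : IsSmall μ T [] (mderiv T ((h : ℤ) • c • w) ((h' : ℤ) • c • w) f)
        ((ε / 2) ^ 2 / 4) := by
      by_contra hcon
      exact hhB (Finset.mem_filter.2 ⟨by simp [hh, hh'], hcon⟩)
    have hsm2 := eventually_GU_zero.1 hsm'
    rw [boxAvg] at hsm2
    refine Eventually.of_forall fun N => le_trans ?_ hsm2
    gcongr
    refine norm_avg_le (I N) (norm_nonneg _) fun n _ => (huf _ _).trans_eq ?_
    simp only [mderiv]
    rw [key, key, hq.diff_one, sub_smul]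
  | succ e ih =>
    rw [tendsto_order]
    refine ⟨fun a ha => Eventually.of_forall fun N => ha.trans_le (nsq_nonneg _), fun ε hε => ?_⟩
    obtain ⟨R, hR⟩ := exists_nat_gt (4 / ε)
    have hR0' : (0 : ℝ) < R := lt_trans (by positivity) hR
    have hR0 : 0 < R := by exact_mod_cast hR0'
    refine (vanDerCorput (μ := ρ) hI hu η hR0 (fun h h' => if h = h' then 1 else ε / 4)
      (ρ := ε / 2) ?_ ?_).mono fun N hN => hN.trans_lt (by linarith)
    · intro h _ h' _
      split_ifs with hh
      · refine Eventually.of_forall fun N => norm_avg_le (I N) zero_le_one fun n _ => ?_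
        exact ((hu _).mul (hu _).conj).norm_integral_le
      · have hd := hq.diff (h : ℤ) (h' : ℤ)
        rw [smul_smul] at hd
        set D : (Fin L → ℤ) → V := fun n => q (n + (h : ℤ) • η) - q (n + (h' : ℤ) • η) with hD
        have hne : ((h : ℤ) - h') * c ≠ 0 := mul_ne_zero (by omega) hc
        choose a ha hab using fun n => exists_phase (∫ x, f (T (D n) x) * (starRingEnd ℂ) (f x) ∂μ)
        have h1 := ih (Z := X) (ρ := μ) hne hd (u := fun n x => a n * f (T (D n) x))
          (fun n => (B1.const (ha n)).mul (hf.act hT _)) (by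
            intro n n'
            have : ∀ x, a n * f (T (D n) x) * (starRingEnd ℂ) (a n' * f (T (D n') x)) =
                (a n * (starRingEnd ℂ) (a n')) *
                  (f (T (D n) x) * (starRingEnd ℂ) (f (T (D n') x))) := fun x => by
              rw [map_mul]; ring
            simp only [this]
            rw [integral_const_mul, norm_mul]
            refine mul_le_of_le_one_left (norm_nonneg _) ?_
            rw [norm_mul, RCLike.norm_conj]
            exact mul_le_one₀ (ha _) (norm_nonneg _) (ha _))
        filter_upwards [h1.eventually_lt_const (show (0 : ℝ) < (ε / 4) ^ 2 by positivity)] with N hN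
        have hB : ∀ n, B1 fun x => a n * f (T (D n) x) := fun n =>
          (B1.const (ha n)).mul (hf.act hT _)
        have h2 := (norm_integral_sq_le_nsq (μ := μ) (B1.avg (I N) hB) hf.conj).trans hN.le
        have h3 := (pow_le_pow_iff_left₀ (norm_nonneg _) (by positivity) two_ne_zero).1 h2
        refine le_trans ?_ h3
        have h4 : ∫ x, (avg (I N) fun n => a n * f (T (D n) x)) * (starRingEnd ℂ) (f x) ∂μ =
            avg (I N) fun n => ((‖∫ x, f (T (D n) x) * (starRingEnd ℂ) (f x) ∂μ‖ : ℝ) : ℂ) := by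
          simp only [← avg_mul_right]
          rw [integral_avg (I N) fun n => ((hB n).mul hf.conj).integrable]
          refine avg_congr fun n _ => ?_
          rw [hab n, ← integral_const_mul]
          simp only [mul_assoc]
        rw [h4]
        simp only [avg, norm_mul, ← Complex.ofReal_sum, Complex.norm_real]
        gcongr
        refine (norm_sum_le _ _).trans ?_
        rw [Real.norm_of_nonneg (Finset.sum_nonneg fun _ _ => norm_nonneg _)]
        refine Finset.sum_le_sum fun n _ => (huf _ _).trans_eq ?_
        rw [key]
    · have h1 : ∑ h ∈ range R, ∑ h' ∈ range R, (if h = h' then (1 : ℝ) else ε / 4) ≤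
          R + R * R * (ε / 4) := by
        calc _ ≤ ∑ h ∈ range R, ∑ h' ∈ range R, ((if h = h' then (1 : ℝ) else 0) + ε / 4) := by
              gcongr
              split_ifs <;> linarith
          _ = _ := by
              simp only [Finset.sum_add_distrib, Finset.sum_ite_eq, Finset.sum_const,
                Finset.card_range, nsmul_eq_mul, Finset.mem_range]
              rw [Finset.sum_congr rfl fun i hi => if_pos (Finset.mem_range.1 hi)]
              simp
              ring
      calc _ ≤ (R : ℝ)⁻¹ * (R : ℝ)⁻¹ * (R + R * R * (ε / 4)) := by gcongr
        _ = 1 / R + ε / 4 := by field_simp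
        _ < ε / 2 := by
          have : 1 / (R : ℝ) < ε / 4 := by
            rw [div_lt_iff₀ hε] at hR
            rw [div_lt_iff₀ hR0']
            linarith
          linarith

end Linear

section LinearVanishing

universe u₁

variable {X Z : Type u₁} {V : Type*} [MeasurableSpace X] [MeasurableSpace Z] [AddCommGroup V]
  {μ : Measure X} [IsProbabilityMeasure μ] {ρ : Measure Z} [IsProbabilityMeasure ρ] {T : V → X → X}
  {L : ℕ}

/-- A function orthogonal to all eigenfunctions is small along every ergodic direction. -/
theorem isSmall_singleton_of_orthogonal (hT : IsMPAction μ T) {w : V} (hw : InvConst μ T w)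
    {g : X → ℂ} (hg : B1 g)
    (horth : ∀ χ l, IsEig μ T χ l → ∫ x, g x * (starRingEnd ℂ) (χ x) ∂μ = 0) {δ : ℝ}
    (hδ : 0 < δ) : IsSmall μ T [w] g δ := by
  by_contra hcon
  rw [IsSmall, ← Ultrafilter.eventually_not, List.length_singleton, eventually_GU_succ] at hcon
  simp only [eventually_GU_zero, not_le] at hcon
  obtain ⟨χ, l, hχ, hle⟩ := exists_isEig_correlation hT hw hg hδ (hcon.mono fun _ h => h.le)
  rw [horth _ _ hχ, norm_zero] at hle
  linarith

/-- Averages depending linearly on a function `f` of zero integral through the iterates `T (q n)`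
vanish as soon as this holds for nontrivial eigenfunctions. -/
theorem tendsto_nsq_of_isEig (hT : IsMPAction μ T) {w : V} (hw : InvConst μ T w)
    {η : Fin L → ℤ} {I : ℕ → Finset (Fin L → ℤ)} (hI : IsFolner L I) {e : ℕ} {c : ℤ} (hc : c ≠ 0)
    {q : (Fin L → ℤ) → V} (hq : HasLead η (e + 1) (c • w) q)
    {u : (X → ℂ) → (Fin L → ℤ) → Z → ℂ} {K : (Fin L → ℤ) → (Fin L → ℤ) → ℂ}
    (hu : ∀ f, B1 f → ∀ n, B1 (u f n)) (hK : ∀ n n', ‖K n n'‖ ≤ 1)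
    (huK : ∀ f b, B1 f → B1 b → ∀ n n', ∫ z, u f n z * (starRingEnd ℂ) (u b n' z) ∂ρ =
      K n n' * ∫ x, f (T (q n) x) * (starRingEnd ℂ) (b (T (q n') x)) ∂μ)
    (heig : ∀ χ l, IsEig μ T χ l → l ≠ 1 →
      Tendsto (fun N => nsq ρ fun z => avg (I N) fun n => u χ n z) atTop (nhds 0))
    {f : X → ℂ} (hf : B1 f) (hf0 : ∫ x, f x ∂μ = 0) :
    Tendsto (fun N => nsq ρ fun z => avg (I N) fun n => u f n z) atTop (nhds 0) := by
  set A : (X → ℂ) → ℕ → Z → ℂ := fun b N z => avg (I N) fun n => u b n z with hA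
  have hA1 : ∀ {b}, B1 b → ∀ N, B1 (A b N) := fun hb N => B1.avg (I N) fun n => hu _ hb n
  change Tendsto (fun N => nsq ρ (A f N)) atTop (nhds 0)
  by_contra hcon
  obtain ⟨ε, hε, hfreq⟩ : ∃ ε : ℝ, 0 < ε ∧ ∃ᶠ N in atTop, ε < nsq ρ (A f N) := by
    by_contra h
    push Not at h
    refine hcon (tendsto_order.2 ⟨fun a ha => Eventually.of_forall fun N =>
      ha.trans_le (nsq_nonneg _), fun a ha => ?_⟩)
    have := h (a / 2) (half_pos ha)
    filter_upwards [this] with N hN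
    linarith
  have hne : (atTop ⊓ 𝓟 {N | ε < nsq ρ (A f N)}).NeBot := frequently_mem_iff_neBot.1 hfreq
  set 𝒱 : Ultrafilter ℕ := Ultrafilter.of (atTop ⊓ 𝓟 {N | ε < nsq ρ (A f N)}) with h𝒱
  have hV := Ultrafilter.of_le (atTop ⊓ 𝓟 {N | ε < nsq ρ (A f N)})
  have hVtop : (𝒱 : Filter ℕ) ≤ atTop := hV.trans inf_le_left
  have hVε : ∀ᶠ N in (𝒱 : Filter ℕ), ε < nsq ρ (A f N) :=
    (hV.trans inf_le_right) (mem_principal_self _)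
  set D : ℕ → X → ℂ := fun N x => avg (I N) fun n => avg (I N) fun n' =>
    K n' n * f (T (q n' - q n) x) with hD
  have hD1 : ∀ N, B1 (D N) := fun N => B1.avg (I N) fun n => B1.avg (I N) fun n' =>
    (B1.const (hK _ _)).mul (hf.act hT _)
  obtain ⟨g, hg, hlim⟩ := exists_weak_ulim (μ := μ) D hD1 𝒱
  have hDA : ∀ N b, B1 b → ∫ x, D N x * (starRingEnd ℂ) (b x) ∂μ =
      ∫ z, A f N z * (starRingEnd ℂ) (A b N z) ∂ρ := by
    intro N b hb
    simp only [hD, hA, ← avg_conj, ← avg_mul_right, ← avg_mul_left]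
    rw [integral_avg (I N) fun n => (B1.avg (I N) fun n' =>
        ((B1.const (hK n' n)).mul (hf.act hT (q n' - q n))).mul hb.conj).integrable,
      integral_avg (I N) fun n => (B1.avg (I N) fun n' =>
        ((hu f hf n').mul (hu b hb n).conj)).integrable]
    refine avg_congr fun n _ => ?_
    rw [integral_avg (I N) fun n' =>
        (((B1.const (hK n' n)).mul (hf.act hT (q n' - q n))).mul hb.conj).integrable,
      integral_avg (I N) fun n' => ((hu f hf n').mul (hu b hb n).conj).integrable]
    refine avg_congr fun n' _ => ?_
    rw [huK f b hf hb, ← integral_const_mul, ← hT.integral_comp (q n)]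
    simp only [hT.apply_add, sub_add_cancel, mul_assoc]
  have horth : ∀ χ l, IsEig μ T χ l → ∫ x, g x * (starRingEnd ℂ) (χ x) ∂μ = 0 := by
    intro χ l hχ
    refine tendsto_nhds_unique (hlim _ hχ.b1.conj) ?_
    by_cases hl : l = 1
    · obtain ⟨a, -, ha⟩ := hχ.ae_const hw (by rw [hl, Pi.one_apply])
      have h0 : ∀ N, ∫ x, D N x * (starRingEnd ℂ) (χ x) ∂μ = 0 := by
        intro N
        have h1 : ∫ x, D N x * (starRingEnd ℂ) (χ x) ∂μ =
            (∫ x, D N x ∂μ) * (starRingEnd ℂ) a := by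
          rw [← integral_mul_const]
          refine integral_congr_ae ?_
          filter_upwards [ha] with x hx
          rw [hx]
        have h2 : ∫ x, D N x ∂μ = 0 := by
          simp only [hD]
          rw [integral_avg (I N) fun n => (B1.avg (I N) fun n' =>
            ((B1.const (hK n' n)).mul (hf.act hT (q n' - q n)))).integrable]
          simp only [integral_avg (I N) fun n' =>
            ((B1.const (hK n' _)).mul (hf.act hT (q n' - q _))).integrable, integral_const_mul,
            hT.integral_comp, hf0, mul_zero]
          simp [avg]
        rw [h1, h2, zero_mul]
      simp only [h0]
      exact tendsto_const_nhds
    · have h1 := ((heig χ l hχ hl).mono_left hVtop).sqrt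
      rw [Real.sqrt_zero] at h1
      refine squeeze_zero_norm (fun N => ?_) h1
      rw [hDA N _ hχ.b1]
      refine Real.le_sqrt_of_sq_le ?_
      have h2 := norm_integral_sq_le_nsq (μ := ρ) (hA1 hχ.b1 N).conj (hA1 hf N)
      have h3 : nsq ρ (fun x => (starRingEnd ℂ) (A χ N x)) = nsq ρ (A χ N) := by
        simp only [nsq, RCLike.norm_conj]
      rw [h3] at h2
      simpa only [mul_comm] using h2
  have hAg : Tendsto (fun N => nsq ρ (A g N)) atTop (nhds 0) :=
    tendsto_nsq_of_correlation_le hT hg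
      (fun δ hδ => isSmall_singleton_of_orthogonal hT hw hg horth hδ) hI hc hq (hu g hg)
      fun n n' => by
        rw [huK g g hg hg, norm_mul]
        exact mul_le_of_le_one_left (norm_nonneg _) (hK _ _)
  have h1 : ε ≤ ‖∫ x, g x * (starRingEnd ℂ) (f x) ∂μ‖ := by
    refine ge_of_tendsto (hlim _ hf.conj).norm ?_
    filter_upwards [hVε] with N hN
    rw [hDA N _ hf, integral_mul_conj_self, Complex.norm_real, Real.norm_of_nonneg (nsq_nonneg _)]
    exact hN.le
  have h2 : ε ^ 2 ≤ nsq μ g :=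
    (pow_le_pow_left₀ hε.le h1 2).trans (norm_integral_sq_le_nsq hg hf.conj)
  have h3 : ∫ x, g x * (starRingEnd ℂ) (g x) ∂μ = 0 := by
    refine tendsto_nhds_unique (hlim _ hg.conj) ?_
    have h1 := (hAg.mono_left hVtop).sqrt
    rw [Real.sqrt_zero] at h1
    refine squeeze_zero_norm (fun N => ?_) h1
    rw [hDA N _ hg]
    refine Real.le_sqrt_of_sq_le ?_
    have h2 := norm_integral_sq_le_nsq (μ := ρ) (hA1 hg N).conj (hA1 hf N)
    have h3 : nsq ρ (fun x => (starRingEnd ℂ) (A g N x)) = nsq ρ (A g N) := by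
      simp only [nsq, RCLike.norm_conj]
    rw [h3] at h2
    simpa only [mul_comm] using h2
  rw [integral_mul_conj_self, Complex.ofReal_eq_zero] at h3
  rw [h3] at h2
  have : 0 < ε ^ 2 := by positivity
  linarith

end LinearVanishing

section JointToDifferences

universe u₁

variable {X : Type u₁} [MeasurableSpace X] {μ : Measure X} [IsProbabilityMeasure μ] {d L k : ℕ}
  {T : (Fin d → ℤ) → X → X}

theorem tendsto_integral_of_eLpNorm_sub {F : ℕ → X → ℂ} {c : ℂ} (hF : ∀ N, B1 (F N))
    (h : Tendsto (fun N => eLpNorm (fun x => F N x - c) 2 μ) atTop (nhds 0)) :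
    Tendsto (fun N => ∫ x, F N x ∂μ) atTop (nhds c) := by
  have h1 : Tendsto (fun N => ∫ x, F N x ∂μ) atTop (nhds (∫ _, c ∂μ)) := by
    refine tendsto_integral_of_L1' (fun _ => c) aestronglyMeasurable_const
      (Eventually.of_forall fun N => (hF N).integrable) ?_
    refine tendsto_of_tendsto_of_tendsto_of_le_of_le tendsto_const_nhds h (fun _ => zero_le)
      fun N => ?_
    exact eLpNorm_le_eLpNorm_of_exponent_le (by norm_num)
      ((hF N).1.sub_const c).aestronglyMeasurable
  simpa using h1

theorem exists_b1_center {f : X → ℂ} (hf : Measurable f) (hb : ∃ C : ℝ, ∀ x, ‖f x‖ ≤ C) :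
    ∃ (c : ℂ) (g : X → ℂ), B1 g ∧ ∫ x, g x ∂μ = 0 ∧ ∀ x, f x = c * g x + ∫ y, f y ∂μ := by
  obtain ⟨C, hC⟩ := hb
  obtain ⟨c, g, hg, hfg⟩ := exists_b1_scale (f := fun x => f x - ∫ y, f y ∂μ) (hf.sub_const _)
    ⟨C + ‖∫ y, f y ∂μ‖, fun x => (norm_sub_le _ _).trans (by gcongr; exact hC x)⟩
  rcases eq_or_ne c 0 with rfl | hc
  · refine ⟨0, fun _ => 0, B1.const (by simp), by simp, fun x => ?_⟩
    have := congrFun hfg x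
    rw [zero_mul, sub_eq_zero] at this
    rw [zero_mul, zero_add, this]
  · refine ⟨c, g, hg, ?_, fun x => ?_⟩
    · have h1 : ∫ x, (f x - ∫ y, f y ∂μ) ∂μ = 0 := by
        rw [integral_sub (Integrable.of_bound hf.aestronglyMeasurable C (ae_of_all _ hC))
          (integrable_const _)]
        simp
      rw [hfg, integral_const_mul] at h1
      exact (mul_eq_zero.1 h1).resolve_left hc
    · rw [← congrFun hfg x, sub_add_cancel]

theorem JointlyErgodic.ergodicSeq {q : Fin k → (Fin L → ℤ) → Fin d → ℤ}
    (h : JointlyErgodic μ T q) (i : Fin k) : ErgodicSeq μ T (q i) := by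
  classical
  intro f hf hfb I hI
  have h1 := h (Function.update (fun _ _ => 1) i f) (fun j => by
    rcases eq_or_ne j i with rfl | hj
    · simpa using hf
    · simp [hj]) (fun j => by
    rcases eq_or_ne j i with rfl | hj
    · simpa using hfb
    · exact ⟨1, by simp [hj]⟩) I hI
  have h2 : ∀ n x, ∏ j, Function.update (fun _ _ => (1 : ℂ)) i f j (T (q j n) x) =
      f (T (q i n) x) := by
    intro n x
    rw [Finset.prod_eq_single i (fun j _ hj => by simp [hj]) (by simp)]
    simp
  have h3 : ∏ j, ∫ y, Function.update (fun _ _ => (1 : ℂ)) i f j y ∂μ = ∫ y, f y ∂μ := by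
    rw [Finset.prod_eq_single i (fun j _ hj => by simp [hj]) (by simp)]
    simp
  simpa only [h2, h3] using h1

/-- Joint ergodicity controls the correlations along differences of two iterates. -/
theorem JointlyErgodic.tendsto_avg_integral (hT : IsMPAction μ T)
    {q : Fin k → (Fin L → ℤ) → Fin d → ℤ} (h : JointlyErgodic μ T q) {i j : Fin k} (hij : i ≠ j)
    {f g : X → ℂ} (hf : B1 f) (hg : B1 g) {I : ℕ → Finset (Fin L → ℤ)} (hI : IsFolner L I) :
    Tendsto (fun N => avg (I N) fun n => ∫ x, f (T (q i n - q j n) x) * g x ∂μ) atTop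
      (nhds ((∫ x, f x ∂μ) * ∫ x, g x ∂μ)) := by
  classical
  set F : Fin k → X → ℂ := Function.update (Function.update (fun _ _ => 1) j g) i f with hFdef
  have hF : ∀ l, B1 (F l) := by
    intro l
    by_cases hl : l = i
    · subst hl; simpa [hFdef] using hf
    · by_cases hl' : l = j
      · subst hl'; simpa [hFdef, hl] using hg
      · simpa [hFdef, hl, hl'] using B1.one
  have hprod : ∀ a : Fin k → (X → ℂ) → ℂ, (∀ l, a l (fun _ => 1) = 1) →
      ∏ l, a l (F l) = a i f * a j g := by
    intro a ha
    rw [← Finset.mul_prod_erase _ _ (mem_univ i),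
      ← Finset.mul_prod_erase _ _ (mem_erase.2 ⟨hij.symm, mem_univ j⟩),
      Finset.prod_eq_one fun l hl => ?_]
    · simp [hFdef, hij.symm]
    · simp only [mem_erase] at hl
      simp [hFdef, hl.1, hl.2.1, ha]
  have h1 := h F (fun l => (hF l).1) (fun l => ⟨1, (hF l).2⟩) I hI
  have h2 : ∀ n x, ∏ l, F l (T (q l n) x) = f (T (q i n) x) * g (T (q j n) x) := fun n x =>
    hprod (fun l b => b (T (q l n) x)) fun _ => rfl
  have h3 := hprod (fun _ b => ∫ y, b y ∂μ) (fun _ => by simp)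
  simp only [h2] at h1
  rw [h3] at h1
  have h4 : ∀ n, B1 fun x => f (T (q i n) x) * g (T (q j n) x) := fun n =>
    (hf.act hT _).mul (hg.act hT _)
  have h5 := tendsto_integral_of_eLpNorm_sub
    (F := fun N x => avg (I N) fun n => f (T (q i n) x) * g (T (q j n) x))
    (fun N => B1.avg (I N) h4) h1
  refine h5.congr fun N => ?_
  rw [integral_avg (I N) fun n => (h4 n).integrable]
  refine avg_congr fun n _ => ?_
  rw [← hT.integral_comp (q j n) fun x => f (T (q i n - q j n) x) * g x]
  simp only [hT.apply_add, sub_add_cancel]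

theorem InvConst.of_jointlyErgodic (hT : IsMPAction μ T)
    {q : Fin k → (Fin L → ℤ) → Fin d → ℤ} (h : JointlyErgodic μ T q) {i j : Fin k} (hij : i ≠ j)
    {w : Fin d → ℤ} (hq : ∀ n, ∃ r : ℤ, (q i n - q j n) - (q i 0 - q j 0) = r • w) :
    InvConst μ T w := by
  intro f hf hinv
  obtain ⟨I, hI⟩ := exists_isFolner L
  have hq' : ∀ n, ∀ᵐ x ∂μ, f (T (q i n - q j n) x) = f (T (q i 0 - q j 0) x) := by
    intro n
    obtain ⟨r, hr⟩ := hq n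
    filter_upwards [ae_comp hT (ae_zsmul_of_inv hT hinv r) (q i 0 - q j 0)] with x hx
    rw [← hx, hT.apply_add, ← hr, sub_add_cancel]
  have h1 := h.tendsto_avg_integral hT hij hf (hf.act hT (q i 0 - q j 0)).conj hI
  have h2 : ∀ N, (avg (I N) fun n => ∫ x, f (T (q i n - q j n) x) *
      (starRingEnd ℂ) (f (T (q i 0 - q j 0) x)) ∂μ) = ((nsq μ f : ℝ) : ℂ) := by
    intro N
    rw [← avg_const (hI.1 N) ((nsq μ f : ℝ) : ℂ)]
    refine avg_congr fun n _ => ?_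
    rw [← hT.nsq_comp (q i 0 - q j 0), ← integral_mul_conj_self]
    refine integral_congr_ae ?_
    filter_upwards [hq' n] with x hx
    rw [hx]
  simp only [h2] at h1
  have h3 := tendsto_nhds_unique tendsto_const_nhds h1
  set a := ∫ x, f x ∂μ with ha
  have h4 : ∫ x, (starRingEnd ℂ) (f (T (q i 0 - q j 0) x)) ∂μ = (starRingEnd ℂ) a := by
    rw [hT.integral_comp (q i 0 - q j 0) fun x => (starRingEnd ℂ) (f x), integral_conj]
  rw [h4] at h3
  have h5 : nsq μ (fun x => f x - a) = 0 := by
    rw [← Complex.ofReal_eq_zero, ← integral_mul_conj_self]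
    have h6 : ∀ x, (f x - a) * (starRingEnd ℂ) (f x - a) = f x * (starRingEnd ℂ) (f x) -
        (starRingEnd ℂ) a * f x - a * (starRingEnd ℂ) (f x) + a * (starRingEnd ℂ) a := by
      intro x
      rw [map_sub]; ring
    simp only [h6]
    have i1 : Integrable (fun x => f x * (starRingEnd ℂ) (f x)) μ := (hf.mul hf.conj).integrable
    have i2 : Integrable (fun x => (starRingEnd ℂ) a * f x) μ := hf.integrable.const_mul _
    have i3 : Integrable (fun x => a * (starRingEnd ℂ) (f x)) μ := hf.conj.integrable.const_mul _
    have i4 : Integrable (fun x => f x * (starRingEnd ℂ) (f x) - (starRingEnd ℂ) a * f x) μ :=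
      i1.sub i2
    have i5 : Integrable (fun x => f x * (starRingEnd ℂ) (f x) - (starRingEnd ℂ) a * f x -
      a * (starRingEnd ℂ) (f x)) μ := i4.sub i3
    rw [integral_add i5 (integrable_const _), integral_sub i4 i3,
      integral_sub i1 i2, integral_const_mul, integral_const_mul, integral_conj,
      integral_mul_conj_self, h3, ← ha]
    simp
    ring
  refine ⟨a, ?_⟩
  have h6 : Integrable (fun x => ‖f x - a‖ ^ 2) μ :=
    Integrable.of_bound ((hf.1.sub_const a).norm.pow_const 2).aestronglyMeasurable
      ((1 + ‖a‖) ^ 2) (ae_of_all _ fun x => by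
        rw [Real.norm_of_nonneg (by positivity)]
        gcongr
        exact (norm_sub_le _ _).trans (by gcongr; exact hf.2 x))
  have h7 := (integral_eq_zero_iff_of_nonneg (fun x => by positivity) h6).1 h5
  filter_upwards [h7] with x hx
  simpa [sub_eq_zero] using hx

variable {P : Fin k → (Fin L → ℤ) → ℤ} {v : Fin k → Fin d → ℤ}
  {Q : Fin k → MvPolynomial (Fin L) ℚ}

/-- Differences of two iterates of a jointly ergodic family have an ergodic leading direction. -/
theorem JointlyErgodic.exists_hasLead (hT : IsMPAction μ T)
    (hrep : ∀ i, RepresentedBy₁ (P i) (Q i))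
    (hnc : ∀ i, ∃ n m : Fin L → ℤ, P i n • v i ≠ P i m • v i)
    (hed : ∀ i j, i ≠ j → ∃ n m : Fin L → ℤ,
      P i n • v i - P j n • v j ≠ P i m • v i - P j m • v j)
    (hdep : ∀ i j, i ≠ j → (Q i).totalDegree = (Q j).totalDegree →
      (∃ a b : ℤ, (a, b) ≠ (0, 0) ∧ a • v i + b • v j = 0) ∨
      (∃ a b : ℤ, (a, b) ≠ (0, 0) ∧
        ∀ n m : Fin L → ℤ, a * P i n + b * P j n = a * P i m + b * P j m))
    (h : JointlyErgodic μ T fun i n => P i n • v i) {i j : Fin k} (hij : i ≠ j) :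
    ∃ (w : Fin d → ℤ) (η : Fin L → ℤ) (e : ℕ) (c : ℤ), InvConst μ T w ∧ c ≠ 0 ∧
      HasLead η (e + 1) (c • w) fun n => P i n • v i - P j n • v j := by
  wlog hle : (Q j).totalDegree ≤ (Q i).totalDegree generalizing i j
  · obtain ⟨w, η, e, c, hw, hc, hlead⟩ := this hij.symm (not_le.1 hle).le
    refine ⟨w, η, e, -c, hw, neg_ne_zero.2 hc, ?_⟩
    simpa using hlead.map negAddMonoidHom
  have hv : v i ≠ 0 := by
    obtain ⟨n, n', h⟩ := hnc i
    intro h0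
    simp [h0] at h
  obtain ⟨u, a, ha, hva, hu⟩ := exists_primitive hv
  have huinv : InvConst μ T u := (InvConst.of_ergodicSeq hT (h.ergodicSeq i)) fun n =>
    ⟨(P i n - P i 0) * a, by rw [mul_smul, ← hva, sub_smul]⟩
  obtain ⟨kind, R, hR, hne, htop, hpt⟩ := exists_pointKind (hrep i) (hrep j) ha hva hu (hnc i)
    (hnc j) (hed i j hij) hle fun h => hdep i j hij h.symm
  obtain ⟨n₁, n₂, hn12⟩ := hnc i
  have hP12 : P i n₁ ≠ P i n₂ := fun h => hn12 (by rw [h])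
  obtain ⟨η, hη⟩ := exists_evalInt_ne_zero
    (mul_ne_zero (homogeneousComponent_totalDegree_ne_zero ((hrep i).ne_zero hP12)) hR)
  simp only [evalInt, map_mul] at hη
  obtain ⟨c, hc, hok⟩ := hpt η (left_ne_zero_of_mul hη) (right_ne_zero_of_mul hη)
  obtain ⟨e, he⟩ := Nat.exists_eq_add_of_le' ((hrep i).totalDegree_pos hP12)
  cases kind with
  | none => exact absurd rfl hne
  | par e' =>
    obtain ⟨h1, -, h2⟩ := hok
    obtain ⟨e'', rfl⟩ := Nat.exists_eq_add_of_le' h1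
    exact ⟨u, η, e'', c, huinv, hc, h2⟩
  | low e' => exact ⟨u, η, e, c, huinv, hc, he ▸ hok.2.1⟩
  | top w =>
    refine ⟨w, η, e, c, ?_, hc, he ▸ hok.2⟩
    rcases htop w rfl with rfl | ⟨-, hr⟩
    · exact huinv
    · exact InvConst.of_jointlyErgodic hT h hij hr

/-- Joint ergodicity implies ergodicity of all differences. -/
theorem JointlyErgodic.ergodicSeq_sub (hT : IsMPAction μ T)
    (hrep : ∀ i, RepresentedBy₁ (P i) (Q i))
    (hnc : ∀ i, ∃ n m : Fin L → ℤ, P i n • v i ≠ P i m • v i)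
    (hed : ∀ i j, i ≠ j → ∃ n m : Fin L → ℤ,
      P i n • v i - P j n • v j ≠ P i m • v i - P j m • v j)
    (hdep : ∀ i j, i ≠ j → (Q i).totalDegree = (Q j).totalDegree →
      (∃ a b : ℤ, (a, b) ≠ (0, 0) ∧ a • v i + b • v j = 0) ∨
      (∃ a b : ℤ, (a, b) ≠ (0, 0) ∧
        ∀ n m : Fin L → ℤ, a * P i n + b * P j n = a * P i m + b * P j m))
    (h : JointlyErgodic μ T fun i n => P i n • v i) {i j : Fin k} (hij : i ≠ j) :
    ErgodicSeq μ T fun n => P i n • v i - P j n • v j := by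
  obtain ⟨w, η, e, c, hw, hc, hlead⟩ := h.exists_hasLead hT hrep hnc hed hdep hij
  intro f hf hfb I hI
  obtain ⟨a, g, hg, hg0, hfg⟩ := exists_b1_center (μ := μ) hf hfb
  set D : (Fin L → ℤ) → Fin d → ℤ := fun n => P i n • v i - P j n • v j with hD
  have hav : ∀ N x, (((I N).card : ℂ))⁻¹ * (∑ n ∈ I N, f (T (D n) x)) - ∫ y, f y ∂μ =
      a * avg (I N) fun n => g (T (D n) x) := by
    intro N x
    change avg (I N) (fun n => f (T (D n) x)) - _ = _
    rw [avg_congr fun n _ => hfg _, avg_add, avg_mul_left, avg_const (hI.1 N), add_sub_cancel_right]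
  refine Tendsto.congr
    (fun N => congrArg (fun F => eLpNorm F 2 μ) (funext fun x => (hav N x).symm)) ?_
  refine tendsto_eLpNorm_const_mul a ?_
  rw [tendsto_eLpNorm_iff fun N => (B1.avg (I N) fun n => hg.act hT _).memLp 2]
  refine tendsto_nsq_of_isEig hT hw hI hc hlead (u := fun b n x => b (T (D n) x))
    (K := fun _ _ => 1) (fun b hb n => hb.act hT _) (by simp) (by simp) ?_ hg hg0
  intro χ l hχ hl
  have h1 := h.tendsto_avg_integral hT hij hχ.b1 hχ.b1.conj hI
  rw [hχ.integral_eq_zero hT hl, zero_mul] at h1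
  have h2 : ∀ n, ∫ x, χ (T (D n) x) * (starRingEnd ℂ) (χ x) ∂μ = l (D n) := by
    intro n
    rw [integral_congr_ae (g := fun _ => l (D n))]
    · simp
    · filter_upwards [hχ.2.2 (D n)] with x hx
      rw [hx, mul_assoc, Complex.mul_conj, Complex.normSq_eq_norm_sq, hχ.2.1]
      simp
  replace h1 : Tendsto (fun N => avg (I N) fun n => l (D n)) atTop (nhds 0) :=
    h1.congr fun N => avg_congr fun n _ => h2 n
  have h3 : ∀ N, nsq μ (fun x => avg (I N) fun n => χ (T (D n) x)) =
      ‖avg (I N) fun n => l (D n)‖ ^ 2 := by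
    intro N
    have h4 : ∀ᵐ x ∂μ, ∀ n, χ (T (D n) x) = l (D n) * χ x := ae_all_iff.2 fun n => hχ.2.2 _
    rw [nsq, integral_congr_ae (g := fun _ => ‖avg (I N) fun n => l (D n)‖ ^ 2)]
    · simp
    · filter_upwards [h4] with x hx
      simp only [hx, avg_mul_right, norm_mul, hχ.2.1, mul_one]
  simp only [h3]
  simpa using h1.norm.pow 2

end JointToDifferences

section MeanErgodic

variable {Z G : Type*} [MeasurableSpace Z] {ρ : Measure Z} [IsProbabilityMeasure ρ]
  {S : G → Z → Z} {I : ℕ → Finset G}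

/-- Convergence in `L²` of the averages of `F` along the maps `S n` to the integral of `F`. -/
def MeanErg (ρ : Measure Z) (S : G → Z → Z) (I : ℕ → Finset G) (F : Z → ℂ) : Prop :=
  Tendsto (fun N => eLpNorm (fun z => (avg (I N) fun n => F (S n z)) - ∫ y, F y ∂ρ) 2 ρ) atTop
    (nhds 0)

omit [IsProbabilityMeasure ρ] in
theorem MemLp.avg_comp (hS : ∀ n, MeasurePreserving (S n) ρ ρ) {F : Z → ℂ} (hF : MemLp F 2 ρ)
    (J : Finset G) : MemLp (fun z => avg J fun n => F (S n z)) 2 ρ :=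
  (memLp_finsetSum J fun n _ => hF.comp_measurePreserving (hS n)).const_mul _

theorem eLpNorm_avg_sub_le (hS : ∀ n, MeasurePreserving (S n) ρ ρ) {F : Z → ℂ} (hF : MemLp F 2 ρ)
    {J : Finset G} (hJ : J.Nonempty) :
    eLpNorm (fun z => (avg J fun n => F (S n z)) - ∫ y, F y ∂ρ) 2 ρ ≤ 2 * eLpNorm F 2 ρ := by
  refine (eLpNorm_sub_le (MemLp.avg_comp hS hF J).1 aestronglyMeasurable_const
    (by norm_num)).trans ?_
  rw [two_mul]
  refine add_le_add ?_ ?_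
  · have h1 : eLpNorm (fun z => ∑ n ∈ J, F (S n z)) 2 ρ ≤ J.card * eLpNorm F 2 ρ := by
      have h2 := eLpNorm_sum_le (s := J) (f := fun n z => F (S n z)) (μ := ρ) (p := 2)
        (fun n _ => (hF.comp_measurePreserving (hS n)).1) (by norm_num)
      have h3 : ∀ n, eLpNorm (fun z => F (S n z)) 2 ρ = eLpNorm F 2 ρ := fun n =>
        eLpNorm_comp_measurePreserving hF.1 (hS n)
      simp only [h3, Finset.sum_const, nsmul_eq_mul] at h2
      convert h2 using 2
      funext z
      simp
    have h2 : eLpNorm (fun z => avg J fun n => F (S n z)) 2 ρ =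
        ‖((J.card : ℂ))⁻¹‖ₑ * eLpNorm (fun z => ∑ n ∈ J, F (S n z)) 2 ρ :=
      eLpNorm_const_smul (((J.card : ℂ))⁻¹) (fun z => ∑ n ∈ J, F (S n z)) 2 ρ
    rw [h2]
    refine (mul_le_mul_right h1 _).trans ?_
    have h0 : (J.card : ℂ) ≠ 0 := by exact_mod_cast hJ.card_pos.ne'
    have h3 : ‖(J.card : ℂ)‖ₑ = J.card := by
      rw [← ofReal_norm]; simp
    rw [← mul_assoc, enorm_inv h0, h3, ENNReal.inv_mul_cancel, one_mul]
    · exact_mod_cast hJ.card_pos.ne'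
    · simp
  · rw [eLpNorm_const _ (by simp) (IsProbabilityMeasure.ne_zero _)]
    simp only [measure_univ, ENNReal.one_rpow, mul_one]
    refine (enorm_integral_le_lintegral_enorm _).trans ?_
    rw [← eLpNorm_one_eq_lintegral_enorm]
    exact eLpNorm_le_eLpNorm_of_exponent_le (by norm_num) hF.1

theorem MeanErg.add (hS : ∀ n, MeasurePreserving (S n) ρ ρ) {F F' : Z → ℂ} (hF : MemLp F 2 ρ)
    (hF' : MemLp F' 2 ρ) (h : MeanErg ρ S I F) (h' : MeanErg ρ S I F') :
    MeanErg ρ S I fun z => F z + F' z := by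
  have h1 := Tendsto.add h h'
  rw [add_zero] at h1
  refine tendsto_of_tendsto_of_tendsto_of_le_of_le tendsto_const_nhds h1 (fun _ => zero_le)
    fun N => ?_
  refine le_trans (le_of_eq ?_) (eLpNorm_add_le
    ((MemLp.avg_comp hS hF (I N)).1.sub aestronglyMeasurable_const)
    ((MemLp.avg_comp hS hF' (I N)).1.sub aestronglyMeasurable_const) (by norm_num))
  congr 1
  funext z
  simp only [Pi.add_apply, avg_add]
  rw [integral_add (hF.integrable (by norm_num)) (hF'.integrable (by norm_num))]
  ring

omit [IsProbabilityMeasure ρ] in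
theorem MeanErg.const_mul {F : Z → ℂ} (h : MeanErg ρ S I F) (c : ℂ) :
    MeanErg ρ S I fun z => c * F z := by
  have h1 := tendsto_eLpNorm_const_mul c h
  simpa only [MeanErg, avg_mul_left, integral_const_mul, mul_sub] using h1

theorem meanErg_const (hI : ∀ N, (I N).Nonempty) (c : ℂ) : MeanErg ρ S I fun _ => c := by
  have h : ∀ N, (avg (I N) fun _ => c) = c := fun N => avg_const (hI N) c
  simp [MeanErg, h]

theorem MeanErg.sum (hS : ∀ n, MeasurePreserving (S n) ρ ρ) (hI : ∀ N, (I N).Nonempty)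
    {ι : Type*} (s : Finset ι) {F : ι → Z → ℂ} (hF : ∀ i, MemLp (F i) 2 ρ)
    (h : ∀ i ∈ s, MeanErg ρ S I (F i)) : MeanErg ρ S I fun z => ∑ i ∈ s, F i z := by
  classical
  induction s using Finset.induction_on with
  | empty => simpa using meanErg_const hI 0
  | insert a s ha ih =>
    simp only [Finset.sum_insert ha]
    exact (h a (mem_insert_self _ _)).add hS (hF a) (memLp_finsetSum s fun i _ => hF i)
      (ih fun i hi => h i (mem_insert_of_mem hi))

theorem MeanErg.of_approx (hS : ∀ n, MeasurePreserving (S n) ρ ρ) (hI : ∀ N, (I N).Nonempty)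
    {F : Z → ℂ} (hF : MemLp F 2 ρ) (h : ∀ ε : ℝ≥0∞, ε ≠ 0 → ∃ F' : Z → ℂ, MemLp F' 2 ρ ∧
      MeanErg ρ S I F' ∧ eLpNorm (fun z => F z - F' z) 2 ρ ≤ ε) : MeanErg ρ S I F := by
  refine ENNReal.tendsto_nhds_zero.2 fun ε hε => ?_
  obtain ⟨F', hF', hm, hle⟩ := h (ε / 4) (ENNReal.div_pos hε.ne' (by norm_num)).ne'
  have h1 := ENNReal.tendsto_nhds_zero.1 hm (ε / 2) (ENNReal.half_pos hε.ne')
  filter_upwards [h1] with N hN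
  have h2 := eLpNorm_avg_sub_le hS (hF.sub hF') (hI N)
  have h3 : eLpNorm (fun z => (avg (I N) fun n => F (S n z)) - ∫ y, F y ∂ρ) 2 ρ ≤
      eLpNorm (fun z => (avg (I N) fun n => (F - F') (S n z)) - ∫ y, (F - F') y ∂ρ) 2 ρ +
      eLpNorm (fun z => (avg (I N) fun n => F' (S n z)) - ∫ y, F' y ∂ρ) 2 ρ := by
    refine le_trans (le_of_eq ?_) (eLpNorm_add_le
      ((MemLp.avg_comp hS (hF.sub hF') (I N)).1.sub aestronglyMeasurable_const)
      ((MemLp.avg_comp hS hF' (I N)).1.sub aestronglyMeasurable_const) (by norm_num))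
    congr 1
    funext z
    simp only [Pi.add_apply, avg_sub, Pi.sub_apply]
    rw [integral_sub (hF.integrable (by norm_num)) (hF'.integrable (by norm_num))]
    ring
  refine h3.trans ((add_le_add (h2.trans (mul_le_mul_right hle 2)) hN).trans (le_of_eq ?_))
  have h4 : (2 : ℝ≥0∞) * (ε / 4) = ε / 2 := by
    rw [show (4 : ℝ≥0∞) = 2 * 2 by norm_num, ← mul_div_assoc,
      ENNReal.mul_div_mul_left _ _ (by norm_num) (by norm_num)]
  rw [h4, ENNReal.add_halves]

theorem memLp_indicator_one {s : Set Z} (hs : MeasurableSet s) :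
    MemLp (s.indicator fun _ => (1 : ℂ)) 2 ρ :=
  memLp_indicator_const 2 hs 1 (Or.inr (measure_ne_top _ _))

/-- Mean ergodicity of indicators of a generating `π`-system implies mean ergodicity. -/
theorem MeanErg.of_generateFrom (hS : ∀ n, MeasurePreserving (S n) ρ ρ)
    (hI : ∀ N, (I N).Nonempty) {C : Set (Set Z)}
    (hC : ‹MeasurableSpace Z› = MeasurableSpace.generateFrom C) (hpi : IsPiSystem C)
    (h : ∀ s ∈ C, MeanErg ρ S I (s.indicator fun _ => 1)) {F : Z → ℂ} (hF : MemLp F 2 ρ) :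
    MeanErg ρ S I F := by
  have hset : ∀ s : Set Z, MeasurableSet s → MeanErg ρ S I (s.indicator fun _ => (1 : ℂ)) := by
    intro s hs
    induction s, hs using MeasurableSpace.induction_on_inter hC hpi with
    | empty => simpa using meanErg_const (ρ := ρ) (S := S) hI 0
    | basic s hs => exact h s hs
    | compl s hs ih =>
      have h1 := (meanErg_const (ρ := ρ) (S := S) hI 1).add hS (memLp_const 1)
        ((memLp_indicator_one hs).const_mul (-1)) (ih.const_mul (-1))
      convert h1 using 1
      funext z
      by_cases hz : z ∈ s <;> simp [hz]
    | iUnion f hd hm ih =>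
      refine MeanErg.of_approx hS hI (memLp_indicator_one (MeasurableSet.iUnion hm))
        fun ε hε => ?_
      have h1 := tendsto_measure_biUnion_Ici_zero_of_pairwise_disjoint (μ := ρ)
        (fun i => (hm i).nullMeasurableSet) hd
      have h2 : Tendsto (fun n => (ρ (⋃ i ≥ n, f i)) ^ (1 / (2 : ℝ≥0∞).toReal)) atTop
          (nhds 0) := by
        have := h1.ennrpow_const (1 / (2 : ℝ≥0∞).toReal)
        simpa using this
      obtain ⟨n, hn⟩ := (ENNReal.tendsto_nhds_zero.1 h2 ε (pos_iff_ne_zero.2 hε)).exists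
      refine ⟨fun z => ∑ i ∈ range n, (f i).indicator (fun _ => (1 : ℂ)) z,
        memLp_finsetSum _ fun i _ => memLp_indicator_one (hm i),
        MeanErg.sum hS hI _ (fun i => memLp_indicator_one (hm i)) fun i _ => ih i, ?_⟩
      have h3 : (fun z => (⋃ i, f i).indicator (fun _ => (1 : ℂ)) z -
          ∑ i ∈ range n, (f i).indicator (fun _ => (1 : ℂ)) z) =
          (⋃ i ≥ n, f i).indicator fun _ => (1 : ℂ) := by
        funext z
        by_cases hz : ∃ i, z ∈ f i
        · obtain ⟨i, hi⟩ := hz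
          have hu : ∀ j, z ∈ f j ↔ j = i := by
            refine fun j => ⟨fun hj => ?_, fun hj => hj ▸ hi⟩
            by_contra hne
            exact Set.disjoint_left.1 (hd hne) hj hi
          by_cases hin : i < n
          · simp [Set.indicator, hu, hin]
          · simp [Set.indicator, hu, hin, not_lt.1 hin]
        · push Not at hz
          simp [Set.indicator, hz]
      rw [h3, eLpNorm_indicator_const (MeasurableSet.iUnion fun i => MeasurableSet.iUnion fun _ =>
        hm i) (by simp) (by simp)]
      simpa using hn
  refine MeanErg.of_approx hS hI hF fun ε hε => ?_
  obtain ⟨g, hg, hgm⟩ := hF.exists_simpleFunc_eLpNorm_sub_lt (by simp) hε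
  refine ⟨g, hgm, ?_, hg.le⟩
  clear hg hgm
  induction g using SimpleFunc.induction with
  | const c hs =>
    have h1 := (hset _ hs).const_mul c
    convert h1 using 1
    funext z
    simp [Set.indicator]
  | add _ hf hg =>
    exact hf.add hS (SimpleFunc.memLp_of_isFiniteMeasure _ _ _)
      (SimpleFunc.memLp_of_isFiniteMeasure _ _ _) hg

end MeanErgodic

section JointToProduct

universe u₁

variable {X : Type u₁} [MeasurableSpace X] {μ : Measure X} [IsProbabilityMeasure μ] {d L k : ℕ}
  {T : (Fin d → ℤ) → X → X}

/-- The product map `T (p 0 n) × ⋯ × T (p (k - 1) n)`. -/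
def prodMap (T : (Fin d → ℤ) → X → X) (p : Fin k → (Fin L → ℤ) → Fin d → ℤ) (n : Fin L → ℤ)
    (z : Fin k → X) : Fin k → X := fun i => T (p i n) (z i)

theorem measurePreserving_prodMap (hT : IsMPAction μ T) (p : Fin k → (Fin L → ℤ) → Fin d → ℤ)
    (n : Fin L → ℤ) : MeasurePreserving (prodMap T p n) (Measure.pi fun _ : Fin k => μ)
      (Measure.pi fun _ : Fin k => μ) :=
  measurePreserving_pi _ _ fun i => hT.mp (p i n)

theorem B1.prod_apply {f : Fin k → X → ℂ} (hf : ∀ j, B1 (f j)) :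
    B1 fun z : Fin k → X => ∏ j, f j (z j) :=
  B1.prod univ fun j _ => (hf j).comp (measurable_pi_apply j)

theorem meanErg_iff_nsq {Z G : Type*} [MeasurableSpace Z] {ρ : Measure Z} [IsProbabilityMeasure ρ]
    {S : G → Z → Z} (hS : ∀ n, Measurable (S n)) {I : ℕ → Finset G} {F : Z → ℂ} (hF : B1 F)
    (h0 : ∫ z, F z ∂ρ = 0) : MeanErg ρ S I F ↔
      Tendsto (fun N => nsq ρ fun z => avg (I N) fun n => F (S n z)) atTop (nhds 0) := by
  rw [MeanErg, h0]
  simp only [sub_zero]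
  exact tendsto_eLpNorm_iff fun N => (B1.avg (I N) fun n => hF.comp (hS n)).memLp 2

theorem integral_prod_apply (f : Fin k → X → ℂ) :
    ∫ z : Fin k → X, ∏ j, f j (z j) ∂(Measure.pi fun _ : Fin k => μ) = ∏ j, ∫ x, f j x ∂μ :=
  integral_fintype_prod_eq_prod (𝕜 := ℂ) f

theorem prod_update {ι : Type*} [DecidableEq ι] [Fintype ι] {α β : Type*} [CommMonoid β]
    (F : ι → α → β) (f : ι → α) (m : ι) (a : α) :
    ∏ j, F j (Function.update f m a j) = F m a * ∏ j ∈ univ.erase m, F j (f j) := by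
  rw [← Finset.mul_prod_erase _ _ (mem_univ m), Function.update_self]
  congr 1
  refine Finset.prod_congr rfl fun j hj => ?_
  rw [Function.update_of_ne (mem_erase.1 hj).1]

theorem eLpNorm_of_norm_eq {Z : Type*} [MeasurableSpace Z] {ρ : Measure Z} [IsProbabilityMeasure ρ]
    {F : Z → ℂ} {a : ℂ} (h : ∀ᵐ z ∂ρ, ‖F z‖ = ‖a‖) : eLpNorm F 2 ρ = ‖a‖ₑ := by
  rw [eLpNorm_congr_norm_ae (g := fun _ => a) h,
    eLpNorm_const _ (by simp) (IsProbabilityMeasure.ne_zero _)]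
  simp

/-- Joint ergodicity implies mean ergodicity of products of eigenfunctions. -/
theorem JointlyErgodic.meanErg_prod_of_isEig (hT : IsMPAction μ T)
    {p : Fin k → (Fin L → ℤ) → Fin d → ℤ} (h : JointlyErgodic μ T p)
    (hinv : Fin k → ∃ w, InvConst μ T w) {I : ℕ → Finset (Fin L → ℤ)} (hI : IsFolner L I)
    {f : Fin k → X → ℂ} {l : Fin k → (Fin d → ℤ) → ℂ} (hf : ∀ j, IsEig μ T (f j) (l j)) :
    MeanErg (Measure.pi fun _ : Fin k => μ) (prodMap T p) I fun z => ∏ j, f j (z j) := by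
  have hev : ∀ {q : Fin k → X → Prop}, (∀ j, ∀ᵐ x ∂μ, q j x) →
      ∀ᵐ z ∂(Measure.pi fun _ : Fin k => μ), ∀ j, q j (z j) := fun hq => ae_all_iff.2 fun j =>
    (measurePreserving_eval (fun _ : Fin k => μ) j).quasiMeasurePreserving.ae (hq j)
  rw [MeanErg, integral_prod_apply]
  simp only [prodMap]
  by_cases hl : ∃ j, l j ≠ 1
  · obtain ⟨j₀, hj₀⟩ := hl
    have h0 : ∏ j, ∫ x, f j x ∂μ = 0 :=
      Finset.prod_eq_zero (mem_univ j₀) ((hf j₀).integral_eq_zero hT hj₀)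
    have h1 := h f (fun j => (hf j).1) (fun j => ⟨1, fun x => ((hf j).2.1 x).le⟩) I hI
    rw [h0] at h1 ⊢
    simp only [sub_zero] at h1 ⊢
    have hn : ∀ N, ∀ y : Fin k → X, (∀ n j, f j (T (p j n) (y j)) = l j (p j n) * f j (y j)) →
        ‖avg (I N) fun n => ∏ j, f j (T (p j n) (y j))‖ = ‖avg (I N) fun n => ∏ j, l j (p j n)‖ := by
      intro N y hy
      simp only [hy, Finset.prod_mul_distrib, avg_mul_right, norm_mul, norm_prod, (hf _).2.1,
        Finset.prod_const_one, mul_one]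
    have h2 : ∀ N, eLpNorm (fun x => (((I N).card : ℂ))⁻¹ *
        ∑ n ∈ I N, ∏ j, f j (T (p j n) x)) 2 μ = ‖avg (I N) fun n => ∏ j, l j (p j n)‖ₑ := by
      intro N
      refine eLpNorm_of_norm_eq ?_
      have h3 : ∀ᵐ x ∂μ, ∀ n j, f j (T (p j n) x) = l j (p j n) * f j x :=
        ae_all_iff.2 fun n => ae_all_iff.2 fun j => (hf j).2.2 _
      filter_upwards [h3] with x hx
      exact hn N (fun _ => x) hx
    simp only [h2] at h1
    refine h1.congr fun N => (eLpNorm_of_norm_eq ?_).symm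
    have h3 : ∀ᵐ z ∂(Measure.pi fun _ : Fin k => μ), ∀ n j,
        f j (T (p j n) (z j)) = l j (p j n) * f j (z j) :=
      ae_all_iff.2 fun n => hev fun j => (hf j).2.2 _
    filter_upwards [h3] with z hz
    exact hn N z hz
  · push Not at hl
    have hc : ∀ j, ∃ c : ℂ, ∀ᵐ x ∂μ, f j x = c := by
      intro j
      obtain ⟨w, hw⟩ := hinv j
      obtain ⟨c, -, hc⟩ := (hf j).ae_const hw (by rw [hl, Pi.one_apply])
      exact ⟨c, hc⟩
    choose c hc using hc
    have h0 : ∀ j, ∫ x, f j x ∂μ = c j := by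
      intro j
      rw [integral_congr_ae (hc j)]
      simp
    have h3 : ∀ᵐ z ∂(Measure.pi fun _ : Fin k => μ), ∀ n j, f j (T (p j n) (z j)) = c j :=
      ae_all_iff.2 fun n => hev fun j => ae_comp hT (hc j) _
    have h4 : ∀ N, eLpNorm (fun z : Fin k → X => (avg (I N) fun n => ∏ j, f j (T (p j n) (z j))) -
        ∏ j, ∫ x, f j x ∂μ) 2 (Measure.pi fun _ : Fin k => μ) = 0 := by
      intro N
      rw [eLpNorm_congr_ae (g := fun _ => 0)]
      · simp
      · filter_upwards [h3] with z hz
        simp only [hz, h0]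
        rw [avg_const (hI.1 N), sub_self]
    simp only [h4]
    exact tendsto_const_nhds

theorem JointlyErgodic.meanErg_prod (hT : IsMPAction μ T)
    {p : Fin k → (Fin L → ℤ) → Fin d → ℤ} (h : JointlyErgodic μ T p)
    (hlead : ∀ i, ∃ (w : Fin d → ℤ) (η : Fin L → ℤ) (e : ℕ) (c : ℤ), InvConst μ T w ∧ c ≠ 0 ∧
      HasLead η (e + 1) (c • w) (p i))
    {I : ℕ → Finset (Fin L → ℤ)} (hI : IsFolner L I) (J : Finset (Fin k))
    {f : Fin k → X → ℂ} (hf : ∀ j, B1 (f j)) {l : Fin k → (Fin d → ℤ) → ℂ}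
    (hfl : ∀ j, j ∉ J → IsEig μ T (f j) (l j)) :
    MeanErg (Measure.pi fun _ : Fin k => μ) (prodMap T p) I fun z => ∏ j, f j (z j) := by
  classical
  induction J using Finset.induction_on generalizing f l with
  | empty =>
    exact h.meanErg_prod_of_isEig hT (fun i => by
      obtain ⟨w, -, -, -, hw, -⟩ := hlead i
      exact ⟨w, hw⟩) hI fun j => hfl j (notMem_empty j)
  | insert m J hm ih =>
    have hS := measurePreserving_prodMap (μ := μ) hT p
    have hupd : ∀ {b : X → ℂ}, B1 b → ∀ j, B1 (Function.update f m b j) := by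
      intro b hb j
      rcases eq_or_ne j m with rfl | hj
      · simpa using hb
      · simpa [hj] using hf j
    have heig : ∀ {χ : X → ℂ} {l' : (Fin d → ℤ) → ℂ}, IsEig μ T χ l' →
        MeanErg (Measure.pi fun _ : Fin k => μ) (prodMap T p) I
          fun z => ∏ j, Function.update f m χ j (z j) := by
      intro χ l' hχ
      refine ih (hupd hχ.b1) (l := Function.update l m l') fun j hj => ?_
      rcases eq_or_ne j m with rfl | hjm
      · simpa using hχ
      · simpa [hjm] using hfl j (by simp [hjm, hj])
    have h_int : ∀ {b : X → ℂ}, ∫ x, b x ∂μ = 0 → ∫ z : Fin k → X,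
        ∏ j, Function.update f m b j (z j) ∂(Measure.pi fun _ : Fin k => μ) = 0 := by
      intro b hb
      rw [integral_prod_apply]
      exact Finset.prod_eq_zero (mem_univ m) (by simpa using hb)
    obtain ⟨a, g, hg, hg0, hfg⟩ := exists_b1_center (μ := μ) (hf m).1 ⟨1, (hf m).2⟩
    obtain ⟨w, η, e, c, hw, hc, hl⟩ := hlead m
    have hgm : MeanErg (Measure.pi fun _ : Fin k => μ) (prodMap T p) I
        fun z => ∏ j, Function.update f m g j (z j) := by
      rw [meanErg_iff_nsq (fun n => (hS n).measurable) (B1.prod_apply (hupd hg)) (h_int hg0)]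
      refine tendsto_nsq_of_isEig hT hw hI hc hl
        (u := fun b n z => ∏ j, Function.update f m b j (prodMap T p n z j))
        (K := fun n n' => ∏ j ∈ univ.erase m,
          ∫ x, f j (T (p j n) x) * (starRingEnd ℂ) (f j (T (p j n') x)) ∂μ)
        (fun b hb n => (B1.prod_apply (hupd hb)).comp (hS n).measurable) (fun n n' => ?_)
        (fun b b' hb hb' n n' => ?_) (fun χ l' hχ hl' => ?_) hg hg0
      · rw [norm_prod]
        exact Finset.prod_le_one (fun _ _ => norm_nonneg _) fun j _ =>
          (((hf j).act hT _).mul ((hf j).act hT _).conj).norm_integral_le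
      · have h1 : ∀ z : Fin k → X, (∏ j, Function.update f m b j (prodMap T p n z j)) *
            (starRingEnd ℂ) (∏ j, Function.update f m b' j (prodMap T p n' z j)) =
            ∏ j, Function.update (fun j x => f j (T (p j n) x) *
              (starRingEnd ℂ) (f j (T (p j n') x))) m (fun x => b (T (p m n) x) *
              (starRingEnd ℂ) (b' (T (p m n') x))) j (z j) := by
          intro z
          rw [prod_update (fun j (b : X → ℂ) => b (prodMap T p n z j)),
            prod_update (fun j (b : X → ℂ) => b (prodMap T p n' z j)),
            prod_update (fun j (b : X → ℂ) => b (z j)), map_mul, map_prod, mul_mul_mul_comm,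
            ← Finset.prod_mul_distrib]
          rfl
        simp only [h1]
        rw [integral_prod_apply, prod_update (fun j (b : X → ℂ) => ∫ x, b x ∂μ), mul_comm]
      · rw [← meanErg_iff_nsq (fun n => (hS n).measurable) (B1.prod_apply (hupd hχ.b1))
          (h_int (hχ.integral_eq_zero hT hl'))]
        exact heig hχ
    have h1m := heig (IsEig.const (μ := μ) (T := T) (c := 1) (by simp))
    have hsum := (hgm.const_mul a).add hS (((B1.prod_apply (hupd hg)).memLp 2).const_mul a)
      (((B1.prod_apply (hupd B1.one)).memLp 2).const_mul (∫ y, f m y ∂μ))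
      (h1m.const_mul (∫ y, f m y ∂μ))
    convert hsum using 1
    funext z
    rw [prod_update (fun j (b : X → ℂ) => b (z j)), prod_update (fun j (b : X → ℂ) => b (z j)),
      ← Finset.mul_prod_erase _ _ (mem_univ m), hfg (z m)]
    ring

/-- Joint ergodicity implies ergodicity of the product. -/
theorem JointlyErgodic.prodErgodic (hT : IsMPAction μ T)
    {p : Fin k → (Fin L → ℤ) → Fin d → ℤ} (h : JointlyErgodic μ T p)
    (hlead : ∀ i, ∃ (w : Fin d → ℤ) (η : Fin L → ℤ) (e : ℕ) (c : ℤ), InvConst μ T w ∧ c ≠ 0 ∧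
      HasLead η (e + 1) (c • w) (p i)) : ProdErgodic μ T p := by
  intro F hF hFb I hI
  obtain ⟨C, hC⟩ := hFb
  refine MeanErg.of_generateFrom (S := prodMap T p) (measurePreserving_prodMap hT p) hI.1
    generateFrom_pi.symm isPiSystem_pi ?_
    (MemLp.of_bound hF.aestronglyMeasurable C (ae_of_all _ hC))
  rintro _ ⟨s, hs, rfl⟩
  have h1 := h.meanErg_prod hT hlead hI univ (f := fun j => (s j).indicator fun _ => 1)
    (fun j => ⟨measurable_const.indicator (hs j (Set.mem_univ j)), fun x => by
      by_cases hx : x ∈ s j <;> simp [hx]⟩) (l := fun _ => 1) (fun j hj => absurd (mem_univ j) hj)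
  convert h1 using 1
  funext z
  by_cases hz : z ∈ Set.univ.pi s
  · rw [Set.indicator_of_mem hz, Finset.prod_eq_one fun j _ =>
      Set.indicator_of_mem (hz j (Set.mem_univ j)) _]
  · rw [Set.indicator_of_notMem hz]
    obtain ⟨j, hj⟩ : ∃ j, z j ∉ s j := by simpa using hz
    rw [Finset.prod_eq_zero (mem_univ j) (Set.indicator_of_notMem hj _)]

variable {P : Fin k → (Fin L → ℤ) → ℤ} {v : Fin k → Fin d → ℤ}
  {Q : Fin k → MvPolynomial (Fin L) ℚ}

theorem JointlyErgodic.prodErgodic_smul (hT : IsMPAction μ T)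
    (hrep : ∀ i, RepresentedBy₁ (P i) (Q i))
    (hnc : ∀ i, ∃ n m : Fin L → ℤ, P i n • v i ≠ P i m • v i)
    (h : JointlyErgodic μ T fun i n => P i n • v i) :
    ProdErgodic μ T fun i n => P i n • v i := by
  refine h.prodErgodic hT fun i => ?_
  obtain ⟨n₁, n₂, hn12⟩ := hnc i
  have hP12 : P i n₁ ≠ P i n₂ := fun h => hn12 (by rw [h])
  obtain ⟨η, hη⟩ := exists_evalInt_ne_zero
    (homogeneousComponent_totalDegree_ne_zero ((hrep i).ne_zero hP12))
  obtain ⟨c, hc, hlead⟩ := (hrep i).exists_hasLead hη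
  obtain ⟨e, he⟩ := Nat.exists_eq_add_of_le' ((hrep i).totalDegree_pos hP12)
  have hv : v i ≠ 0 := by
    intro h0
    simp [h0] at hn12
  obtain ⟨u, a, ha, hva, -⟩ := exists_primitive hv
  refine ⟨u, η, e, c * a, InvConst.of_ergodicSeq hT (h.ergodicSeq i) fun n =>
    ⟨(P i n - P i 0) * a, by rw [mul_smul, ← hva, sub_smul]⟩, mul_ne_zero hc ha, ?_⟩
  rw [mul_smul, ← hva, ← he]
  exact hlead.smul (v i)

end JointToProduct

/-- **Theorem.** Joint ergodicity criterion for iterates `P_i(n)·v_i`, under the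
dependence assumption on polynomials of equal degree: (C1) ↔ (C2') and (C2') ↔ (C2). -/
theorem stmt1 {X : Type*} [MeasurableSpace X] (μ : Measure X) [IsProbabilityMeasure μ]
    (d k L : ℕ) (hd : 0 < d) (hk : 0 < k) (hL : 0 < L)
    (T : (Fin d → ℤ) → X → X)
    (hT0 : T 0 = id) (hTadd : ∀ g h, T (g + h) = T g ∘ T h)
    (hTmp : ∀ g, MeasurePreserving (T g) μ μ)
    (P : Fin k → (Fin L → ℤ) → ℤ) (v : Fin k → Fin d → ℤ)
    (Q : Fin k → MvPolynomial (Fin L) ℚ)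
    (hrep : ∀ i, RepresentedBy₁ (P i) (Q i))
    -- the family `n ↦ P_i(n)·v_i` is essentially distinct
    (hnc : ∀ i, ∃ n m : Fin L → ℤ, P i n • v i ≠ P i m • v i)
    (hed : ∀ i j, i ≠ j → ∃ n m : Fin L → ℤ,
      P i n • v i - P j n • v j ≠ P i m • v i - P j m • v j)
    -- the dependence assumption for polynomials of equal degree
    (hdep : ∀ i j, i ≠ j → (Q i).totalDegree = (Q j).totalDegree →
      (∃ a b : ℤ, (a, b) ≠ (0, 0) ∧ a • v i + b • v j = 0) ∨
      (∃ a b : ℤ, (a, b) ≠ (0, 0) ∧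
        ∀ n m : Fin L → ℤ, a * P i n + b * P j n = a * P i m + b * P j m)) :
    -- (C1) ↔ (C2')
    (JointlyErgodic μ T (fun i n => P i n • v i) ↔
      ((∀ i j, i ≠ j → (Q i).totalDegree = (Q j).totalDegree →
          ErgodicSeq μ T (fun n => P i n • v i - P j n • v j)) ∧
        ProdErgodic μ T (fun i n => P i n • v i))) ∧
    -- (C2') ↔ (C2)
    (((∀ i j, i ≠ j → (Q i).totalDegree = (Q j).totalDegree →
          ErgodicSeq μ T (fun n => P i n • v i - P j n • v j)) ∧
        ProdErgodic μ T (fun i n => P i n • v i)) ↔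
      ((∀ i j, i ≠ j → ErgodicSeq μ T (fun n => P i n • v i - P j n • v j)) ∧
        ProdErgodic μ T (fun i n => P i n • v i))) := by
  have hT : IsMPAction μ T := ⟨hT0, hTadd, hTmp⟩
  have h12 : JointlyErgodic μ T (fun i n => P i n • v i) →
      (∀ i j, i ≠ j → ErgodicSeq μ T (fun n => P i n • v i - P j n • v j)) ∧
        ProdErgodic μ T (fun i n => P i n • v i) := fun h =>
    ⟨fun _ _ hij => h.ergodicSeq_sub hT hrep hnc hed hdep hij, h.prodErgodic_smul hT hrep hnc⟩
  have h21 : ((∀ i j, i ≠ j → (Q i).totalDegree = (Q j).totalDegree →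
      ErgodicSeq μ T (fun n => P i n • v i - P j n • v j)) ∧
        ProdErgodic μ T (fun i n => P i n • v i)) →
      JointlyErgodic μ T (fun i n => P i n • v i) := fun h =>
    jointlyErgodic_of_prodErgodic hT hrep hnc hed hdep h.2 h.1
  exact ⟨⟨fun h => ⟨fun i j hij _ => (h12 h).1 i j hij, (h12 h).2⟩, h21⟩,
    fun h => h12 (h21 h), fun h => ⟨fun i j hij _ => h.1 i j hij, h.2⟩⟩
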